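/- Let L ⊂ ℙ² be a line over ℂ, p ∈ L a point, and 𝒱_{L,p} the closure in 𝒱 of the locus of reduced GIT-semistable plane quartics C with finite stabilizer such that L ⊄ C, L is an inflection line of C, and p is the non-reduced point of C ∩ L. Then the morphism ℱ: 𝒱 → Sym²⁴((ℙ²)∨) sending a quartic to its configuration of inflection lines restricts to an injective map on a non-empty Zariski-open subset of 𝒱_{L,p}. -/

import Mathlib

/-!
STATEMENT 1 (Pacini–Testa, Theorem `main`): fix a line `L ⊂ ℙ²` (with dual vector `w`)
and a point `p ∈ L`.  Let `𝒱 ⊂ ℙ¹⁴` be the locus of reduced GIT-semistable plane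
quartics with finite stabilizer, and `𝒱_{L,p} ⊆ 𝒱` the closure in `𝒱` of the locus
`𝒱⁰_{L,p}` of quartics `C ∈ 𝒱` with `L ⊄ C`, `L` an inflection line of `C` and `p` the
non-reduced point of `C ∩ L`.  Then the morphism `ℱ : 𝒱 → Sym²⁴((ℙ²)∨)` of limit
inflection-line configurations restricts to an injective map on a nonempty
(Zariski-)open subset of `𝒱_{L,p}`.

Formalization: configurations are multiplicity functions `μ` on lines, and `ℱ(C)` is
characterized as the scale-invariant limit configuration of `C` along all smoothings
(`IsLimitConfig`).  The nonempty open subset of `𝒱_{L,p}` is given by the nonvanishing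
of a polynomial `Φ` in the coefficients which does not vanish identically on
`𝒱_{L,p}`; injectivity means that two members of `𝒱_{L,p}` in this open set sharing a
configuration are equal in `ℙ¹⁴` (proportional quartics).
-/
open MvPolynomial Polynomial Filter

noncomputable section

namespace Infl

variable {K : Type*} [Field K]

def dotv (w p : Fin 3 → K) : K := ∑ i, w i * p i

def lineRestrict (F : MvPolynomial (Fin 3) K) (a b : Fin 3 → K) : Polynomial K :=
  MvPolynomial.aeval (fun i => Polynomial.C (a i) + Polynomial.C (b i) * Polynomial.X) F

def contactAt (F : MvPolynomial (Fin 3) K) (a b : Fin 3 → K) : ℕ :=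
  (lineRestrict F a b).rootMultiplicity 0

def IsSmoothCurve (F : MvPolynomial (Fin 3) K) (d : ℕ) : Prop :=
  F.IsHomogeneous d ∧ F ≠ 0 ∧
    ∀ p : Fin 3 → K, p ≠ 0 → eval p F = 0 → ∃ i, eval p (pderiv i F) ≠ 0

/-- `n - 2`, the inflectionary weight of a point of contact order `n` on a plane quartic. -/
def padm (n : ℕ) : ℕ := n - 2

/-- The multiplicity of the line through `a` and `b` in the configuration of the `24`
inflection lines (counted with multiplicity) of a smooth plane quartic `F`:
the sum, over the points of the line, of (contact order − 2). -/
def inflMultLine (F : MvPolynomial (Fin 3) ℂ) (a b : Fin 3 → ℂ) : ℕ :=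
  ((lineRestrict F a b).roots.toFinset.sum fun t =>
    padm ((lineRestrict F a b).rootMultiplicity t)) + padm (contactAt F b a)

/-- The multiplicity of the line `{dotv w ⬝ = 0}` in the configuration of inflection
lines of the smooth plane quartic `F` (junk value at non-lines). -/
def inflMultDual (F : MvPolynomial (Fin 3) ℂ) (w : Fin 3 → ℂ) : ℕ :=
  ⨆ a, ⨆ b, ⨆ _ : dotv w a = 0 ∧ dotv w b = 0 ∧ LinearIndependent ℂ ![a, b],
    inflMultLine F a b

/-- The projective plane dual: classes of nonzero vectors. -/
abbrev DualPlane := Projectivization ℂ (Fin 3 → ℂ)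

/-- `w` and `w₀` are `ε`-close up to scaling. -/
def projNear (ε : ℝ) (w w₀ : Fin 3 → ℂ) : Prop := ∃ c : ℂ, ‖c • w - w₀‖ < ε

open Classical in
/-- Total multiplicity of the inflection lines of `F` that are `ε`-close to `w₀`. -/
def inflNear (F : MvPolynomial (Fin 3) ℂ) (w₀ : Fin 3 → ℂ) (ε : ℝ) : ℕ :=
  ∑ᶠ l : DualPlane, if projNear ε l.rep w₀ then inflMultDual F l.rep else 0

/-- An algebraic family of plane quartics: a polynomial in `x₀,x₁,x₂` and the
parameter `t = X 3`; `fiberAt Q t` is the quartic at parameter value `t`. -/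
def fiberAt (Q : MvPolynomial (Fin 4) ℂ) (t : ℂ) : MvPolynomial (Fin 3) ℂ :=
  MvPolynomial.aeval
    (fun i : Fin 4 => if h : (i : ℕ) < 3 then X ⟨i, h⟩ else MvPolynomial.C t) Q

/-- `Q` is a smoothing of the plane quartic `F₀` to (general) smooth plane quartics. -/
def IsQuarticSmoothing (Q : MvPolynomial (Fin 4) ℂ) (F₀ : MvPolynomial (Fin 3) ℂ) : Prop :=
  fiberAt Q 0 = F₀ ∧ (∀ t, (fiberAt Q t).IsHomogeneous 4) ∧
    ∀ᶠ t in nhdsWithin (0 : ℂ) {0}ᶜ, IsSmoothCurve (fiberAt Q t) 4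

/-- `μ` is the limit, as `t → 0`, of the configurations of the `24` inflection lines of
the fibers of the family `Q`. -/
def IsLimitConfigAlong (Q : MvPolynomial (Fin 4) ℂ) (μ : (Fin 3 → ℂ) → ℕ) : Prop :=
  ∀ w₀ : Fin 3 → ℂ, w₀ ≠ 0 →
    ∀ᶠ ε in nhdsWithin (0 : ℝ) (Set.Ioi 0),
      ∀ᶠ t in nhdsWithin (0 : ℂ) {0}ᶜ, inflNear (fiberAt Q t) w₀ ε = μ w₀

/-- `μ` is *the* configuration of limit inflection lines of the quartic `F₀`: it is
scale invariant and is the limit of the configurations of inflection lines along every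
smoothing of `F₀` to plane quartics. -/
def IsLimitConfig (F₀ : MvPolynomial (Fin 3) ℂ) (μ : (Fin 3 → ℂ) → ℕ) : Prop :=
  (∀ c : ℂ, c ≠ 0 → ∀ w, μ (c • w) = μ w) ∧
    ∀ Q, IsQuarticSmoothing Q F₀ → IsLimitConfigAlong Q μ

def transformPoly (g : Matrix (Fin 3) (Fin 3) ℂ) (F : MvPolynomial (Fin 3) ℂ) :
    MvPolynomial (Fin 3) ℂ :=
  MvPolynomial.aeval (fun i => ∑ j, MvPolynomial.C (g i j) * X j) F

/-- GIT-semistability for plane quartics (Hilbert–Mumford criterion). -/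
def GITSemistable (F : MvPolynomial (Fin 3) ℂ) : Prop :=
  ∀ g : GL (Fin 3) ℂ, ∀ a : Fin 3 → ℤ, (∑ i, a i) = 0 →
    ∃ m ∈ (transformPoly (g : Matrix (Fin 3) (Fin 3) ℂ) F).support,
      (∑ i, (m i : ℤ) * a i) ≤ 0

/-- The stabilizer of `F` in `PGL₃` is finite. -/
def ProjStabFinite (F : MvPolynomial (Fin 3) ℂ) : Prop :=
  ∃ S : Set (Matrix (Fin 3) (Fin 3) ℂ), S.Finite ∧
    ∀ g : GL (Fin 3) ℂ, (∃ c : ℂ, c ≠ 0 ∧ transformPoly (g : Matrix (Fin 3) (Fin 3) ℂ) F = c • F) →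
      ∃ h ∈ S, ∃ c : ℂ, c ≠ 0 ∧ (g : Matrix (Fin 3) (Fin 3) ℂ) = c • h

/-- `[F] ∈ 𝒱`: `F` is a reduced plane quartic, GIT-semistable with finite stabilizer. -/
def memV (F : MvPolynomial (Fin 3) ℂ) : Prop :=
  F.IsHomogeneous 4 ∧ Squarefree F ∧ GITSemistable F ∧ ProjStabFinite F

/-- Evaluation of a polynomial `Φ` in the coefficients of plane quartics at `F`. -/
def coeffEval (Φ : MvPolynomial (Fin 3 →₀ ℕ) ℂ) (F : MvPolynomial (Fin 3) ℂ) : ℂ :=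
  MvPolynomial.eval (fun d => F.coeff d) Φ

/-- The Zariski closure, in the space of ternary quartics, of a set of quartics. -/
def ZarClosure (S : Set (MvPolynomial (Fin 3) ℂ)) : Set (MvPolynomial (Fin 3) ℂ) :=
  {F | ∀ Φ : MvPolynomial (Fin 3 →₀ ℕ) ℂ, (∀ G ∈ S, coeffEval Φ G = 0) → coeffEval Φ F = 0}


/-- `[C] ∈ 𝒱⁰_{L,p}`: `C ∈ 𝒱`, the line `L` dual to `w` is not contained in `C`, `L`
is an inflection line of `C` and `p` is the non-reduced point of `C ∩ L`. -/
def memV0Lp (w p : Fin 3 → ℂ) (F : MvPolynomial (Fin 3) ℂ) : Prop :=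
  memV F ∧ ∃ b : Fin 3 → ℂ, dotv w b = 0 ∧ LinearIndependent ℂ ![p, b] ∧
    lineRestrict F p b ≠ 0 ∧ 3 ≤ contactAt F p b

/-- `𝒱_{L,p}`: the closure in `𝒱` of `𝒱⁰_{L,p}`. -/
def memVLp (w p : Fin 3 → ℂ) (F : MvPolynomial (Fin 3) ℂ) : Prop :=
  memV F ∧ F ∈ ZarClosure {G | memV0Lp w p G}

/-- The invariant I of a binary quartic. -/
def bI (a b c d e : ℂ) : ℂ := 12*a*e - 3*b*d + c^2
/-- The invariant J of a binary quartic. -/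
def bJ (a b c d e : ℂ) : ℂ := 72*a*c*e + 9*b*c*d - 27*a*d^2 - 27*e*b^2 - 2*c^3
/-- The binary quartic. -/
def bq (a b c d e x y : ℂ) : ℂ := a*x^4 + b*x^3*y + c*x^2*y^2 + d*x*y^3 + e*y^4

def Tri (φ : ℂ → ℂ → ℂ) : Prop :=
  ∃ a b c d e, (∀ x y, φ x y = bq a b c d e x y) ∧ bI a b c d e = 0 ∧ bJ a b c d e = 0

lemma bq_inj {a b c d e a' b' c' d' e' : ℂ}
    (h : ∀ x y, bq a b c d e x y = bq a' b' c' d' e' x y) :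
    a = a' ∧ b = b' ∧ c = c' ∧ d = d' ∧ e = e' := by
  have h1 := h 1 0
  have h2 := h 0 1
  have h3 := h 1 1
  have h4 := h 1 (-1)
  have h5 := h 1 2
  simp only [bq] at h1 h2 h3 h4 h5
  refine ⟨?_, ?_, ?_, ?_, ?_⟩ <;> grind

lemma Tri_iff {φ : ℂ → ℂ → ℂ} {a b c d e : ℂ} (h : ∀ x y, φ x y = bq a b c d e x y) :
    Tri φ ↔ bI a b c d e = 0 ∧ bJ a b c d e = 0 := by
  constructor
  · rintro ⟨a', b', c', d', e', h', hI, hJ⟩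
    obtain ⟨rfl, rfl, rfl, rfl, rfl⟩ := bq_inj (fun x y => (h' x y).symm.trans (h x y))
    exact ⟨hI, hJ⟩
  · rintro ⟨hI, hJ⟩
    exact ⟨a, b, c, d, e, h, hI, hJ⟩

lemma Tri.comp {φ : ℂ → ℂ → ℂ} (h : Tri φ) (p q r s : ℂ) :
    Tri (fun x y => φ (p*x+q*y) (r*x+s*y)) := by
  obtain ⟨a, b, c, d, e, h, hI, hJ⟩ := h
  refine ⟨bq a b c d e p r,
    4*a*p^3*q + b*(3*p^2*q*r+p^3*s) + c*(2*p*q*r^2+2*p^2*r*s) + d*(q*r^3+3*p*r^2*s) + 4*e*r^3*s,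
    6*a*p^2*q^2 + b*(3*p*q^2*r+3*p^2*q*s) + c*(q^2*r^2+4*p*q*r*s+p^2*s^2)
      + d*(3*q*r^2*s+3*p*r*s^2) + 6*e*r^2*s^2,
    4*a*p*q^3 + b*(q^3*r+3*p*q^2*s) + c*(2*q^2*r*s+2*p*q*s^2) + d*(3*q*r*s^2+p*s^3) + 4*e*r*s^3,
    bq a b c d e q s, ?_, ?_, ?_⟩
  · intro x y; simp only [h]; simp only [bq]; ring
  · have : ∀ t : ℂ, t = (p*s-q*r)^4 * bI a b c d e → t = 0 := by
      intro t ht; rw [ht, hI, mul_zero]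
    apply this; simp only [bI, bq]; ring
  · have : ∀ t : ℂ, t = (p*s-q*r)^6 * bJ a b c d e → t = 0 := by
      intro t ht; rw [ht, hJ, mul_zero]
    apply this; simp only [bJ, bq]; ring

lemma Tri.smul {φ : ℂ → ℂ → ℂ} (h : Tri φ) (t : ℂ) : Tri (fun x y => t * φ x y) := by
  obtain ⟨a, b, c, d, e, h, hI, hJ⟩ := h
  refine ⟨t*a, t*b, t*c, t*d, t*e, fun x y => by simp only [h]; simp only [bq]; ring, ?_, ?_⟩
  · simp only [bI] at *; linear_combination t^2 * hI
  · simp only [bJ] at *; linear_combination t^3 * hJ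

/-- limits of binary quartics with `I = J = 0`. -/
lemma Tri.lim {φ : ℕ → ℂ → ℂ → ℂ} {ψ : ℂ → ℂ → ℂ} (h : ∀ n, Tri (φ n))
    (hl : ∀ x y, Tendsto (fun n => φ n x y) atTop (nhds (ψ x y))) : Tri ψ := by
  choose a b c d e hf hI hJ using h
  have ha : Tendsto a atTop (nhds (ψ 1 0)) := by
    refine (hl 1 0).congr fun n => ?_
    rw [hf]; simp [bq]
  have he : Tendsto e atTop (nhds (ψ 0 1)) := by
    refine (hl 0 1).congr fun n => ?_
    rw [hf]; simp [bq]
  have hc : Tendsto c atTop (nhds ((ψ 1 1 + ψ 1 (-1))/2 - ψ 1 0 - ψ 0 1)) := by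
    refine (((((hl 1 1).add (hl 1 (-1))).div_const 2).sub (hl 1 0)).sub (hl 0 1)).congr fun n => ?_
    simp only [hf, bq]; ring
  have hd : Tendsto d atTop (nhds ((ψ 1 2 - ψ 1 0 - 4*((ψ 1 1 + ψ 1 (-1))/2 - ψ 1 0 - ψ 0 1)
      - 16 * ψ 0 1 - (ψ 1 1 - ψ 1 (-1)))/6)) := by
    refine ((((((hl 1 2).sub (hl 1 0)).sub (hc.const_mul 4)).sub ((hl 0 1).const_mul 16)).sub
      ((hl 1 1).sub (hl 1 (-1)))).div_const 6).congr fun n => ?_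
    simp only [hf, bq]; ring
  have hb : Tendsto b atTop (nhds ((ψ 1 1 - ψ 1 (-1))/2 -
      ((ψ 1 2 - ψ 1 0 - 4*((ψ 1 1 + ψ 1 (-1))/2 - ψ 1 0 - ψ 0 1)
      - 16 * ψ 0 1 - (ψ 1 1 - ψ 1 (-1)))/6))) := by
    refine ((((hl 1 1).sub (hl 1 (-1))).div_const 2).sub hd).congr fun n => ?_
    simp only [hf, bq]; ring
  generalize ψ 1 0 = a' at ha
  generalize ((ψ 1 1 - ψ 1 (-1))/2 -
      ((ψ 1 2 - ψ 1 0 - 4*((ψ 1 1 + ψ 1 (-1))/2 - ψ 1 0 - ψ 0 1)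
      - 16 * ψ 0 1 - (ψ 1 1 - ψ 1 (-1)))/6)) = b' at hb
  generalize ((ψ 1 2 - ψ 1 0 - 4*((ψ 1 1 + ψ 1 (-1))/2 - ψ 1 0 - ψ 0 1)
      - 16 * ψ 0 1 - (ψ 1 1 - ψ 1 (-1)))/6) = d' at hd
  generalize ((ψ 1 1 + ψ 1 (-1))/2 - ψ 1 0 - ψ 0 1) = c' at hc
  generalize ψ 0 1 = e' at he
  refine ⟨a', b', c', d', e', ?_, ?_, ?_⟩
  · intro x y
    refine tendsto_nhds_unique (hl x y) ?_
    have : Tendsto (fun n => bq (a n) (b n) (c n) (d n) (e n) x y) atTop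
        (nhds (bq a' b' c' d' e' x y)) := by
      unfold bq
      exact ((((ha.mul_const _).add ((hb.mul_const _).mul_const _)).add
        ((hc.mul_const _).mul_const _)).add ((hd.mul_const _).mul_const _)).add (he.mul_const _)
    exact this.congr fun n => (hf n x y).symm
  · have : Tendsto (fun n => bI (a n) (b n) (c n) (d n) (e n)) atTop
        (nhds (bI a' b' c' d' e')) := by
      unfold bI
      exact (((ha.const_mul 12).mul he).sub ((hb.const_mul 3).mul hd)).add (hc.pow 2)
    simp only [hI] at this
    exact (tendsto_nhds_unique this tendsto_const_nhds)
  · have : Tendsto (fun n => bJ (a n) (b n) (c n) (d n) (e n)) atTop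
        (nhds (bJ a' b' c' d' e')) := by
      unfold bJ
      exact ((((((ha.const_mul 72).mul hc).mul he).add (((hb.const_mul 9).mul hc).mul hd)).sub
        ((ha.const_mul 27).mul (hd.pow 2))).sub ((he.const_mul 27).mul (hb.pow 2))).sub
          ((hc.pow 3).const_mul 2)
    simp only [hJ] at this
    exact (tendsto_nhds_unique this tendsto_const_nhds)

/-- A binary quartic with `I=J=0` has a triple root. -/
lemma exists_triple_aux {b c d e : ℂ} (hI : bI 0 b c d e = 0) (hJ : bJ 0 b c d e = 0) :
    ∃ u v r s : ℂ, (u ≠ 0 ∨ v ≠ 0) ∧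
      ∀ x y, bq 0 b c d e x y = (v*x - u*y)^3 * (r*x + s*y) := by
  simp only [bI, bJ] at hI hJ
  by_cases hb : b = 0
  · subst hb
    have hc : c = 0 := by
      have : c^2 = 0 := by linear_combination hI
      exact pow_eq_zero_iff (two_ne_zero) |>.1 this
    subst hc
    exact ⟨-1, 0, d, e, Or.inl (by norm_num), fun x y => by simp only [bq]; ring⟩
  · have hd : d = c^2/(3*b) := by
      rw [eq_div_iff (by simpa using hb)]; linear_combination -hI
    have he : e = c^3/(27*b^2) := by
      have h2 : 3*b*d = c^2 := by linear_combination -hI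
      rw [eq_div_iff (by simpa using hb)]; linear_combination -hJ + 3*c*h2
    refine ⟨-c/(3*b), 1, 0, b, Or.inr one_ne_zero, fun x y => ?_⟩
    rw [hd, he]; simp only [bq]; field_simp; ring

lemma exists_triple {a b c d e : ℂ} (hI : bI a b c d e = 0) (hJ : bJ a b c d e = 0) :
    ∃ u v r s : ℂ, (u ≠ 0 ∨ v ≠ 0) ∧
      ∀ x y, bq a b c d e x y = (v*x - u*y)^3 * (r*x + s*y) := by
  by_cases ha : a = 0
  · subst ha; exact exists_triple_aux hI hJ
  obtain ⟨t, ht⟩ : ∃ t : ℂ, bq a b c d e t 1 = 0 := by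
    have hdeg : (Polynomial.C a * Polynomial.X^4 + Polynomial.C b * Polynomial.X^3 +
      Polynomial.C c * Polynomial.X^2 + Polynomial.C d * Polynomial.X +
        Polynomial.C e : Polynomial ℂ).degree = 4 := by
      compute_degree!
    obtain ⟨t, ht⟩ := IsAlgClosed.exists_root _ (by rw [hdeg]; norm_num)
    refine ⟨t, ?_⟩
    simp [Polynomial.IsRoot] at ht
    simp only [bq]; linear_combination ht
  have h0 : Tri (fun x y => bq a b c d e x y) := ⟨a, b, c, d, e, fun _ _ => rfl, hI, hJ⟩
  obtain ⟨a', b', c', d', e', h', hI', hJ'⟩ := h0.comp t 1 1 0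
  have ha' : a' = 0 := by
    have := h' 1 0
    simp only [mul_one, mul_zero, add_zero, one_mul] at this
    rw [ht] at this
    simpa [bq] using this.symm
  subst ha'
  obtain ⟨u, v, r, s, huv, hh⟩ := exists_triple_aux hI' hJ'
  refine ⟨-(v + u*t), -u, s, r - s*t, ?_, fun x y => ?_⟩
  · by_cases hu : u = 0
    · left; subst hu; simpa using huv
    · right; simpa using hu
  · have h1 := h' y (x - t*y)
    have h2 := hh y (x - t*y)
    simp only [one_mul, zero_mul, add_zero] at h1
    rw [show t*y + (x - t*y) = x by ring] at h1
    rw [h1, h2]; ring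

/-- explicit triple root -/
lemma triple_formula {a b c d e : ℂ} (hI : bI a b c d e = 0) (hJ : bJ a b c d e = 0)
    (hH : 8*c*e - 3*d^2 ≠ 0) (x y : ℂ) :
    bq a b c d e x y = (y - (c*d-6*b*e)/(8*c*e-3*d^2) * x)^3 *
      (e*y + (d + 3*e*((c*d-6*b*e)/(8*c*e-3*d^2)))*x) := by
  obtain ⟨u, v, r, s, huv, hh⟩ := exists_triple hI hJ
  have hk : ∀ x y, bq a b c d e x y =
      bq (v^3*r) (v^3*s - 3*v^2*u*r) (3*v*u^2*r-3*v^2*u*s) (3*v*u^2*s-u^3*r) (-u^3*s) x y := by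
    intro x y; rw [hh]; simp only [bq]; ring
  obtain ⟨h1, h2, h3, h4, h5⟩ := bq_inj hk
  have hu : u ≠ 0 := by
    rintro rfl
    apply hH; rw [h3, h4, h5]; ring
  have hy : (c*d-6*b*e)/(8*c*e-3*d^2) = v/u := by
    rw [div_eq_div_iff hH hu, h2, h3, h4, h5]; ring
  rw [hy, hk, h4, h5]; simp only [bq]; field_simp; ring

/-- Ternary quartics, as functions; the fifteen coefficients in a convenient order. -/
def QF (k : Fin 15 → ℂ) (x y z : ℂ) : ℂ :=
  k 0 * x*y^3 + k 1 * y^4 + z*(k 2 * x^3 + k 3 * x^2*y + k 4 * x*y^2 + k 5 * y^3)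
  + z^2*(k 6 * x^2 + k 7 * x*y + k 8 * y^2) + z^3*(k 9 * x + k 10 * y) + k 11 * z^4
  + k 12 * x^4 + k 13 * x^3*y + k 14 * x^2*y^2

def IsQ (f : ℂ → ℂ → ℂ → ℂ) : Prop := ∃ k, ∀ x y z, f x y z = QF k x y z

lemma poly4_zero {a b c d e : ℂ} (h : ∀ t : ℂ, a + b*t + c*t^2 + d*t^3 + e*t^4 = 0) :
    a = 0 ∧ b = 0 ∧ c = 0 ∧ d = 0 ∧ e = 0 := by
  have h0 := h 0
  have h1 := h 1
  have h2 := h (-1)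
  have h3 := h 2
  have h4 := h (-2)
  refine ⟨?_, ?_, ?_, ?_, ?_⟩ <;> grind

def QFL : (Fin 15 → ℂ) →ₗ[ℂ] (ℂ → ℂ → ℂ → ℂ) where
  toFun := QF
  map_add' k l := by
    funext x y z; simp only [QF, Pi.add_apply]; ring
  map_smul' t k := by
    funext x y z; simp only [QF, Pi.smul_apply, smul_eq_mul, RingHom.id_apply]; ring

lemma QF_eq_zero {k : Fin 15 → ℂ} (h : ∀ x y z, QF k x y z = 0) : k = 0 := by
  have key : ∀ x z : ℂ, (k 12 * x^4 + k 2 * x^3*z + k 6*x^2*z^2 + k 9*x*z^3 + k 11*z^4 = 0 ∧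
      k 13 * x^3 + k 3 * x^2*z + k 7 *x*z^2 + k 10 * z^3 = 0 ∧
      k 14 * x^2 + k 4*x*z + k 8*z^2 = 0 ∧ k 0 * x + k 5 * z = 0 ∧ k 1 = 0) := by
    intro x z
    apply poly4_zero
    intro t
    have := h x t z
    simp only [QF] at this
    linear_combination this
  have a0 := poly4_zero (a := k 11) (b := k 9) (c := k 6) (d := k 2) (e := k 12)
    (fun t => by linear_combination (key t 1).1)
  have a1 := poly4_zero (a := k 10) (b := k 7) (c := k 3) (d := k 13) (e := 0)
    (fun t => by linear_combination (key t 1).2.1)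
  have a2 := poly4_zero (a := k 8) (b := k 4) (c := k 14) (d := 0) (e := 0)
    (fun t => by linear_combination (key t 1).2.2.1)
  have a3 := poly4_zero (a := k 5) (b := k 0) (c := 0) (d := 0) (e := 0)
    (fun t => by linear_combination (key t 1).2.2.2.1)
  have a4 := (key 0 0).2.2.2.2
  funext i
  fin_cases i <;> simp [a0, a1, a2, a3, a4]

lemma QFL_inj : Function.Injective QFL := by
  rw [← LinearMap.ker_eq_bot, LinearMap.ker_eq_bot']
  intro k hk
  apply QF_eq_zero
  intro x y z
  exact congrFun (congrFun (congrFun hk x) y) z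

lemma QF_inj {k l : Fin 15 → ℂ} (h : ∀ x y z, QF k x y z = QF l x y z) : k = l :=
  QFL_inj (by funext x y z; exact h x y z)

lemma QF_tendsto {k : ℕ → Fin 15 → ℂ} {l : Fin 15 → ℂ}
    (h : ∀ x y z, Tendsto (fun n => QF (k n) x y z) atTop (nhds (QF l x y z))) :
    Tendsto k atTop (nhds l) := by
  have := (LinearMap.isClosedEmbedding_of_injective (LinearMap.ker_eq_bot.2 QFL_inj)).isEmbedding
  rw [this.tendsto_nhds_iff]
  rw [tendsto_pi_nhds]; intro x
  rw [tendsto_pi_nhds]; intro y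
  rw [tendsto_pi_nhds]; intro z
  exact h x y z

lemma QF_cont : Continuous (fun q : (Fin 15 → ℂ) × ℂ × ℂ × ℂ => QF q.1 q.2.1 q.2.2.1 q.2.2.2) := by
  unfold QF
  fun_prop

lemma QF_lim {k : ℕ → Fin 15 → ℂ} {l : Fin 15 → ℂ} (h : Tendsto k atTop (nhds l))
    {x y z : ℕ → ℂ} {x' y' z' : ℂ} (hx : Tendsto x atTop (nhds x'))
    (hy : Tendsto y atTop (nhds y')) (hz : Tendsto z atTop (nhds z')) :
    Tendsto (fun n => QF (k n) (x n) (y n) (z n)) atTop (nhds (QF l x' y' z')) := by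
  have h1 : Tendsto (fun n => (k n, x n, y n, z n)) atTop (nhds (l, x', y', z')) :=
    h.prodMk_nhds (hx.prodMk_nhds (hy.prodMk_nhds hz))
  have h2 := QF_cont.tendsto (l, x', y', z')
  have h3 := h2.comp h1
  simp only [Function.comp_def] at h3
  exact h3

lemma IsQ.add {f g} (hf : IsQ f) (hg : IsQ g) : IsQ (fun x y z => f x y z + g x y z) := by
  obtain ⟨k, hk⟩ := hf
  obtain ⟨l, hl⟩ := hg
  refine ⟨k + l, fun x y z => ?_⟩
  simp only [hk, hl]; simp only [QF, Pi.add_apply]; ring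

lemma IsQ.smul {f} (hf : IsQ f) (t : ℂ) : IsQ (fun x y z => t * f x y z) := by
  obtain ⟨k, hk⟩ := hf
  refine ⟨t • k, fun x y z => ?_⟩
  simp only [hk]; simp only [QF, Pi.smul_apply, smul_eq_mul]; ring

def lf (u : Fin 3 → ℂ) (x y z : ℂ) : ℂ := u 0 * x + u 1 * y + u 2 * z

lemma lf_mul (u v : Fin 3 → ℂ) : ∃ q : Fin 6 → ℂ, ∀ x y z, lf u x y z * lf v x y z =
    q 0 * x^2 + q 1 * x*y + q 2 * x*z + q 3 * y^2 + q 4 * y*z + q 5 * z^2 := by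
  refine ⟨![u 0 * v 0, u 0 * v 1 + u 1 * v 0, u 0 * v 2 + u 2 * v 0, u 1 * v 1,
    u 1 * v 2 + u 2 * v 1, u 2 * v 2], fun x y z => ?_⟩
  simp [lf]; ring

lemma IsQ.prod4 (u v w t : Fin 3 → ℂ) :
    IsQ (fun x y z => lf u x y z * lf v x y z * (lf w x y z * lf t x y z)) := by
  obtain ⟨q, hq⟩ := lf_mul u v
  obtain ⟨r, hr⟩ := lf_mul w t
  refine ⟨![q 1 * r 3 + q 3 * r 1, q 3 * r 3, q 0 * r 2 + q 2 * r 0,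
    q 0 * r 4 + q 1 * r 2 + q 2 * r 1 + q 4 * r 0, q 1 * r 4 + q 2 * r 3 + q 3 * r 2 + q 4 * r 1,
    q 3 * r 4 + q 4 * r 3, q 0 * r 5 + q 2 * r 2 + q 5 * r 0,
    q 1 * r 5 + q 2 * r 4 + q 4 * r 2 + q 5 * r 1, q 3 * r 5 + q 4 * r 4 + q 5 * r 3,
    q 2 * r 5 + q 5 * r 2, q 4 * r 5 + q 5 * r 4, q 5 * r 5, q 0 * r 0, q 0 * r 1 + q 1 * r 0,
    q 0 * r 3 + q 1 * r 1 + q 3 * r 0], fun x y z => ?_⟩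
  simp only [hq, hr]
  simp [QF]; ring

lemma QF_sub (k : Fin 15 → ℂ) (u v w : Fin 3 → ℂ) :
    IsQ (fun x y z => QF k (lf u x y z) (lf v x y z) (lf w x y z)) := by
  have h := ((((((((((((((IsQ.prod4 u v v v).smul (k 0)).add ((IsQ.prod4 v v v v).smul (k 1))).add
    ((IsQ.prod4 w u u u).smul (k 2))).add ((IsQ.prod4 w u u v).smul (k 3))).add
    ((IsQ.prod4 w u v v).smul (k 4))).add ((IsQ.prod4 w v v v).smul (k 5))).add
    ((IsQ.prod4 w w u u).smul (k 6))).add ((IsQ.prod4 w w u v).smul (k 7))).add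
    ((IsQ.prod4 w w v v).smul (k 8))).add ((IsQ.prod4 w w w u).smul (k 9))).add
    ((IsQ.prod4 w w w v).smul (k 10))).add ((IsQ.prod4 w w w w).smul (k 11))).add
    ((IsQ.prod4 u u u u).smul (k 12))).add ((IsQ.prod4 u u u v).smul (k 13))
  obtain ⟨l, hl⟩ := h.add ((IsQ.prod4 u u v v).smul (k 14))
  refine ⟨l, fun x y z => ?_⟩
  rw [← hl]; simp only [QF]; ring

lemma IsQ.sub {f} (hf : IsQ f) (u v w : Fin 3 → ℂ) :
    IsQ (fun x y z => f (lf u x y z) (lf v x y z) (lf w x y z)) := by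
  obtain ⟨k, hk⟩ := hf
  obtain ⟨l, hl⟩ := QF_sub k u v w
  exact ⟨l, fun x y z => by simp only [hk]; exact hl x y z⟩

/-- Restriction of a quartic to a line is a binary quartic. -/
lemma IsQ.line {f} (hf : IsQ f) (u v : Fin 3 → ℂ) : ∃ a b c d e, ∀ s t,
    f (u 0 * s + v 0 * t) (u 1 * s + v 1 * t) (u 2 * s + v 2 * t) = bq a b c d e s t := by
  obtain ⟨l, hl⟩ := hf.sub ![u 0, v 0, 0] ![u 1, v 1, 0] ![u 2, v 2, 0]
  refine ⟨l 12, l 13, l 14, l 0, l 1, fun s t => ?_⟩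
  have := hl s t 0
  simp [lf, QF] at this
  rw [this]; simp only [bq]; ring

lemma Tri.lim' {φ : ℕ → ℂ → ℂ → ℂ} {ψ : ℂ → ℂ → ℂ} (h : ∀ᶠ n in atTop, Tri (φ n))
    (hl : ∀ x y, Tendsto (fun n => φ n x y) atTop (nhds (ψ x y))) : Tri ψ := by
  obtain ⟨N, hN⟩ := eventually_atTop.1 h
  refine Tri.lim (φ := fun n => φ (n + N)) (fun n => hN _ (Nat.le_add_left _ _)) fun x y => ?_
  exact (tendsto_add_atTop_iff_nat (f := fun n => φ n x y) N).2 (hl x y)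

lemma bq_lim {φ : ℕ → ℂ → ℂ → ℂ} {a b c d e : ℕ → ℂ} {a' b' c' d' e' : ℂ}
    (h : ∀ n x y, φ n x y = bq (a n) (b n) (c n) (d n) (e n) x y)
    (hl : ∀ x y, Tendsto (fun n => φ n x y) atTop (nhds (bq a' b' c' d' e' x y))) :
    Tendsto a atTop (nhds a') ∧ Tendsto b atTop (nhds b') ∧ Tendsto c atTop (nhds c') ∧
    Tendsto d atTop (nhds d') ∧ Tendsto e atTop (nhds e') := by
  have key : ∀ a b c d e x y z : ℂ,
      QF ![d, e, 0, 0, 0, 0, 0, 0, 0, 0, 0, 0, a, b, c] x y z = bq a b c d e x y := by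
    intro a b c d e x y z
    simp [QF, bq]; ring
  have := QF_tendsto (k := fun n => ![d n, e n, 0, 0, 0, 0, 0, 0, 0, 0, 0, 0, a n, b n, c n])
    (l := ![d', e', 0, 0, 0, 0, 0, 0, 0, 0, 0, 0, a', b', c']) (fun x y z => by
      simp only [key, ← h]; exact hl x y)
  rw [tendsto_pi_nhds] at this
  exact ⟨this 12, this 13, this 14, this 0, this 1⟩

def NoCube (f : ℂ → ℂ → ℂ → ℂ) : Prop :=
  ∀ a b l m n : ℂ, ¬ ∀ x y z, f x y z = (y - a*x - b*z)^3 * (l*x + m*y + n*z)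

lemma NoCube.comp {f} (h : NoCube f) {c τ : ℂ} (hc : c ≠ 0) (hτ : τ ≠ 0) (a b : ℂ) :
    NoCube (fun x y z => c * f x (τ*y + a*x + b*z) z) := by
  intro a' b' l m n hh
  refine h (a + τ*a') (b + τ*b') (c⁻¹ * τ⁻¹^3 * (l - m*τ⁻¹*a)) (c⁻¹ * τ⁻¹^3 * (m*τ⁻¹))
    (c⁻¹ * τ⁻¹^3 * (n - m*τ⁻¹*b)) fun x y z => ?_
  have := hh x ((y - a*x - b*z)/τ) z
  simp only at this
  rw [show τ*((y - a*x - b*z)/τ) + a*x + b*z = y by field_simp; ring] at this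
  have h2 : f x y z = c⁻¹ * (c * f x y z) := by field_simp
  rw [h2, this]; field_simp; ring

/-- the degree in `y` of the monomials -/
def yd : Fin 15 → ℕ := ![3, 4, 0, 1, 2, 3, 0, 1, 2, 0, 1, 0, 0, 1, 2]

lemma exists_norm_eq {g : Fin 15 → ℝ} : ∃ i, ‖g i‖ = ‖g‖ := by
  by_contra hne
  push Not at hne
  have h0 : 0 < ‖g‖ := lt_of_le_of_ne (norm_nonneg _) (fun h => by
    have hg : g = 0 := norm_eq_zero.1 h.symm
    exact hne 0 (by rw [hg]; simp))
  have := (pi_norm_lt_iff h0).2 (fun i => lt_of_le_of_ne (norm_le_pi_norm g i) (hne i))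
  exact lt_irrefl _ this

lemma weight_scale (w : Fin 15 → ℕ) (k : ℕ → Fin 15 → ℂ)
    (h0 : ∀ i, 0 < w i → Tendsto (fun n => k n i) atTop (nhds 0))
    (h1 : ∀ n, ∃ i, 0 < w i ∧ k n i ≠ 0) :
    ∃ τ : ℕ → ℝ, (∀ n, 0 < τ n) ∧ Tendsto τ atTop (nhds 0) ∧
      (∀ n i, 0 < w i → ‖k n i‖ ≤ τ n ^ w i) ∧
      (∀ n, ∃ i, 0 < w i ∧ ‖k n i‖ = τ n ^ w i) := by
  set g : ℕ → Fin 15 → ℝ := fun n i => if 0 < w i then ‖k n i‖ ^ ((w i : ℝ)⁻¹) else 0 with hg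
  have gpow : ∀ n i, 0 < w i → (g n i) ^ w i = ‖k n i‖ := by
    intro n i hi
    simp only [hg, if_pos hi]
    exact Real.rpow_inv_natCast_pow (norm_nonneg _) hi.ne'
  have gnn : ∀ n i, 0 ≤ g n i := by
    intro n i
    simp only [hg]; split_ifs
    · positivity
    · exact le_rfl
  refine ⟨fun n => ‖g n‖, ?_, ?_, ?_, ?_⟩
  · intro n
    obtain ⟨i, hi, hk⟩ := h1 n
    refine norm_pos_iff.2 fun h => ?_
    have := gpow n i hi
    rw [h] at this
    simp only [Pi.zero_apply, zero_pow hi.ne'] at this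
    exact hk (norm_eq_zero.1 this.symm)
  · have : Tendsto g atTop (nhds 0) := by
      rw [tendsto_pi_nhds]
      intro i
      by_cases hi : 0 < w i
      · have h2 := (h0 i hi).norm.rpow_const (p := ((w i : ℝ)⁻¹)) (Or.inr (by positivity))
        rw [norm_zero, Real.zero_rpow (by positivity)] at h2
        refine h2.congr fun n => ?_
        simp only [hg, if_pos hi]
      · refine tendsto_const_nhds.congr fun n => ?_
        simp only [hg, if_neg hi, Pi.zero_apply]
    simpa using this.norm
  · intro n i hi
    rw [← gpow n i hi]
    have := norm_le_pi_norm (g n) i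
    rw [Real.norm_of_nonneg (gnn n i)] at this
    exact pow_le_pow_left₀ (gnn n i) this _
  · intro n
    obtain ⟨i, hi⟩ := exists_norm_eq (g := g n)
    rw [Real.norm_of_nonneg (gnn n i)] at hi
    have hwi : 0 < w i := by
      by_contra hw
      have h3 : g n i = 0 := by simp only [hg, if_neg hw]
      rw [h3] at hi
      have h4 : g n = 0 := norm_eq_zero.1 hi.symm
      obtain ⟨i', hi', hk⟩ := h1 n
      have := gpow n i' hi'
      rw [h4] at this
      simp only [Pi.zero_apply, zero_pow hi'.ne'] at this
      exact hk (norm_eq_zero.1 this.symm)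
    exact ⟨i, hwi, by rw [← gpow n i hwi, hi]⟩

/-- Weighted rescaling in the `y` direction. -/
lemma rescale (m : ℕ) (k : ℕ → Fin 15 → ℂ) (l : Fin 15 → ℂ) (hk : Tendsto k atTop (nhds l))
    (hl : ∀ i, yd i < m → l i = 0) (hne : ∀ n, ∃ i, yd i < m ∧ k n i ≠ 0) :
    ∃ (φ : ℕ → ℕ) (τ : ℕ → ℂ) (K : ℕ → Fin 15 → ℂ) (K' : Fin 15 → ℂ), StrictMono φ ∧
      (∀ n, τ n ≠ 0) ∧ Tendsto τ atTop (nhds 0) ∧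
      (∀ n x y z, QF (K n) x y z = (τ n ^ m)⁻¹ * QF (k (φ n)) x (τ n * y) z) ∧
      Tendsto K atTop (nhds K') ∧ (∀ i, yd i = m → K' i = l i) ∧ (∀ i, m < yd i → K' i = 0) ∧
      ∃ i, yd i < m ∧ K' i ≠ 0 := by
  rw [tendsto_pi_nhds] at hk
  obtain ⟨τ, hτ, hτ0, hle, heq⟩ := weight_scale (fun i => m - yd i) k
    (fun i hi => by have := hk i; rwa [hl i (by omega)] at this)
    (fun n => by obtain ⟨i, hi, h⟩ := hne n; exact ⟨i, by omega, h⟩)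
  have hτc : ∀ n, (τ n : ℂ) ≠ 0 := fun n => by exact_mod_cast (hτ n).ne'
  have hτt : Tendsto (fun n => (τ n : ℂ)) atTop (nhds 0) := by
    have := (Complex.continuous_ofReal.tendsto 0).comp hτ0
    simpa [Function.comp_def] using this
  set K : ℕ → Fin 15 → ℂ := fun n i => k n i * (τ n : ℂ)^(yd i) / (τ n : ℂ)^m with hK
  have hKlow : ∀ n i, yd i < m → K n i = k n i / (τ n : ℂ)^(m - yd i) := by
    intro n i hi
    simp only [hK]
    rw [div_eq_div_iff (pow_ne_zero _ (hτc n)) (pow_ne_zero _ (hτc n)), mul_assoc, ← pow_add]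
    congr 2; omega
  set P : ℕ → Fin 15 → ℂ := fun n i => if yd i < m then K n i else 0 with hP
  have hPball : ∀ n, P n ∈ Metric.closedBall (0 : Fin 15 → ℂ) 1 := by
    intro n
    rw [mem_closedBall_zero_iff, pi_norm_le_iff_of_nonneg zero_le_one]
    intro i
    simp only [hP]
    split_ifs with hi
    · rw [hKlow n i hi, norm_div, norm_pow, Complex.norm_real, Real.norm_of_nonneg (hτ n).le]
      exact div_le_one_of_le₀ (hle n i (by omega)) (by have := hτ n; positivity)
    · simp
  have hPone : ∀ n, ‖P n‖ = 1 := by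
    intro n
    refine le_antisymm (by simpa using hPball n) ?_
    obtain ⟨i, hi, he⟩ := heq n
    have hi' : yd i < m := by omega
    refine le_trans ?_ (norm_le_pi_norm (P n) i)
    simp only [hP, if_pos hi']
    rw [hKlow n i hi', norm_div, norm_pow, Complex.norm_real, Real.norm_of_nonneg (hτ n).le, he,
      div_self (pow_ne_zero _ (hτ n).ne')]
  obtain ⟨P', -, φ, hφ, hPl⟩ := (isCompact_closedBall (0 : Fin 15 → ℂ) 1).tendsto_subseq hPball
  have hP' : ‖P'‖ = 1 := by
    have := hPl.norm
    simp only [Function.comp_def, hPone] at this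
    exact (tendsto_nhds_unique this tendsto_const_nhds)
  rw [tendsto_pi_nhds] at hPl
  refine ⟨φ, fun n => τ (φ n), fun n => K (φ n),
    fun i => if yd i < m then P' i else if yd i = m then l i else 0, hφ, fun n => hτc _,
    hτt.comp hφ.tendsto_atTop, ?_, ?_, ?_, ?_, ?_⟩
  · intro n x y z
    simp only [QF, hK]
    simp only [yd]
    simp
    ring
  · rw [tendsto_pi_nhds]
    intro i
    rcases lt_trichotomy (yd i) m with hi | hi | hi
    · simp only [if_pos hi]
      refine (hPl i).congr fun n => ?_
      simp only [Function.comp_def, hP, if_pos hi]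
    · simp only [if_neg hi.not_lt, if_pos hi]
      refine ((hk i).comp hφ.tendsto_atTop).congr fun n => ?_
      simp only [hK, Function.comp_def, hi]
      rw [mul_div_cancel_right₀ _ (pow_ne_zero _ (hτc _))]
    · simp only [if_neg hi.not_gt, if_neg hi.ne']
      have h3 := ((hk i).mul (hτt.pow (yd i - m))).comp hφ.tendsto_atTop
      rw [zero_pow (by omega), mul_zero] at h3
      refine h3.congr fun n => ?_
      simp only [hK, Function.comp_def]
      rw [eq_div_iff (pow_ne_zero _ (hτc _)), mul_assoc, ← pow_add]
      congr 2; omega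
  · intro i hi
    simp [hi]
  · intro i hi
    simp [hi.not_gt, hi.ne']
  · by_contra hcon
    push Not at hcon
    have hz : P' = 0 := by
      funext i
      by_cases hi : yd i < m
      · have := hcon i hi
        simpa [hi] using this
      · refine tendsto_nhds_unique (hPl i) (tendsto_const_nhds.congr fun n => ?_)
        simp [hP, if_neg hi]
    rw [hz] at hP'; simp at hP'

/-- The form on the line `x = s z + r y`. -/
def onLine (k : Fin 15 → ℂ) (s r : ℂ) : ℂ → ℂ → ℂ := fun z y => QF k (s*z + r*y) y z

/-- The form on the line `z = s x + r y`. -/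
def onLine' (k : Fin 15 → ℂ) (s r : ℂ) : ℂ → ℂ → ℂ := fun x y => QF k x y (s*x + r*y)

def TripleAt (φ : ℂ → ℂ → ℂ) (t : ℂ) : Prop :=
  ∃ l m, ∀ z y, φ z y = (y - t*z)^3 * (l*z + m*y)

lemma TripleAt.lim {φ : ℕ → ℂ → ℂ → ℂ} {ψ : ℂ → ℂ → ℂ} (h : ∀ᶠ n in atTop, TripleAt (φ n) 0)
    (hl : ∀ x y, Tendsto (fun n => φ n x y) atTop (nhds (ψ x y))) : TripleAt ψ 0 := by
  refine ⟨ψ 1 1 - ψ 0 1, ψ 0 1, fun z y => ?_⟩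
  have h1 : Tendsto (fun n => (y - 0*z)^3 * ((φ n 1 1 - φ n 0 1)*z + φ n 0 1*y)) atTop
      (nhds ((y - 0*z)^3 * ((ψ 1 1 - ψ 0 1)*z + ψ 0 1 * y))) :=
    ((((hl 1 1).sub (hl 0 1)).mul_const z).add ((hl 0 1).mul_const y)).const_mul _
  refine tendsto_nhds_unique (hl z y) (h1.congr' ?_)
  filter_upwards [h] with n hn
  obtain ⟨l, m, hlm⟩ := hn
  rw [hlm, hlm, hlm]; ring

lemma tdiv {f g : ℕ → ℂ} {a b : ℂ} (hf : Tendsto f atTop (nhds a)) (hg : Tendsto g atTop (nhds b))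
    (hb : b ≠ 0) : Tendsto (fun n => f n / g n) atTop (nhds (a / b)) := hf.div hg hb

lemma shift {ι : Type*} (k : ℕ → Fin 15 → ℂ) (k' : Fin 15 → ℂ) (hk : Tendsto k atTop (nhds k'))
    (s r : ℕ → ι → ℂ) (s' r' : ι → ℂ) (hs : ∀ j, Tendsto (fun n => s n j) atTop (nhds (s' j)))
    (hr : ∀ j, Tendsto (fun n => r n j) atTop (nhds (r' j)))
    (htri : ∀ j, ∀ᶠ n in atTop, Tri (onLine (k n) (s n j) (r n j)))
    (j0 j1 : ι) (hj : s' j0 ≠ s' j1) (y0 y1 : ℕ → ℂ) (hy0 : Tendsto y0 atTop (nhds 0))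
    (hy1 : Tendsto y1 atTop (nhds 0))
    (ht0 : ∀ᶠ n in atTop, TripleAt (onLine (k n) (s n j0) (r n j0)) (y0 n))
    (ht1 : ∀ᶠ n in atTop, TripleAt (onLine (k n) (s n j1) (r n j1)) (y1 n)) :
    ∃ (a b : ℕ → ℂ) (K : ℕ → Fin 15 → ℂ) (S R : ℕ → ι → ℂ), Tendsto a atTop (nhds 0) ∧
      Tendsto b atTop (nhds 0) ∧ 
      (∀ n x y z, QF (K n) x y z = QF (k n) x (y + a n * x + b n * z) z) ∧
      Tendsto K atTop (nhds k') ∧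
      (∀ j, Tendsto (fun n => S n j) atTop (nhds (s' j))) ∧
      (∀ j, Tendsto (fun n => R n j) atTop (nhds (r' j))) ∧
      (∀ j, ∀ᶠ n in atTop, Tri (onLine (K n) (S n j) (R n j))) ∧
      (∀ᶠ n in atTop, TripleAt (onLine (K n) (S n j0) (R n j0)) 0) ∧
      (∀ᶠ n in atTop, TripleAt (onLine (K n) (S n j1) (R n j1)) 0) := by
  have hX0 : Tendsto (fun n => s n j0 + r n j0 * y0 n) atTop (nhds (s' j0)) := by
    simpa using (hs j0).add ((hr j0).mul hy0)
  have hX1 : Tendsto (fun n => s n j1 + r n j1 * y1 n) atTop (nhds (s' j1)) := by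
    simpa using (hs j1).add ((hr j1).mul hy1)
  set X0 := fun n => s n j0 + r n j0 * y0 n with hX0d
  set X1 := fun n => s n j1 + r n j1 * y1 n with hX1d
  set a : ℕ → ℂ := fun n => (y0 n - y1 n)/(X0 n - X1 n) with ha
  set b : ℕ → ℂ := fun n => y0 n - a n * X0 n with hb
  have hat : Tendsto a atTop (nhds 0) := by
    simpa using tdiv (hy0.sub hy1) (hX0.sub hX1) (sub_ne_zero.2 hj)
  have hbt : Tendsto b atTop (nhds 0) := by
    simpa using hy0.sub (hat.mul hX0)
  have hXne : ∀ᶠ n in atTop, X0 n - X1 n ≠ 0 :=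
    (hX0.sub hX1).eventually_ne (sub_ne_zero.2 hj)
  have hra : ∀ j, Tendsto (fun n => 1 - r n j * a n) atTop (nhds 1) := by
    intro j; simpa using ((hr j).mul hat).const_sub 1
  have hrane : ∀ j, ∀ᶠ n in atTop, 1 - r n j * a n ≠ 0 := fun j =>
    (hra j).eventually_ne one_ne_zero
  have hK : ∀ n, ∃ K, ∀ x y z, QF (k n) x (y + a n * x + b n * z) z = QF K x y z := by
    intro n
    obtain ⟨l, hl⟩ := QF_sub (k n) ![1, 0, 0] ![a n, 1, b n] ![0, 0, 1]
    refine ⟨l, fun x y z => ?_⟩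
    rw [← hl]; simp only [lf]; simp
    congr 1; ring
  choose K hK using hK
  set S : ℕ → ι → ℂ := fun n j => s n j + r n j * (a n * s n j + b n)/(1 - r n j * a n) with hS
  set R : ℕ → ι → ℂ := fun n j => r n j / (1 - r n j * a n) with hR
  have hline : ∀ n j, 1 - r n j * a n ≠ 0 → ∀ z y, onLine (K n) (S n j) (R n j) z y =
      onLine (k n) (s n j) (r n j) z ((y + (a n * s n j + b n) * z)/(1 - r n j * a n)) := by
    intro n j hne z y
    simp only [onLine, ← hK]
    congr 1
    · simp only [hS, hR]; ring
    · simp only [hS, hR]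
      generalize a n = A at *
      generalize b n = B at *
      rw [eq_div_iff hne]
      linear_combination (A * z * (A * s n j + B) * r n j + A * r n j * y) *
        inv_mul_cancel₀ hne
  have hTriple : ∀ j t n, 1 - r n j * a n ≠ 0 → a n * (s n j + r n j * t) + b n = t →
      TripleAt (onLine (k n) (s n j) (r n j)) t → TripleAt (onLine (K n) (S n j) (R n j)) 0 := by
    rintro j t n hne hab ⟨l, m, h⟩
    refine ⟨(1 - r n j * a n)⁻¹^3 * (l + m * (a n * s n j + b n) * (1 - r n j * a n)⁻¹),
      (1 - r n j * a n)⁻¹^3 * (m * (1 - r n j * a n)⁻¹), fun z y => ?_⟩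
    rw [hline n j hne, h]
    rw [show (y + (a n * s n j + b n) * z)/(1 - r n j * a n) - t * z = y * (1 - r n j * a n)⁻¹ by
      rw [div_sub' hne, div_eq_mul_inv]; congr 1; linear_combination z * hab]
    rw [div_eq_mul_inv]; ring
  refine ⟨a, b, K, S, R, hat, hbt, fun n x y z => (hK n x y z).symm, ?_, ?_, ?_, ?_, ?_, ?_⟩
  · apply QF_tendsto
    intro x y z
    have h1 : Tendsto (fun n => y + a n * x + b n * z) atTop (nhds y) := by
      simpa using ((hat.mul_const x).const_add y).add (hbt.mul_const z)
    refine (QF_lim hk (tendsto_const_nhds (x := x)) h1 (tendsto_const_nhds (x := z))).congr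
      fun n => ?_
    rw [hK]
  · intro j
    have := (hs j).add (tdiv ((hr j).mul ((hat.mul (hs j)).add hbt)) (hra j) one_ne_zero)
    simpa using this
  · intro j
    simpa using tdiv (hr j) (hra j) one_ne_zero
  · intro j
    filter_upwards [htri j, hrane j] with n h1 h2
    have := h1.comp 1 0 ((a n * s n j + b n)/(1 - r n j * a n)) (1/(1 - r n j * a n))
    convert this using 3 with z y
    rw [hline n j h2]
    congr 1
    · ring
    · ring
  · filter_upwards [ht0, hrane j0] with n h1 h2
    refine hTriple j0 (y0 n) n h2 ?_ h1
    simp only [hb]; simp only [hX0d]; ring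
  · filter_upwards [ht1, hrane j1, hXne] with n h1 h2 h3
    refine hTriple j1 (y1 n) n h2 ?_ h1
    have : a n * (X0 n - X1 n) = y0 n - y1 n := by simp only [ha]; field_simp
    simp only [hb]; change a n * X1 n + _ = _; linear_combination -this

lemma poly_zero_of_roots {m : ℕ} (P : Polynomial ℂ) (hP : P.natDegree < m) (x : Fin m → ℂ)
    (hx : Function.Injective x) (h : ∀ j, P.eval (x j) = 0) : P = 0 :=
  Polynomial.eq_zero_of_natDegree_lt_card_of_eval_eq_zero P hx h (by simpa using hP)

lemma poly4_roots (x : Fin 5 → ℂ) (hx : Function.Injective x) {a b c d e : ℂ}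
    (h : ∀ j, a + b * x j + c * x j^2 + d * x j^3 + e * x j^4 = 0) :
    a = 0 ∧ b = 0 ∧ c = 0 ∧ d = 0 ∧ e = 0 := by
  have hP : (Polynomial.C a + Polynomial.C b * Polynomial.X + Polynomial.C c * Polynomial.X^2 +
      Polynomial.C d * Polynomial.X^3 + Polynomial.C e * Polynomial.X^4 : Polynomial ℂ) = 0 := by
    refine poly_zero_of_roots (m := 5) _ ?_ x hx fun j => ?_
    · refine lt_of_le_of_lt (b := 4) ?_ (by norm_num)
      compute_degree
    · simpa using h j
  apply poly4_zero
  intro t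
  have := congrArg (Polynomial.eval t) hP
  simpa using this

lemma QF_cube_of_low {K : Fin 15 → ℂ} (h : ∀ i, yd i < 3 → K i = 0) (x y z : ℂ) :
    QF K x y z = y^3 * (K 0 * x + K 1 * y + K 5 * z) := by
  simp only [QF, h 2 (by decide), h 3 (by decide), h 4 (by decide), h 6 (by decide),
    h 7 (by decide), h 8 (by decide), h 9 (by decide), h 10 (by decide), h 11 (by decide),
    h 12 (by decide), h 13 (by decide), h 14 (by decide)]
  ring

lemma zoom {ι : Type*} (m : ℕ) (hm : 3 ≤ m)
    (k : ℕ → Fin 15 → ℂ) (k' : Fin 15 → ℂ) (hk : Tendsto k atTop (nhds k'))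
    (hk' : ∀ i, yd i < m → k' i = 0)
    (s r : ℕ → ι → ℂ) (s' r' : ι → ℂ) (hs : ∀ j, Tendsto (fun n => s n j) atTop (nhds (s' j)))
    (hr : ∀ j, Tendsto (fun n => r n j) atTop (nhds (r' j)))
    (htri : ∀ j, ∀ᶠ n in atTop, Tri (onLine (k n) (s n j) (r n j)))
    (hnc : ∀ n, NoCube (QF (k n)))
    (j0 j1 : ι) (hj : s' j0 ≠ s' j1) (y0 y1 : ℕ → ℂ) (hy0 : Tendsto y0 atTop (nhds 0))
    (hy1 : Tendsto y1 atTop (nhds 0))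
    (ht0 : ∀ᶠ n in atTop, TripleAt (onLine (k n) (s n j0) (r n j0)) (y0 n))
    (ht1 : ∀ᶠ n in atTop, TripleAt (onLine (k n) (s n j1) (r n j1)) (y1 n)) :
    ∃ (φ : ℕ → ℕ) (a b τ : ℕ → ℂ) (K : ℕ → Fin 15 → ℂ) (K' : Fin 15 → ℂ) (S R : ℕ → ι → ℂ),
      StrictMono φ ∧ Tendsto a atTop (nhds 0) ∧
      Tendsto b atTop (nhds 0) ∧ (∀ n, τ n ≠ 0) ∧ Tendsto τ atTop (nhds 0) ∧
      (∀ n x y z, QF (K n) x y z =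
        (τ n ^ m)⁻¹ * QF (k (φ n)) x (τ n * y + a n * x + b n * z) z) ∧
      Tendsto K atTop (nhds K') ∧ (∀ i, yd i = m → K' i = k' i) ∧ (∀ i, m < yd i → K' i = 0) ∧
      (∃ i, yd i < m ∧ K' i ≠ 0) ∧
      (∀ j, Tendsto (fun n => S n j) atTop (nhds (s' j))) ∧
      (∀ j, Tendsto (fun n => R n j) atTop (nhds 0)) ∧
      (∀ j, ∀ᶠ n in atTop, Tri (onLine (K n) (S n j) (R n j))) ∧
      (∀ n, NoCube (QF (K n))) ∧
      TripleAt (onLine K' (s' j0) 0) 0 ∧ TripleAt (onLine K' (s' j1) 0) 0 := by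
  obtain ⟨a, b, K₁, S₁, R₁, ha, hb, hK₁, hK₁t, hS₁, hR₁, htri₁, ht0₁, ht1₁⟩ :=
    shift k k' hk s r s' r' hs hr htri j0 j1 hj y0 y1 hy0 hy1 ht0 ht1
  have hnc₁ : ∀ n, NoCube (QF (K₁ n)) := by
    intro n
    have := (hnc n).comp (one_ne_zero) (one_ne_zero) (a n) (b n)
    convert this using 4 with x y z
    rw [hK₁]; simp
  obtain ⟨φ, τ, K, K', hφ, hτ, hτt, hK, hKt, hKeq, hKgt, hKne⟩ := rescale m K₁ k' hK₁t hk' (by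
    intro n
    by_contra hcon
    push Not at hcon
    refine hnc₁ n 0 0 (K₁ n 0) (K₁ n 1) (K₁ n 5) fun x y z => ?_
    rw [QF_cube_of_low (fun i hi => hcon i (lt_of_lt_of_le hi hm))]; ring)
  have hline : ∀ n j z y, onLine (K n) (S₁ (φ n) j) (R₁ (φ n) j * τ n) z y =
      (τ n ^ m)⁻¹ * onLine (K₁ (φ n)) (S₁ (φ n) j) (R₁ (φ n) j) z (τ n * y) := by
    intro n j z y
    simp only [onLine, hK]; congr 2; ring
  have hS : ∀ j, Tendsto (fun n => S₁ (φ n) j) atTop (nhds (s' j)) := fun j =>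
    (hS₁ j).comp hφ.tendsto_atTop
  have hR : ∀ j, Tendsto (fun n => R₁ (φ n) j * τ n) atTop (nhds 0) := fun j => by
    have := ((hR₁ j).comp hφ.tendsto_atTop).mul hτt
    simpa using this
  have hlim : ∀ j z y, Tendsto (fun n => onLine (K n) (S₁ (φ n) j) (R₁ (φ n) j * τ n) z y) atTop
      (nhds (onLine K' (s' j) 0 z y)) := fun j z y =>
    QF_lim hKt (((hS j).mul_const z).add ((hR j).mul_const y)) tendsto_const_nhds
      tendsto_const_nhds
  have htrip : ∀ j n, TripleAt (onLine (K₁ (φ n)) (S₁ (φ n) j) (R₁ (φ n) j)) 0 →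
      TripleAt (onLine (K n) (S₁ (φ n) j) (R₁ (φ n) j * τ n)) 0 := by
    rintro j n ⟨l, p, h⟩
    refine ⟨(τ n ^ m)⁻¹ * τ n ^ 3 * l, (τ n ^ m)⁻¹ * τ n ^ 4 * p, fun z y => ?_⟩
    rw [hline, h]; ring
  refine ⟨φ, fun n => a (φ n), fun n => b (φ n), τ, K, K', fun n j => S₁ (φ n) j,
    fun n j => R₁ (φ n) j * τ n, hφ, ha.comp hφ.tendsto_atTop, hb.comp hφ.tendsto_atTop, hτ, hτt,
    ?_, hKt, hKeq, hKgt, hKne, hS, hR, ?_, ?_, ?_, ?_⟩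
  · intro n x y z
    rw [hK, hK₁]
  · intro j
    filter_upwards [hφ.tendsto_atTop.eventually (htri₁ j)] with n hn
    have := (hn.comp 1 0 0 (τ n)).smul ((τ n ^ m)⁻¹)
    convert this using 3 with z y
    rw [hline]; congr 2
    · ring
    · ring
  · intro n
    have := (hnc₁ (φ n)).comp (inv_ne_zero (pow_ne_zero m (hτ n))) (hτ n) 0 0
    convert this using 4 with x y z
    rw [hK]; simp
  · refine TripleAt.lim ?_ (hlim j0)
    filter_upwards [hφ.tendsto_atTop.eventually ht0₁] with n hn using htrip _ _ hn
  · refine TripleAt.lim ?_ (hlim j1)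
    filter_upwards [hφ.tendsto_atTop.eventually ht1₁] with n hn using htrip _ _ hn

lemma onLine_bq (k : Fin 15 → ℂ) (s r : ℂ) :
    ∃ a b c d e, ∀ z y, onLine k s r z y = bq a b c d e z y := by
  obtain ⟨a, b, c, d, e, h⟩ := IsQ.line (f := QF k) ⟨k, fun _ _ _ => rfl⟩ ![s, 0, 1] ![r, 1, 0]
  refine ⟨a, b, c, d, e, fun z y => ?_⟩
  have := h z y
  simp at this
  exact this

lemma onLine_zero_bq (K : Fin 15 → ℂ) (s z y : ℂ) : onLine K s 0 z y =
    bq (K 12 * s^4 + K 2 * s^3 + K 6 * s^2 + K 9 * s + K 11)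
      (K 13 * s^3 + K 3 * s^2 + K 7 * s + K 10) (K 14 * s^2 + K 4 * s + K 8) (K 0 * s + K 5)
      (K 1) z y := by
  simp only [onLine, QF, bq]; ring

lemma TripleAt.low {K : Fin 15 → ℂ} {s : ℂ} (h : TripleAt (onLine K s 0) 0) :
    K 12 * s^4 + K 2 * s^3 + K 6 * s^2 + K 9 * s + K 11 = 0 ∧
      K 13 * s^3 + K 3 * s^2 + K 7 * s + K 10 = 0 ∧ K 14 * s^2 + K 4 * s + K 8 = 0 := by
  obtain ⟨l, m, h⟩ := h
  have : ∀ z y, bq (K 12 * s^4 + K 2 * s^3 + K 6 * s^2 + K 9 * s + K 11)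
      (K 13 * s^3 + K 3 * s^2 + K 7 * s + K 10) (K 14 * s^2 + K 4 * s + K 8) (K 0 * s + K 5)
      (K 1) z y = bq 0 0 0 l m z y := by
    intro z y
    rw [← onLine_zero_bq, h]; simp only [bq]; ring
  have := bq_inj this
  exact ⟨this.1, this.2.1, this.2.2.1⟩

/-- Elimination lemma, type A. -/
lemma ELA (k : ℕ → Fin 15 → ℂ) (k' : Fin 15 → ℂ) (hk : Tendsto k atTop (nhds k'))
    (hk' : ∀ i, yd i < 3 → k' i = 0)
    (s r : ℕ → Fin 5 → ℂ) (s' r' : Fin 5 → ℂ)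
    (hs : ∀ j, Tendsto (fun n => s n j) atTop (nhds (s' j)))
    (hr : ∀ j, Tendsto (fun n => r n j) atTop (nhds (r' j)))
    (hinj : Function.Injective s') (hn : ∀ j, k' 0 * s' j + k' 5 ≠ 0)
    (htri : ∀ j, ∀ᶠ n in atTop, Tri (onLine (k n) (s n j) (r n j)))
    (hnc : ∀ n, NoCube (QF (k n))) : False := by
  have htrip : ∀ j, ∃ y : ℕ → ℂ, Tendsto y atTop (nhds 0) ∧
      ∀ᶠ n in atTop, TripleAt (onLine (k n) (s n j) (r n j)) (y n) := by
    intro j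
    choose a b c d e h using fun n => onLine_bq (k n) (s n j) (r n j)
    obtain ⟨ha, hb, hc, hd, he⟩ := bq_lim (a' := 0) (b' := 0) (c' := 0)
      (d' := k' 0 * s' j + k' 5) (e' := k' 0 * r' j + k' 1) h (fun z y => by
        have := QF_lim hk (((hs j).mul_const z).add ((hr j).mul_const y))
          (tendsto_const_nhds (x := y)) (tendsto_const_nhds (x := z))
        have e : bq 0 0 0 (k' 0 * s' j + k' 5) (k' 0 * r' j + k' 1) z y =
            QF k' (s' j * z + r' j * y) y z := by
          rw [QF_cube_of_low hk']; simp only [bq]; ring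
        rw [e]; exact this)
    have hH : Tendsto (fun n => 8 * c n * e n - 3 * d n ^ 2) atTop
        (nhds (8 * 0 * (k' 0 * r' j + k' 1) - 3 * (k' 0 * s' j + k' 5)^2)) :=
      ((hc.const_mul 8).mul he).sub ((hd.pow 2).const_mul 3)
    have hN : Tendsto (fun n => c n * d n - 6 * b n * e n) atTop
        (nhds (0 * (k' 0 * s' j + k' 5) - 6 * 0 * (k' 0 * r' j + k' 1))) :=
      (hc.mul hd).sub ((hb.const_mul 6).mul he)
    have hne : 8 * 0 * (k' 0 * r' j + k' 1) - 3 * (k' 0 * s' j + k' 5)^2 ≠ 0 := by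
      simpa using hn j
    refine ⟨fun n => (c n * d n - 6 * b n * e n)/(8 * c n * e n - 3 * d n ^ 2), ?_, ?_⟩
    · simpa using tdiv hN hH hne
    · filter_upwards [hH.eventually_ne hne, htri j] with n h1 h2
      obtain ⟨hI, hJ⟩ := (Tri_iff (h n)).1 h2
      refine ⟨d n + 3 * e n * ((c n * d n - 6 * b n * e n)/(8 * c n * e n - 3 * d n ^ 2)),
        e n, fun z y => ?_⟩
      rw [h, triple_formula hI hJ h1]; rw [add_comm (e n * y)]
  obtain ⟨y0, hy0, ht0⟩ := htrip 0
  obtain ⟨y1, hy1, ht1⟩ := htrip 1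
  have h01 : s' 0 ≠ s' 1 := fun h => by simpa using hinj h
  obtain ⟨φ, a, b, τ, K, K', S, R, -, -, -, -, -, -, hK, hK3, hK4, hKne, hS, hR, hTri, -, hL0, hL1⟩ :=
    zoom 3 le_rfl k k' hk hk' s r s' r' hs hr htri hnc 0 1 h01 y0 y1 hy0 hy1 ht0 ht1
  have hlim : ∀ j, Tri (onLine K' (s' j) 0) := by
    intro j
    refine Tri.lim' (hTri j) fun z y => ?_
    exact QF_lim hK (((hS j).mul_const z).add ((hR j).mul_const y)) tendsto_const_nhds
      tendsto_const_nhds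
  have hIJ := fun j => (Tri_iff (onLine_zero_bq K' (s' j))).1 (hlim j)
  simp only [bI, bJ, hK4 1 (by decide)] at hIJ
  have hn' : ∀ j, K' 0 * s' j + K' 5 ≠ 0 := by
    intro j; rw [hK3 0 (by decide), hK3 5 (by decide)]; exact hn j
  obtain ⟨-, -, c0⟩ := hL0.low
  obtain ⟨-, -, c1⟩ := hL1.low
  -- A2 is a multiple of (x - s0)(x - s1)
  have e4 : K' 4 = - K' 14 * (s' 0 + s' 1) := by
    have : (s' 0 - s' 1) * (K' 4 + K' 14 * (s' 0 + s' 1)) = 0 := by linear_combination c0 - c1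
    rcases mul_eq_zero.1 this with h | h
    · exact absurd (sub_eq_zero.1 h) h01
    · linear_combination h
  have e8 : K' 8 = K' 14 * (s' 0 * s' 1) := by
    rw [e4] at c0; linear_combination c0
  obtain ⟨p0, p1, p2, p3, p4⟩ := poly4_roots s' hinj
    (a := K' 8^2 - 3 * K' 10 * K' 5) (b := 2 * K' 8 * K' 4 - 3 * (K' 10 * K' 0 + K' 7 * K' 5))
    (c := K' 4^2 + 2 * K' 14 * K' 8 - 3 * (K' 7 * K' 0 + K' 3 * K' 5))
    (d := 2 * K' 14 * K' 4 - 3 * (K' 3 * K' 0 + K' 13 * K' 5)) (e := K' 14^2 - 3 * K' 13 * K' 0)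
    (fun j => by linear_combination (hIJ j).1)
  have hid : ∀ x, (K' 14 * ((x - s' 0) * (x - s' 1)))^2 =
      3 * (K' 13 * x^3 + K' 3 * x^2 + K' 7 * x + K' 10) * (K' 0 * x + K' 5) := by
    intro x
    rw [show K' 14 * ((x - s' 0) * (x - s' 1)) = K' 14 * x^2 + K' 4 * x + K' 8 by
      rw [e4, e8]; ring]
    linear_combination p0 + x * p1 + x^2 * p2 + x^3 * p3 + x^4 * p4
  have h14 : K' 14 = 0 := by
    by_cases h0 : K' 0 = 0
    · rw [h0] at p4
      have : K' 14 ^2 = 0 := by linear_combination p4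
      simpa using this
    · have h2 := hid (-K' 5 / K' 0)
      rw [show K' 0 * (-K' 5 / K' 0) + K' 5 = 0 by field_simp; ring, mul_zero] at h2
      have h3 : K' 14 * ((-K' 5 / K' 0 - s' 0) * (-K' 5 / K' 0 - s' 1)) = 0 := by
        simpa using h2
      rcases mul_eq_zero.1 h3 with h | h
      · exact h
      · exfalso
        rcases mul_eq_zero.1 h with h | h
        · apply hn' 0; rw [← sub_eq_zero.1 h]; field_simp; ring
        · apply hn' 1; rw [← sub_eq_zero.1 h]; field_simp; ring
  have h4 : K' 4 = 0 := by rw [e4, h14]; ring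
  have h8 : K' 8 = 0 := by rw [e8, h14]; ring
  have hA1 : ∀ j, K' 13 * s' j^3 + K' 3 * s' j^2 + K' 7 * s' j + K' 10 = 0 := by
    intro j
    have := (hIJ j).1
    rw [h14, h4, h8] at this
    have h5 : (K' 13 * s' j^3 + K' 3 * s' j^2 + K' 7 * s' j + K' 10) * (K' 0 * s' j + K' 5) = 0 := by
      linear_combination (-1/3) * this
    exact (mul_eq_zero.1 h5).resolve_right (hn' j)
  obtain ⟨q0, q1, q2, q3, -⟩ := poly4_roots s' hinj
    (a := K' 10) (b := K' 7) (c := K' 3) (d := K' 13) (e := 0)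
    (fun j => by linear_combination hA1 j)
  obtain ⟨o0, o1, o2, o3, o4⟩ := poly4_roots s' hinj
    (a := K' 11) (b := K' 9) (c := K' 6) (d := K' 2) (e := K' 12) (fun j => by
      have := (hIJ j).2
      rw [h14, h4, h8, q0, q1, q2, q3] at this
      have h5 : (K' 11 + K' 9 * s' j + K' 6 * s' j^2 + K' 2 * s' j^3 + K' 12 * s' j^4) *
          (K' 0 * s' j + K' 5)^2 = 0 := by
        linear_combination (-1/27) * this
      exact (mul_eq_zero.1 h5).resolve_right (pow_ne_zero _ (hn' j)))
  obtain ⟨i, hi, hne⟩ := hKne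
  apply hne
  fin_cases i <;> first | assumption | (exfalso; revert hi; decide)

lemma root_small {a b c d e t : ℕ → ℂ} {κ : ℂ} (hκ : κ ≠ 0) (ha : Tendsto a atTop (nhds 0))
    (hb : Tendsto b atTop (nhds 0)) (hc : Tendsto c atTop (nhds 0)) (hd : Tendsto d atTop (nhds 0))
    (he : Tendsto e atTop (nhds κ))
    (h : ∀ᶠ n in atTop, a n + b n * t n + c n * t n^2 + d n * t n^3 + e n * t n^4 = 0) :
    Tendsto t atTop (nhds 0) := by
  rw [Metric.tendsto_nhds]
  intro δ hδ
  set x : ℕ → ℂ := fun n => if δ ≤ ‖t n‖ then (t n)⁻¹ else 0 with hx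
  have hxb : ∀ n, ‖x n‖ ≤ δ⁻¹ := by
    intro n
    simp only [hx]
    split_ifs with h1
    · rw [norm_inv]; exact inv_anti₀ hδ h1
    · simp [hδ.le]
  have hz : ∀ (f : ℕ → ℂ) (m : ℕ), Tendsto f atTop (nhds 0) →
      Tendsto (fun n => f n * x n ^ m) atTop (nhds 0) := by
    intro f m hf
    refine squeeze_zero_norm (a := fun n => ‖f n‖ * δ⁻¹ ^ m) (fun n => ?_) ?_
    · rw [norm_mul, norm_pow]
      gcongr
      exact hxb n
    · simpa using (hf.norm).mul_const (δ⁻¹ ^ m)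
  have hT := ((((hz a 4 ha).add (hz b 3 hb)).add (hz c 2 hc)).add (hz d 1 hd)).add he
  simp only [add_zero, zero_add] at hT
  filter_upwards [hT.eventually_ne hκ, h] with n h1 h2
  rw [dist_zero_right]
  by_contra h3
  push Not at h3
  have ht : t n ≠ 0 := by
    intro h4; rw [h4] at h3; simp at h3; linarith
  apply h1
  simp only [hx, if_pos h3]
  have : (a n + b n * t n + c n * t n^2 + d n * t n^3 + e n * t n^4) * (t n)⁻¹^4 = 0 := by
    rw [h2, zero_mul]
  field_simp at this ⊢
  linear_combination this

lemma poly3_roots (x : Fin 4 → ℂ) (hx : Function.Injective x) {a b c d : ℂ}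
    (h : ∀ j, a + b * x j + c * x j^2 + d * x j^3 = 0) :
    a = 0 ∧ b = 0 ∧ c = 0 ∧ d = 0 := by
  have hP : (Polynomial.C a + Polynomial.C b * Polynomial.X + Polynomial.C c * Polynomial.X^2 +
      Polynomial.C d * Polynomial.X^3 : Polynomial ℂ) = 0 := by
    refine poly_zero_of_roots (m := 4) _ ?_ x hx fun j => ?_
    · refine lt_of_le_of_lt (b := 3) ?_ (by norm_num)
      compute_degree
    · simpa using h j
  have : a = 0 ∧ b = 0 ∧ c = 0 ∧ d = 0 ∧ (0:ℂ) = 0 := by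
    apply poly4_zero
    intro t
    have := congrArg (Polynomial.eval t) hP
    simp at this
    linear_combination this
  tauto

/-- a quadratic expression vanishing at four points vanishes everywhere -/
lemma quad_roots (x : Fin 4 → ℂ) (hx : Function.Injective x) (f : ℂ → ℂ) (a b c : ℂ)
    (hf : ∀ t, f t = a + b * t + c * t^2) (h : ∀ j, f (x j) = 0) (t : ℂ) : f t = 0 := by
  obtain ⟨h1, h2, h3, -⟩ := poly3_roots x hx (a := a) (b := b) (c := c) (d := 0)
    (fun j => by have := h j; rw [hf] at this; linear_combination this)
  rw [hf, h1, h2, h3]; ring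

lemma lin_zero {x0 x1 a b : ℂ} (h01 : x0 ≠ x1) (h0 : a * x0 + b = 0) (h1 : a * x1 + b = 0) :
    a = 0 ∧ b = 0 := by
  have : (x0 - x1) * a = 0 := by linear_combination h0 - h1
  have ha : a = 0 := (mul_eq_zero.1 this).resolve_left (sub_ne_zero.2 h01)
  subst ha
  exact ⟨rfl, by linear_combination h0⟩

section
variable {e x0 x1 κ l m p q : ℂ}

/-- The polynomial `P` of the elimination lemma of type B. -/
def PB (e x0 x1 κ l m p q x : ℂ) : ℂ :=
  108*e*κ*((x-x0)*(x-x1))*((l*x+m)*(p*x+q)) - 32*e*κ^3*((x-x0)*(x-x1))^2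
   - 27*((l*x+m)*(p*x+q)^3) + 9*κ^2*((x-x0)*(x-x1))*(p*x+q)^2 - 108*e^2*((x-x0)*(x-x1))*(l*x+m)^2

lemma PB_deg3 (hlead : 108*e*κ*l*p - 32*e*κ^3 - 27*l*p^3 + 9*κ^2*p^2 - 108*e^2*l^2 = 0) :
    ∃ a b c d, ∀ x, PB e x0 x1 κ l m p q x = a + b*x + c*x^2 + d*x^3 := by
  set f := PB e x0 x1 κ l m p q with hf
  refine ⟨f 0, f 1 - f 0 - (f 1 + f (-1) - 2*f 0)/2 - (f 2 - 2 * f 1 + f 0 - (f 1 + f (-1) - 2*f 0))/6,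
    (f 1 + f (-1) - 2*f 0)/2,
    (f 2 - 2 * f 1 + f 0 - (f 1 + f (-1) - 2*f 0))/6, fun x => ?_⟩
  simp only [hf, PB]
  linear_combination (x^4-2*x^3-x^2+2*x) * hlead

lemma algB2 (he : e ≠ 0) (h01 : x0 ≠ x1) (s : Fin 4 → ℂ)
    (hs : Function.Injective s) (hs0 : ∀ j, s j ≠ x0) (hs1 : ∀ j, s j ≠ x1)
    (hP : ∀ x, PB e x0 x1 κ 0 0 p q x = 0) : κ = 0 := by
  by_contra hκ
  have h1 := quad_roots s hs (fun x => 9*(p*x+q)^2 - 32*e*κ*((x-x0)*(x-x1)))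
    (9*q^2-32*e*κ*(x0*x1)) (18*p*q+32*e*κ*(x0+x1)) (9*p^2-32*e*κ) (fun t => by ring) (fun j => by
      have := hP (s j)
      have h3 : (κ^2*((s j-x0)*(s j-x1))) *
          (9*(p*(s j)+q)^2 - 32*e*κ*((s j-x0)*(s j-x1))) = 0 := by
        simp only [PB] at this; linear_combination this
      exact (mul_eq_zero.1 h3).resolve_left (mul_ne_zero (pow_ne_zero _ hκ)
        (mul_ne_zero (sub_ne_zero.2 (hs0 j)) (sub_ne_zero.2 (hs1 j)))))
  have h2 : p*x0+q = 0 := by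
    have := h1 x0; simp at this; exact this
  have h3 : p*x1+q = 0 := by
    have := h1 x1; simp at this; exact this
  obtain ⟨rfl, rfl⟩ := lin_zero h01 h2 h3
  have h4 := h1 (s 0)
  simp only [zero_mul, add_zero] at h4
  have h5 : (32*e*κ)*((s 0-x0)*(s 0-x1)) = 0 := by linear_combination -h4
  rcases mul_eq_zero.1 h5 with h | h
  · rcases mul_eq_zero.1 h with h | h
    · exact he (by simpa using h)
    · exact hκ h
  · exact (mul_ne_zero (sub_ne_zero.2 (hs0 0)) (sub_ne_zero.2 (hs1 0))) h

lemma algB3 (he : e ≠ 0) (h01 : x0 ≠ x1) (s : Fin 4 → ℂ)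
    (hs : Function.Injective s) (hs0 : ∀ j, s j ≠ x0) (hs1 : ∀ j, s j ≠ x1)
    (hP : ∀ x, PB e x0 x1 κ l m p q x = 0) (h0 : p*x0+q = 0) (h1 : l*x1+m = 0) :
    l = 0 := by
  obtain rfl : q = -p*x0 := by linear_combination h0
  obtain rfl : m = -l*x1 := by linear_combination h1
  have h1 := quad_roots s hs (fun x => 108*e*κ*p*l*((x-x0)*(x-x1)) - 32*e*κ^3*((x-x0)*(x-x1))
      - 27*p^3*l*(x-x0)^2 + 9*κ^2*p^2*(x-x0)^2 - 108*e^2*l^2*(x-x1)^2)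
    ((108*e*κ*p*l- 32*e*κ^3)*(x0*x1) + (-27*p^3*l+9*κ^2*p^2)*x0^2 - 108*e^2*l^2*x1^2)
    (-(108*e*κ*p*l- 32*e*κ^3)*(x0+x1) - 2*(-27*p^3*l+9*κ^2*p^2)*x0 + 2*108*e^2*l^2*x1)
    (108*e*κ*p*l- 32*e*κ^3 + (-27*p^3*l+9*κ^2*p^2) - 108*e^2*l^2) (fun t => by ring) (fun j => by
      have := hP (s j)
      simp only [PB] at this
      have hne : ((s j-x0)*(s j-x1)) ≠ 0 :=
        (mul_ne_zero (sub_ne_zero.2 (hs0 j)) (sub_ne_zero.2 (hs1 j)))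
      refine (mul_eq_zero_iff_left hne).1 ?_
      linear_combination this)
  have h2 := h1 x0
  simp only [sub_self, zero_mul, mul_zero] at h2
  have h3 : (e*(x0-x1)*l)^2 = 0 := by linear_combination (-1/108)*h2
  have h4 : e*(x0-x1)*l = 0 := by simpa using h3
  exact (mul_eq_zero.1 h4).resolve_left (mul_ne_zero he (sub_ne_zero.2 h01))

lemma algB (he : e ≠ 0) (h01 : x0 ≠ x1) (s : Fin 4 → ℂ)
    (hs : Function.Injective s) (hs0 : ∀ j, s j ≠ x0) (hs1 : ∀ j, s j ≠ x1)
    (hP : ∀ j, PB e x0 x1 κ l m p q (s j) = 0)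
    (hlead : 108*e*κ*l*p - 32*e*κ^3 - 27*l*p^3 + 9*κ^2*p^2 - 108*e^2*l^2 = 0) :
    κ = 0 ∧ l = 0 ∧ m = 0 := by
  have hP' : ∀ x, PB e x0 x1 κ l m p q x = 0 := by
    obtain ⟨a, b, c, d, h⟩ := PB_deg3 (x0 := x0) (x1 := x1) (m := m) (q := q) hlead
    obtain ⟨rfl, rfl, rfl, rfl⟩ := poly3_roots s hs (fun j => by rw [← h]; exact hP j)
    intro x; rw [h]; ring
  suffices hlm : l = 0 ∧ m = 0 by
    obtain ⟨rfl, rfl⟩ := hlm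
    exact ⟨algB2 he h01 s hs hs0 hs1 hP', rfl, rfl⟩
  have e0 : (l*x0+m)*(p*x0+q)^3 = 0 := by
    have := hP' x0; simp only [PB, sub_self, zero_mul, mul_zero] at this
    linear_combination (-1/27)*this
  have e1 : (l*x1+m)*(p*x1+q)^3 = 0 := by
    have := hP' x1; simp only [PB, sub_self, zero_mul, mul_zero] at this
    linear_combination (-1/27)*this
  rcases mul_eq_zero.1 e0 with e0 | e0 <;> rcases mul_eq_zero.1 e1 with e1 | e1
  · exact lin_zero h01 e0 e1
  · have e1 : p*x1+q = 0 := by simpa using e1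
    have := algB3 he h01.symm s hs hs1 hs0 (κ := κ) (l := l) (m := m) (p := p) (q := q) (fun x => by
      rw [← hP' x]; simp only [PB]; ring) e1 e0
    subst this
    exact ⟨rfl, by linear_combination e0⟩
  · have e0 : p*x0+q = 0 := by simpa using e0
    have := algB3 he h01 s hs hs0 hs1 hP' e0 e1
    subst this
    exact ⟨rfl, by linear_combination e1⟩
  · have e0 : p*x0+q = 0 := by simpa using e0
    have e1 : p*x1+q = 0 := by simpa using e1
    obtain ⟨rfl, rfl⟩ := lin_zero h01 e0 e1
    have h1 := quad_roots s hs (fun x => 8*κ^3*((x-x0)*(x-x1)) + 27*e*(l*x+m)^2)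
      (8*κ^3*(x0*x1) + 27*e*m^2) (-8*κ^3*(x0+x1) + 54*e*l*m) (8*κ^3 + 27*e*l^2)
      (fun t => by ring) (fun j => by
        have := hP j
        simp only [PB] at this
        have hne : e*((s j-x0)*(s j-x1)) ≠ 0 := mul_ne_zero he
          (mul_ne_zero (sub_ne_zero.2 (hs0 j)) (sub_ne_zero.2 (hs1 j)))
        refine (mul_eq_zero_iff_left hne).1 ?_
        linear_combination (-1/4) * this)
    refine lin_zero h01 ?_ ?_
    · have := h1 x0; simp [he] at this; exact this
    · have := h1 x1; simp [he] at this; exact this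
end

lemma onLine'_zero_bq (K : Fin 15 → ℂ) (x y : ℂ) : onLine' K 0 0 x y =
    bq (K 12) (K 13) (K 14) (K 0) (K 1) x y := by
  simp only [onLine', QF, bq]; ring

lemma infLine {k K : Fin 15 → ℂ} {c a b τ ε ρ : ℂ}
    (h : ∀ x y z, QF K x y z = c * QF k x (τ * y + a * x + b * z) z) (hρ : 1 - ρ * b ≠ 0)
    (ht : Tri (onLine' k ε ρ)) :
    Tri (onLine' K ((ε + ρ * a) / (1 - ρ * b)) (ρ * τ / (1 - ρ * b))) := by
  have := (ht.comp 1 0 (a + b * ((ε + ρ * a) / (1 - ρ * b)))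
    (τ + b * (ρ * τ / (1 - ρ * b)))).smul c
  convert this using 3 with x y
  simp only [onLine', h]
  congr 2
  · ring
  · ring
  · field_simp; ring

/-- Elimination lemma, type B. -/
lemma ELB (k : ℕ → Fin 15 → ℂ) (k' : Fin 15 → ℂ) (hk : Tendsto k atTop (nhds k'))
    (hk' : ∀ i, yd i < 4 → k' i = 0) (hk1 : k' 1 ≠ 0)
    (s r : ℕ → Fin 6 → ℂ) (s' r' : Fin 6 → ℂ)
    (hs : ∀ j, Tendsto (fun n => s n j) atTop (nhds (s' j)))
    (hr : ∀ j, Tendsto (fun n => r n j) atTop (nhds (r' j)))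
    (hinj : Function.Injective s')
    (htri : ∀ j, ∀ᶠ n in atTop, Tri (onLine (k n) (s n j) (r n j)))
    (ε ρ : ℕ → ℂ) (ρ' : ℂ) (hε : Tendsto ε atTop (nhds 0)) (hρ : Tendsto ρ atTop (nhds ρ'))
    (hinf : ∀ᶠ n in atTop, Tri (onLine' (k n) (ε n) (ρ n)))
    (hnc : ∀ n, NoCube (QF (k n))) : False := by
  have htrip : ∀ j, ∃ y : ℕ → ℂ, Tendsto y atTop (nhds 0) ∧
      ∀ᶠ n in atTop, TripleAt (onLine (k n) (s n j) (r n j)) (y n) := by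
    intro j
    choose a b c d e h using fun n => onLine_bq (k n) (s n j) (r n j)
    obtain ⟨ha, hb, hc, hd, he⟩ := bq_lim (a' := 0) (b' := 0) (c' := 0)
      (d' := 0) (e' := k' 1) h (fun z y => by
        have := QF_lim hk (((hs j).mul_const z).add ((hr j).mul_const y))
          (tendsto_const_nhds (x := y)) (tendsto_const_nhds (x := z))
        have e : bq 0 0 0 0 (k' 1) z y = QF k' (s' j * z + r' j * y) y z := by
          rw [QF_cube_of_low (fun i hi => hk' i (by omega)), hk' 0 (by decide), hk' 5 (by decide)]
          simp only [bq]; ring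
        rw [e]; exact this)
    have key : ∀ n, ∃ t : ℂ, e n ≠ 0 → Tri (onLine (k n) (s n j) (r n j)) →
        TripleAt (onLine (k n) (s n j) (r n j)) t := by
      intro n
      by_cases hh : e n ≠ 0 ∧ Tri (onLine (k n) (s n j) (r n j))
      · obtain ⟨he, ht⟩ := hh
        obtain ⟨hI, hJ⟩ := (Tri_iff (h n)).1 ht
        obtain ⟨u, v, p, q, -, hf⟩ := exists_triple hI hJ
        have hu : u ≠ 0 := by
          rintro rfl
          have := hf 0 1
          simp [bq] at this; exact he this
        refine ⟨v/u, fun _ _ => ⟨-u^3*p, -u^3*q, fun z y => ?_⟩⟩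
        rw [h, hf]
        field_simp; ring
      · exact ⟨0, fun h1 h2 => absurd ⟨h1, h2⟩ hh⟩
    choose y hy using key
    have hev : ∀ᶠ n in atTop, TripleAt (onLine (k n) (s n j) (r n j)) (y n) := by
      filter_upwards [he.eventually_ne hk1, htri j] with n h1 h2 using hy n h1 h2
    refine ⟨y, ?_, hev⟩
    refine root_small hk1 ha hb hc hd he ?_
    filter_upwards [hev] with n hn
    obtain ⟨l, m, hl⟩ := hn
    have := hl 1 (y n)
    rw [h] at this
    simp only [bq] at this
    linear_combination this
  obtain ⟨y0, hy0, ht0⟩ := htrip 0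
  obtain ⟨y1, hy1, ht1⟩ := htrip 1
  have h01 : s' 0 ≠ s' 1 := fun h => by simpa using hinj h
  obtain ⟨φ, a, b, τ, K, K', S, R, hφ, ha, hb, hτ, hτt, hKeq, hK, hK3, hK4, hKne, hS, hR, hTri,
    hnc', hL0, hL1⟩ :=
    zoom 4 (by norm_num) k k' hk hk' s r s' r' hs hr htri hnc 0 1 h01 y0 y1 hy0 hy1 ht0 ht1
  have hlim : ∀ j, Tri (onLine K' (s' j) 0) := by
    intro j
    refine Tri.lim' (hTri j) fun z y => ?_
    exact QF_lim hK (((hS j).mul_const z).add ((hR j).mul_const y)) tendsto_const_nhds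
      tendsto_const_nhds
  have hinfl : Tri (onLine' K' 0 0) := by
    have hρφ := hρ.comp hφ.tendsto_atTop
    have hεφ := hε.comp hφ.tendsto_atTop
    have hden : Tendsto (fun n => 1 - ρ (φ n) * b n) atTop (nhds (1 - ρ' * 0)) :=
      tendsto_const_nhds.sub (hρφ.mul hb)
    have h1 : Tendsto (fun n => (ε (φ n) + ρ (φ n) * a n) / (1 - ρ (φ n) * b n)) atTop
        (nhds ((0 + ρ' * 0)/(1 - ρ' * 0))) :=
      tdiv (hεφ.add (hρφ.mul ha)) hden (by simp)
    have h2 : Tendsto (fun n => (ρ (φ n) * τ n) / (1 - ρ (φ n) * b n)) atTop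
        (nhds ((ρ' * 0)/(1 - ρ' * 0))) :=
      tdiv (hρφ.mul hτt) hden (by simp)
    simp only [mul_zero, sub_zero, add_zero, zero_div] at h1 h2
    refine Tri.lim' (φ := fun n => onLine' (K n) ((ε (φ n) + ρ (φ n) * a n) / (1 - ρ (φ n) * b n))
      ((ρ (φ n) * τ n) / (1 - ρ (φ n) * b n))) ?_ fun x y => ?_
    · filter_upwards [hφ.tendsto_atTop.eventually hinf, hden.eventually_ne (show 1 - ρ' * 0 ≠ 0 by simp)] with n i1 i2
      exact infLine (hKeq n) i2 i1
    · exact QF_lim hK tendsto_const_nhds tendsto_const_nhds ((h1.mul_const x).add (h2.mul_const y))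
  have hIJ := fun j => (Tri_iff (onLine_zero_bq K' (s' j))).1 (hlim j)
  obtain ⟨iI, iJ⟩ := (Tri_iff (onLine'_zero_bq K')).1 hinfl
  have he : K' 1 ≠ 0 := by rw [hK3 1 (by decide)]; exact hk1
  simp only [bI, bJ] at hIJ iI iJ
  obtain ⟨-, b0, c0⟩ := hL0.low
  obtain ⟨-, b1, c1⟩ := hL1.low
  have hd01 := sub_ne_zero.2 h01
  have e4 : K' 4 = - K' 14 * (s' 0 + s' 1) := by
    have : (s' 0 - s' 1) * (K' 4 + K' 14 * (s' 0 + s' 1)) = 0 := by linear_combination c0 - c1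
    linear_combination (mul_eq_zero.1 this).resolve_left hd01
  have e8 : K' 8 = K' 14 * (s' 0 * s' 1) := by
    rw [e4] at c0; linear_combination c0
  obtain ⟨m, hm⟩ : ∃ m, m = K' 3 + K' 13 * (s' 0 + s' 1) := ⟨_, rfl⟩
  have e3 : K' 3 = m - K' 13 * (s' 0 + s' 1) := by rw [hm]; ring
  have e7 : K' 7 = K' 13 * (s' 0 * s' 1) - m * (s' 0 + s' 1) := by
    have : (s' 0 - s' 1) * (K' 7 - (K' 13 * (s' 0 * s' 1) - m * (s' 0 + s' 1))) = 0 := by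
      rw [hm]; linear_combination b0 - b1
    linear_combination (mul_eq_zero.1 this).resolve_left hd01
  have e10 : K' 10 = m * (s' 0 * s' 1) := by
    rw [e7, e3] at b0; linear_combination b0
  set ι : Fin 4 → Fin 6 := fun j => ⟨j + 2, by omega⟩ with hι
  have hιinj : Function.Injective ι := by
    intro i j h; simp only [hι, Fin.mk.injEq] at h; ext; omega
  have hi0 : ∀ j, s' (ι j) ≠ s' 0 := fun j h => by
    have := congrArg Fin.val (hinj h); simp [hι] at this
  have hi1 : ∀ j, s' (ι j) ≠ s' 1 := fun j h => by
    have := congrArg Fin.val (hinj h); simp [hι] at this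
  obtain ⟨h14, h13, hm0⟩ := algB (κ := K' 14) (l := K' 13) (m := m) (p := K' 0) (q := K' 5)
    he h01 (fun j => s' (ι j)) (fun i j h => hιinj (hinj h)) hi0 hi1
    (fun j => by
      obtain ⟨i1, i2⟩ := hIJ (ι j)
      have hA2 : K' 14 * s' (ι j)^2 + K' 4 * s' (ι j) + K' 8 =
          K' 14 * ((s' (ι j) - s' 0) * (s' (ι j) - s' 1)) := by rw [e4, e8]; ring
      have hA1 : K' 13 * s' (ι j)^3 + K' 3 * s' (ι j)^2 + K' 7 * s' (ι j) + K' 10 =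
          (K' 13 * s' (ι j) + m) * ((s' (ι j) - s' 0) * (s' (ι j) - s' 1)) := by
        rw [e3, e7, e10]; ring
      rw [hA1, hA2] at i1 i2
      have hne : ((s' (ι j)-s' 0)*(s' (ι j)-s' 1)) ≠ 0 :=
        (mul_ne_zero (sub_ne_zero.2 (hi0 j)) (sub_ne_zero.2 (hi1 j)))
      refine (mul_eq_zero_iff_left hne).1 ?_
      simp only [PB]
      generalize K' 12 * s' (ι j)^4 + K' 2 * s' (ι j)^3 + K' 6 * s' (ι j)^2 + K' 9 * s' (ι j) +
        K' 11 = A0 at i1 i2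
      linear_combination 4 * K' 1 * i2 - (24 * K' 1 * K' 14 * ((s' (ι j) - s' 0) *
        (s' (ι j) - s' 1)) - 9 * (K' 0 * s' (ι j) + K' 5)^2) * i1)
    (by linear_combination 4 * K' 1 * iJ - (24 * K' 1 * K' 14 - 9 * K' 0^2) * iI)
  clear_value ι
  clear hιinj hi0 hi1 hι ι
  subst hm0
  rw [h14] at e4 e8
  rw [h13] at e3 e7
  simp only [zero_mul, neg_zero, sub_zero] at e4 e8 e3 e7 e10
  obtain ⟨o0, o1, o2, o3, o4⟩ := poly4_roots (fun j : Fin 5 => s' j.castSucc)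
    (fun i j h => Fin.castSucc_injective _ (hinj h))
    (a := K' 11) (b := K' 9) (c := K' 6) (d := K' 2) (e := K' 12) (fun j => by
      have := (hIJ j.castSucc).1
      rw [h14, e4, e8, h13, e3, e7, e10] at this
      refine (mul_eq_zero_iff_left he).1 ?_
      linear_combination (1/12) * this)
  have hlow : ∀ i, yd i < 3 → K' i = 0 := by
    intro i hi
    fin_cases i <;> first | assumption | (exfalso; revert hi; decide)
  have h05 : K' 0 ≠ 0 ∨ K' 5 ≠ 0 := by
    obtain ⟨i, hi, hne⟩ := hKne
    by_contra hcon
    push Not at hcon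
    apply hne
    obtain ⟨p0, p5⟩ := hcon
    clear hne
    fin_cases i <;> first | assumption | (exfalso; revert hi; decide)
  obtain ⟨j0, hj0⟩ : ∃ j0 : Fin 6, ∀ j, j ≠ j0 → K' 0 * s' j + K' 5 ≠ 0 := by
    by_cases hz : ∃ j, K' 0 * s' j + K' 5 = 0
    · obtain ⟨j0, hz⟩ := hz
      refine ⟨j0, fun j hj hz' => ?_⟩
      have := lin_zero (fun h => hj (hinj h)) hz' hz
      tauto
    · push Not at hz
      exact ⟨0, fun j _ => hz j⟩
  exact ELA K K' hK hlow (fun n j => S n (j0.succAbove j)) (fun n j => R n (j0.succAbove j))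
    (fun j => s' (j0.succAbove j)) (fun _ => 0) (fun j => hS _) (fun j => hR _)
    (fun i j h => Fin.succAbove_right_injective (hinj h)) (fun j => hj0 _ (Fin.succAbove_ne _ _))
    (fun j => hTri _) hnc'

/-- the quartic whose roots (with 1 and 4) parametrise the flexes -/
def qx (a : ℂ) : ℂ := a^4-4*a^3+2*a-2

lemma qx_pair {b c : ℂ} (hb : qx b = 0) (hc : qx c = 0) (hbc : b ≠ c) :
    ∃ q, b*c+q+(b+c)*(4-(b+c))=0 ∧ b*c*q=-2 ∧ b*c*(4-(b+c))+q*(b+c)=-2 ∧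
      ∀ a, qx a = 0 → a ≠ b → a ≠ c → a^2-(4-(b+c))*a+q = 0 := by
  have hne := sub_ne_zero.2 hbc
  simp only [qx] at *
  have h3 : b^3+b^2*c+b*c^2+c^3-4*(b^2+b*c+c^2)+2 = 0 := by
    refine (mul_eq_zero_iff_left hne).1 ?_
    linear_combination hb - hc
  refine ⟨-(b*c+(b+c)*(4-(b+c))), by ring, ?_, ?_, ?_⟩
  · linear_combination (b) * h3 - hb
  · linear_combination h3
  · intro a ha h1 h2
    have hn : (a-b)*(a-c) ≠ 0 := mul_ne_zero (sub_ne_zero.2 h1) (sub_ne_zero.2 h2)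
    refine (mul_eq_zero_iff_left hn).1 ?_
    linear_combination ha - (a-b)*h3 - hb

lemma qx_ne_one {a : ℂ} (h : qx a = 0) : a ≠ 1 := by simp only [qx] at h; grind
lemma qx_ne_four {a : ℂ} (h : qx a = 0) : a ≠ 4 := by simp only [qx] at h; grind
lemma qx_ne_zero {a : ℂ} (h : qx a = 0) : a ≠ 0 := by simp only [qx] at h; grind
lemma qx_b {a b : ℂ} (h : qx a = 0) (hb : qx b = 0) : 4 * a ≠ b := by
  rintro rfl; simp only [qx] at *; grind
lemma qx_a {a b : ℂ} (h : qx a = 0) (hb : qx b = 0) (hab : a ≠ b) : a * b ≠ 4 := by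
  obtain ⟨q, h1, h2, h3, -⟩ := qx_pair h hb hab
  intro h4
  rw [h4] at h1 h2 h3
  generalize a + b = s at *
  clear h hb hab
  grind
lemma qx_c {a b c : ℂ} (ha : qx a = 0) (hb : qx b = 0) (hc : qx c = 0) (hab : a ≠ b) (hac : a ≠ c)
    (hbc : b ≠ c) : b * c ≠ a := by
  obtain ⟨q, h1, h2, h3, h4⟩ := qx_pair hb hc hbc
  intro h5
  replace h4 := h4 a ha hab hac
  rw [h5] at h1 h2 h3
  generalize b + c = s at *
  clear ha hb hc hab hac hbc h5
  obtain rfl : q = a*(4-s-a) := by linear_combination h4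
  grind
lemma qx_d {a b c : ℂ} (ha : qx a = 0) (hb : qx b = 0) (hc : qx c = 0) (hab : a ≠ b) (hac : a ≠ c)
    (hbc : b ≠ c) : b * c ≠ 4 * a := by
  obtain ⟨q, h1, h2, h3, h4⟩ := qx_pair hb hc hbc
  intro h5
  replace h4 := h4 a ha hab hac
  rw [h5] at h1 h2 h3
  generalize b + c = s at *
  clear ha hb hc hab hac hbc h5
  obtain rfl : q = a*(4-s-a) := by linear_combination h4
  grind
lemma qx_e {a b c d : ℂ} (ha : qx a = 0) (hb : qx b = 0) (hc : qx c = 0) (hd : qx d = 0)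
    (hab : a ≠ b) (hac : a ≠ c) (had : a ≠ d)
    (hbc : b ≠ c) (hbd : b ≠ d) (hcd : c ≠ d) : a * b ≠ c * d := by
  obtain ⟨q, h1, h2, h3, h4⟩ := qx_pair ha hb hab
  intro h5
  have i1 := h4 c hc hac.symm hbc.symm
  have i2 := h4 d hd had.symm hbd.symm
  have i3 : c + d - (4 - (a+b)) = 0 := by
    refine (mul_eq_zero_iff_left (sub_ne_zero.2 hcd)).1 ?_
    linear_combination i1 - i2
  have i4 : q = c * d := by linear_combination i1 - c * i3
  subst i4
  rw [← h5] at h1 h2 h3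
  generalize a + b = s at *
  generalize a * b = p at *
  clear i1 i2 i3 h4 h5 ha hb hc hd
  grind
lemma qx_n1 {a : ℂ} (h : qx a = 0) : a^3 ≠ 8 := by simp only [qx] at h; grind
lemma qx_n4 {a : ℂ} (h : qx a = 0) : (4*a)^3 ≠ 8 := by simp only [qx] at h; grind
lemma qx_n {a b : ℂ} (h : qx a = 0) (hb : qx b = 0) (hab : a ≠ b) : (a * b)^3 ≠ 8 := by
  obtain ⟨q, h1, h2, h3, -⟩ := qx_pair h hb hab
  intro h4
  generalize a + b = s at *
  generalize a * b = p at *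
  clear h hb hab
  grind

lemma exists_xi : ∃ ξ : Fin 6 → ℂ, Function.Injective ξ ∧ ξ 0 = 1 ∧ ξ 1 = 4 ∧
    ∀ i, i = 0 ∨ i = 1 ∨ qx (ξ i) = 0 := by
  set Q : Polynomial ℂ := Polynomial.X^4 - 4 * Polynomial.X^3 + 2 * Polynomial.X - 2 with hQ
  have hev : ∀ a, Q.eval a = qx a := by intro a; simp [hQ, qx]
  have hdeg : Q.natDegree = 4 := by
    rw [hQ]
    compute_degree!
  have hQ0 : Q ≠ 0 := by rintro h; rw [h] at hdeg; simp at hdeg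
  have hnd : Q.roots.Nodup := by
    rw [Polynomial.nodup_roots_iff_of_splits hQ0 (IsAlgClosed.splits Q)]
    rw [Polynomial.separable_def]
    rw [Polynomial.isCoprime_iff_aeval_ne_zero_of_isAlgClosed (k := ℂ) (K := ℂ)]
    intro a
    by_contra hcon
    push Not at hcon
    obtain ⟨h1, h2⟩ := hcon
    have h2 : 4*a^3-12*a^2+2 = 0 := by
      simp [hQ] at h2
      linear_combination h2
    rw [Polynomial.aeval_def, Polynomial.eval₂_eq_eval_map, Algebra.algebraMap_self,
      Polynomial.map_id, hev] at h1
    simp only [qx] at h1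
    grind
  have hcard : Q.roots.toFinset.card = 4 := by
    rw [Multiset.toFinset_card_of_nodup hnd, ← hdeg]
    exact ((IsAlgClosed.splits Q).natDegree_eq_card_roots).symm
  set r := (Q.roots.toFinset.equivFinOfCardEq hcard).symm with hr
  have hrq : ∀ i, qx (r i : ℂ) = 0 := by
    intro i
    have := (r i).2
    rw [Multiset.mem_toFinset, Polynomial.mem_roots hQ0, Polynomial.IsRoot, hev] at this
    exact this
  refine ⟨Fin.cons 1 (Fin.cons 4 (fun i => (r i : ℂ))), ?_, rfl, rfl, ?_⟩
  · rw [Fin.cons_injective_iff, Fin.cons_injective_iff]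
    refine ⟨?_, ?_, ?_⟩
    · rintro ⟨i, hi⟩
      induction i using Fin.cases with
      | zero => simp at hi
      | succ i => simp at hi; exact qx_ne_one (hrq i) hi
    · rintro ⟨i, hi⟩
      exact qx_ne_four (hrq i) hi
    · intro i j h; exact r.injective (Subtype.ext h)
  · intro i
    induction i using Fin.cases with
    | zero => simp
    | succ i =>
      induction i using Fin.cases with
      | zero => simp
      | succ i => right; right; simpa using hrq i

def xi : Fin 6 → ℂ := exists_xi.choose
lemma xi_inj : Function.Injective xi := exists_xi.choose_spec.1
lemma xi_0 : xi 0 = 1 := exists_xi.choose_spec.2.1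
lemma xi_1 : xi 1 = 4 := exists_xi.choose_spec.2.2.1
lemma xi_q (i : Fin 6) : i = 0 ∨ i = 1 ∨ qx (xi i) = 0 := exists_xi.choose_spec.2.2.2 i

lemma xi_cases (i : Fin 6) : xi i = 1 ∨ xi i = 4 ∨ qx (xi i) = 0 := by
  rcases xi_q i with rfl | rfl | h
  · left; exact xi_0
  · right; left; exact xi_1
  · right; right; exact h

lemma xi_ne (i : Fin 6) : xi i ≠ 0 := by
  rcases xi_cases i with h | h | h
  · rw [h]; norm_num
  · rw [h]; norm_num
  · exact qx_ne_zero h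

lemma xi_disj_aux {a b c d : ℂ} (ha : a = 1 ∨ a = 4 ∨ qx a = 0) (hb : b = 1 ∨ b = 4 ∨ qx b = 0)
    (hc : c = 1 ∨ c = 4 ∨ qx c = 0) (hd : d = 1 ∨ d = 4 ∨ qx d = 0) 
    (hab : a ≠ b) (hac : a ≠ c) (had : a ≠ d)
    (hbc : b ≠ c) (hbd : b ≠ d) (hcd : c ≠ d) : a * b ≠ c * d := by
  have key : ∀ {b c d : ℂ}, (b = 4 ∨ qx b = 0) → (c = 4 ∨ qx c = 0) → (d = 4 ∨ qx d = 0) → 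
      b ≠ c → b ≠ d → c ≠ d → b ≠ c * d := by
    rintro b c d (rfl | hb) (rfl | hc) (rfl | hd) h1 h2 h3
    all_goals try contradiction
    · exact (qx_a hc hd h3).symm
    · exact (qx_b hd hb).symm
    · rw [mul_comm]; exact (qx_b hc hb).symm
    · exact (qx_c hb hc hd h1 h2 h3).symm
  have key4 : ∀ {b c d : ℂ}, (qx b = 0) → (qx c = 0) → (qx d = 0) → 
      b ≠ c → b ≠ d → c ≠ d → 4 * b ≠ c * d := by
    intro b c d hb hc hd h1 h2 h3
    exact (qx_d hb hc hd h1 h2 h3).symm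
  by_cases a1 : a = 1
  · subst a1; rw [one_mul]
    exact key (hb.resolve_left hab.symm) (hc.resolve_left hac.symm) (hd.resolve_left had.symm)
      hbc hbd hcd
  replace ha := ha.resolve_left a1
  by_cases b1 : b = 1
  · subst b1; rw [mul_one]
    exact key ha (hc.resolve_left hbc.symm) (hd.resolve_left hbd.symm) hac had hcd
  replace hb := hb.resolve_left b1
  by_cases c1 : c = 1
  · subst c1; rw [one_mul]
    exact (key (hd.resolve_left hcd.symm) ha hb had.symm hbd.symm hab).symm
  replace hc := hc.resolve_left c1
  by_cases d1 : d = 1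
  · subst d1; rw [mul_one]
    exact (key hc ha hb hac.symm hbc.symm hab).symm
  replace hd := hd.resolve_left d1
  by_cases a4 : a = 4
  · subst a4
    exact key4 (hb.resolve_left hab.symm) (hc.resolve_left hac.symm) (hd.resolve_left had.symm)
      hbc hbd hcd
  replace ha := ha.resolve_left a4
  by_cases b4 : b = 4
  · subst b4; rw [mul_comm]
    exact key4 ha (hc.resolve_left hbc.symm) (hd.resolve_left hbd.symm) hac had hcd
  replace hb := hb.resolve_left b4
  by_cases c4 : c = 4
  · subst c4
    exact (key4 (hd.resolve_left hcd.symm) ha hb had.symm hbd.symm hab).symm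
  replace hc := hc.resolve_left c4
  by_cases d4 : d = 4
  · subst d4; rw [mul_comm c]
    exact (key4 hc ha hb hac.symm hbc.symm hab).symm
  replace hd := hd.resolve_left d4
  exact qx_e ha hb hc hd hab hac had hbc hbd hcd

lemma xi_disj {i j k l : Fin 6} (hij : i ≠ j) (hik : i ≠ k) (hil : i ≠ l) (hjk : j ≠ k)
    (hjl : j ≠ l) (hkl : k ≠ l) : xi i * xi j ≠ xi k * xi l :=
  xi_disj_aux (xi_cases i) (xi_cases j) (xi_cases k) (xi_cases l) (xi_inj.ne hij) (xi_inj.ne hik)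
    (xi_inj.ne hil) (xi_inj.ne hjk) (xi_inj.ne hjl) (xi_inj.ne hkl)

lemma xi_node_aux {a b : ℂ} (ha : a = 1 ∨ a = 4 ∨ qx a = 0) (hb : b = 1 ∨ b = 4 ∨ qx b = 0)
    (hab : a ≠ b) : (a * b)^3 ≠ 8 := by
  rcases ha with rfl | rfl | ha <;> rcases hb with rfl | rfl | hb
  all_goals try contradiction
  · norm_num
  · rw [one_mul]; exact qx_n1 hb
  · norm_num
  · exact qx_n4 hb
  · rw [mul_one]; exact qx_n1 ha
  · rw [mul_comm]; exact qx_n4 ha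
  · exact qx_n ha hb hab

lemma xi_node {i j : Fin 6} (hij : i ≠ j) : (xi i * xi j)^3 ≠ 8 :=
  xi_node_aux (xi_cases i) (xi_cases j) (xi_inj.ne hij)

/-- the six flexes `z = α x + β y` of the limit curve -/
def mα (j : Fin 6) : ℂ := (xi j - 1)/3
def mβ (j : Fin 6) : ℂ := 2*(xi j - 1)/(3*xi j)

lemma m_coll {i j : Fin 6} (hij : i ≠ j) {P Q : ℂ} (h : mα i * P + mβ i * Q = mα j * P + mβ j * Q) :
    xi i * xi j * P + 2 * Q = 0 := by
  have hi := xi_ne i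
  have hj := xi_ne j
  have hne := sub_ne_zero.2 (xi_inj.ne hij)
  simp only [mα, mβ] at h
  field_simp at h
  refine (mul_eq_zero_iff_left hne).1 ?_
  linear_combination h

lemma m_five {P Q : ℂ} (h : P ≠ 0 ∨ Q ≠ 0) : ∃ j0 : Fin 6,
    Function.Injective (fun j => mα (j0.succAbove j) * P + mβ (j0.succAbove j) * Q) := by
  by_cases hc : ∃ i j, i ≠ j ∧ mα i * P + mβ i * Q = mα j * P + mβ j * Q
  · obtain ⟨i, j, hij, he⟩ := hc
    refine ⟨i, fun k l hkl => ?_⟩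
    by_contra hne
    have h1 := m_coll hij he
    have h2 := m_coll (fun h => hne (Fin.succAbove_right_injective h)) hkl
    have hk : i ≠ i.succAbove k := (Fin.succAbove_ne i k).symm
    have hl : i ≠ i.succAbove l := (Fin.succAbove_ne i l).symm
    have hkl' : i.succAbove k ≠ i.succAbove l := fun h => hne (Fin.succAbove_right_injective h)
    generalize i.succAbove k = k at *
    generalize i.succAbove l = l at *
    have hP : P ≠ 0 := by
      rintro rfl
      simp at h1; simp [h1] at h
    have h3 : xi i * xi j = xi k * xi l := by
      have : (xi i * xi j - xi k * xi l) * P = 0 := by linear_combination h1 - h2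
      exact sub_eq_zero.1 ((mul_eq_zero.1 this).resolve_right hP)
    by_cases hjk : j = k
    · subst hjk
      rw [mul_comm] at h3
      exact hl (xi_inj (mul_left_cancel₀ (xi_ne _) h3))
    by_cases hjl : j = l
    · subst hjl
      exact hk (xi_inj (mul_right_cancel₀ (xi_ne _) h3))
    exact xi_disj hij hk hl hjk hjl hkl' h3
  · push Not at hc
    refine ⟨0, fun k l hkl => ?_⟩
    by_contra hne
    exact hc _ _ (fun h => hne (Fin.succAbove_right_injective h)) hkl

/-- at the nodes, and at `p`, the six values are distinct -/
lemma m_six {P Q : ℂ} (h : P ≠ 0 ∨ Q ≠ 0) (hn : P^3+Q^3 = 0 ∨ Q = 0) :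
    Function.Injective (fun j => mα j * P + mβ j * Q) := by
  intro i j hij
  by_contra hne
  have h1 := m_coll hne hij
  have hP : P ≠ 0 := by
    rintro rfl
    simp at h1; simp [h1] at h
  rcases hn with hn | rfl
  · have h2 : (xi i * xi j)^3 * P^3 = 8 * P^3 := by
      have : xi i * xi j * P = -2*Q := by linear_combination h1
      rw [← mul_pow, this]; linear_combination -8*hn
    exact xi_node hne (mul_right_cancel₀ (pow_ne_zero 3 hP) h2)
  · simp [hP, xi_ne] at h1

def lA (k : Fin 15 → ℂ) (s r : ℂ) : ℂ := k 12 + s * k 2 + s^2 * k 6 + s^3 * k 9 + s^4 * k 11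
def lB (k : Fin 15 → ℂ) (s r : ℂ) : ℂ := k 13 + (s * k 3 + r * k 2) + (s^2 * k 7 + 2*s*r * k 6) +
  (s^3 * k 10 + 3 * s^2 * r * k 9) + 4*s^3*r* k 11
def lC (k : Fin 15 → ℂ) (s r : ℂ) : ℂ := k 14 + (s * k 4 + r * k 3) +
  (s^2 * k 8 + 2*s*r * k 7 + r^2 * k 6) + (3*s^2*r * k 10 + 3 * s*r^2 * k 9) + 6*s^2*r^2* k 11
def lD (k : Fin 15 → ℂ) (s r : ℂ) : ℂ := k 0 + (s * k 5 + r * k 4) + (2*s*r * k 8 + r^2 * k 7) +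
  (3*s*r^2 * k 10 + r^3 * k 9) + 4*s*r^3 * k 11
def lE (k : Fin 15 → ℂ) (s r : ℂ) : ℂ := k 1 + r * k 5 + r^2 * k 8 + r^3 * k 10 + r^4 * k 11

lemma onLine'_bq (k : Fin 15 → ℂ) (s r x y : ℂ) : onLine' k s r x y =
    bq (lA k s r) (lB k s r) (lC k s r) (lD k s r) (lE k s r) x y := by
  simp only [onLine', QF, bq, lA, lB, lC, lD, lE]; ring

def LI (k : Fin 15 → ℂ) (s r : ℂ) : ℂ := bI (lA k s r) (lB k s r) (lC k s r) (lD k s r) (lE k s r)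
def LJ (k : Fin 15 → ℂ) (s r : ℂ) : ℂ := bJ (lA k s r) (lB k s r) (lC k s r) (lD k s r) (lE k s r)

lemma tri_iff_LIJ (k : Fin 15 → ℂ) (s r : ℂ) : Tri (onLine' k s r) ↔ LI k s r = 0 ∧ LJ k s r = 0 :=
  Tri_iff (onLine'_bq k s r)

/-- the limit curve `z (x³+y³) - y³ (x + y/2)` -/
def kA : Fin 15 → ℂ := ![-1, -1/2, 1, 0, 0, 1, 0, 0, 0, 0, 0, 0, 0, 0, 0]

lemma QF_kA (x y z : ℂ) : QF kA x y z = z * (x^3+y^3) - y^3*(x + y/2) := by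
  simp [QF, kA]; ring

lemma LI_kA (s r : ℂ) : LI kA s r = 9*s*r - 6*s+3*r := by
  simp [LI, bI, lA, lB, lC, lD, lE, kA]; ring
lemma LJ_kA (s r : ℂ) : LJ kA s r = -27*s*(s-1)^2 - 27*(r-1/2)*r^2 := by
  simp [LJ, bJ, lA, lB, lC, lD, lE, kA]; ring

lemma LI_m (j : Fin 6) : LI kA (mα j) (mβ j) = 0 := by
  rw [LI_kA]; simp only [mα, mβ]
  have := xi_ne j
  field_simp; ring

lemma xi_rel (j : Fin 6) : (xi j - 1)*(xi j - 4)*(xi j^4 - 4 * xi j^3 + 2 * xi j - 2) = 0 := by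
  rcases xi_cases j with h | h | h
  · rw [h]; ring
  · rw [h]; ring
  · simp only [qx] at h; rw [h, mul_zero]

lemma LJ_m (j : Fin 6) : LJ kA (mα j) (mβ j) = 0 := by
  rw [LJ_kA]; simp only [mα, mβ]
  have := xi_ne j
  field_simp
  linear_combination (-27) * xi_rel j

lemma tri_m (j : Fin 6) : Tri (onLine' kA (mα j) (mβ j)) := (tri_iff_LIJ _ _ _).2 ⟨LI_m j, LJ_m j⟩

lemma det_m (j : Fin 6) : (9*mβ j - 6) * (-27*mβ j*(3*mβ j-1)) -
    (9*mα j+3) * (-27*(mα j-1)*(3*mα j-1)) ≠ 0 := by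
  have h0 := xi_ne j
  intro h
  simp only [mα, mβ] at h
  field_simp at h
  have h2 : (xi j - 2)*(4*(xi j-1)+xi j^4*(xi j-4)) = 0 := by linear_combination (1/243) * h
  rcases xi_cases j with h1 | h1 | h1
  · rw [h1] at h2; norm_num at h2
  · rw [h1] at h2; norm_num at h2
  · have hne := qx_ne_one h1
    simp only [qx] at h1
    generalize xi j = x at *
    have h3 : (x-1)*(x-2)^2 = 0 := by linear_combination (-1/2) * h2 + (1/2)*(x-2)*x*h1
    rcases mul_eq_zero.1 h3 with h4 | h4
    · exact hne (sub_eq_zero.1 h4)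
    · have : x = 2 := by
        have : x - 2 = 0 := by simpa using h4
        exact sub_eq_zero.1 this
      rw [this] at h1; norm_num at h1

def LIJ (u : (Fin 15 → ℂ) × (ℂ × ℂ)) : ℂ × ℂ := (LI u.1 u.2.1 u.2.2, LJ u.1 u.2.1 u.2.2)

lemma LIJ_contDiff : ContDiff ℂ 1 LIJ := by
  unfold LIJ LI LJ bI bJ lA lB lC lD lE
  fun_prop

lemma lift_flex (j : Fin 6) : ∃ ψ : (Fin 15 → ℂ) → ℂ × ℂ,
    Tendsto ψ (nhds kA) (nhds (mα j, mβ j)) ∧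
    ∀ᶠ k in nhds kA, Tri (onLine' k (ψ k).1 (ψ k).2) := by
  set u : (Fin 15 → ℂ) × (ℂ × ℂ) := (kA, (mα j, mβ j)) with hu
  have dfu : HasStrictFDerivAt LIJ (fderiv ℂ LIJ u) u :=
    (LIJ_contDiff.contDiffAt).hasStrictFDerivAt one_ne_zero
  have hinj : ∀ v : ℂ × ℂ, fderiv ℂ LIJ u (0, v) = 0 → v = 0 := by
    rintro ⟨v1, v2⟩ hv
    have h1 : HasDerivAt (fun t : ℂ => u + t • ((0 : Fin 15 → ℂ), (v1, v2))) (0, (v1, v2)) 0 := by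
      simpa using ((hasDerivAt_id (0:ℂ)).smul_const ((0 : Fin 15 → ℂ), (v1, v2))).const_add u
    have h2 : HasDerivAt (fun t : ℂ => LIJ (u + t • ((0 : Fin 15 → ℂ), (v1, v2))))
        (fderiv ℂ LIJ u (0, (v1, v2))) 0 := by
      refine HasFDerivAt.comp_hasDerivAt_of_eq (0:ℂ) dfu.hasFDerivAt h1 (by simp)
    rw [hv] at h2
    have h3 : (fun t : ℂ => LIJ (u + t • ((0 : Fin 15 → ℂ), (v1, v2)))) = fun t =>
        (9*(mα j + t * v1)*(mβ j + t * v2) - 6*(mα j + t * v1)+3*(mβ j + t * v2),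
        -27*(mα j + t * v1)*((mα j + t * v1)-1)^2 - 27*((mβ j + t * v2)-1/2)*(mβ j + t * v2)^2) := by
      funext t
      simp only [LIJ, hu, Prod.fst_add, Prod.snd_add, Prod.smul_fst, Prod.smul_snd, smul_zero,
        add_zero, smul_eq_mul, LI_kA, LJ_kA]
    rw [h3] at h2
    have hs : HasDerivAt (fun t : ℂ => mα j + t * v1) v1 0 := by
      simpa using ((hasDerivAt_id (0:ℂ)).mul_const v1).const_add (mα j)
    have hr : HasDerivAt (fun t : ℂ => mβ j + t * v2) v2 0 := by
      simpa using ((hasDerivAt_id (0:ℂ)).mul_const v2).const_add (mβ j)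
    have e1 := (((hs.const_mul 9).mul hr).sub (hs.const_mul 6)).add (hr.const_mul 3)
    have e2 := ((hs.const_mul (-27)).mul ((hs.sub_const 1).pow 2)).sub
      (((hr.sub_const (1/2)).const_mul 27).mul (hr.pow 2))
    have e3 := (e1.prodMk e2).unique h2
    simp only [Prod.mk_eq_zero] at e3
    obtain ⟨f1, f2⟩ := e3
    simp at f1 f2
    have g1 : (9*mβ j - 6) * v1 + (9*mα j+3) * v2 = 0 := by linear_combination f1
    have g2 : (-27*(mα j-1)*(3*mα j-1)) * v1 + (-27*mβ j*(3*mβ j-1)) * v2 = 0 := by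
      linear_combination f2
    have hd := det_m j
    have k1 : v1 = 0 := by
      refine (mul_eq_zero_iff_left hd).1 ?_
      linear_combination (-27*mβ j*(3*mβ j-1)) * g1 - (9*mα j+3) * g2
    have k2 : v2 = 0 := by
      refine (mul_eq_zero_iff_left hd).1 ?_
      linear_combination (9*mβ j - 6) * g2 - (-27*(mα j-1)*(3*mα j-1)) * g1
    rw [k1, k2]; rfl
  have hinv : (fderiv ℂ LIJ u ∘L .inr ℂ (Fin 15 → ℂ) (ℂ × ℂ)).IsInvertible := by
    have hi : Function.Injective ((fderiv ℂ LIJ u ∘L .inr ℂ (Fin 15 → ℂ) (ℂ × ℂ)) :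
        (ℂ × ℂ) →ₗ[ℂ] (ℂ × ℂ)) := by
      rw [← LinearMap.ker_eq_bot, LinearMap.ker_eq_bot']
      intro v hv
      exact hinj v hv
    refine ⟨(LinearEquiv.ofInjectiveEndo _ hi).toContinuousLinearEquiv, ?_⟩
    ext <;> rfl
  refine ⟨dfu.implicitFunctionOfProdDomain hinv, dfu.tendsto_implicitFunctionOfProdDomain hinv, ?_⟩
  filter_upwards [dfu.eventually_apply_implicitFunctionOfProdDomain hinv] with k hk
  rw [tri_iff_LIJ]
  have : LIJ u = 0 := by simp only [LIJ, hu, LI_m, LJ_m]; rfl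
  rw [this] at hk
  exact ⟨congrArg Prod.fst hk, congrArg Prod.snd hk⟩

lemma xi5_roots {a b c d e : ℂ}
    (h : ∀ j, a + b * xi j + c * xi j^2 + d * xi j^3 + e * xi j^4 = 0) :
    a = 0 ∧ b = 0 ∧ c = 0 ∧ d = 0 ∧ e = 0 :=
  poly4_roots (fun j : Fin 5 => xi j.castSucc) (fun i j h => Fin.castSucc_injective _ (xi_inj h))
    (fun j => h _)

lemma polar_case {a b c d e : ℂ}
    (hI : ∀ j, 12*(mα j*e+(mβ j-1/2)*a)-3*(mβ j*d+(mα j-1)*b) = 0)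
    (hJ : ∀ j, 72*mα j*(mβ j-1/2)*c + 9*mβ j*(mα j-1)*c - 27*(a*(mα j-1)^2+2*mα j*(mα j-1)*d)
      - 27*(e*mβ j^2+2*(mβ j-1/2)*mβ j*b) = 0) :
    a = 0 ∧ b = 0 ∧ c = 0 ∧ d = 0 ∧ e = 0 := by
  obtain ⟨h1, h2, h3, -, -⟩ := xi5_roots (a := -8*a+2*d) (b := -4*e+2*a-2*d+4*b) (c := 4*e-b)
    (d := 0) (e := 0) (fun j => by
      have h := hI j
      have h0 := xi_ne j
      simp only [mα, mβ] at h
      field_simp at h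
      linear_combination (1/6)*h)
  obtain rfl : b = 4*e := by linear_combination -h3
  obtain rfl : d = 4*a := by linear_combination (1/2)*h1
  obtain rfl : a = 2*e := by linear_combination (-1/6)*h2
  have h4 := xi5_roots (a := -12*e-96*e) (b := 24*c+24*e+120*e) (c := -30*c-96*e-192*e-12*e-24*e)
    (d := 6*c+48*e+240*e) (e := -54*e) (fun j => by
      have h := hJ j
      have h0 := xi_ne j
      simp only [mα, mβ] at h
      field_simp at h
      ring_nf at h ⊢
      linear_combination (1/18)*h)
  obtain ⟨-, -, -, h5, h6⟩ := h4
  obtain rfl : e = 0 := by simpa using h6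
  obtain rfl : c = 0 := by simpa using h5
  simp

lemma comparable_case {a b c d e : ℂ}
    (hI : ∀ j, bI (mα j + a) (mβ j + b) c (mα j - 1 + d) (mβ j - 1/2 + e) = 0)
    (hJ : ∀ j, bJ (mα j + a) (mβ j + b) c (mα j - 1 + d) (mβ j - 1/2 + e) = 0) :
    a = 0 ∧ b = 0 ∧ c = 0 ∧ d = 0 ∧ e = 0 := by
  simp only [bI, bJ] at hI hJ
  obtain ⟨h1, h2, h3, -, -⟩ := xi5_roots (a := -8*a+2*d)
    (b := -4*e+2*a-2*d+4*b + (12*a*e-3*b*d+c^2)) (c := 4*e-b)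
    (d := 0) (e := 0) (fun j => by
      have h := hI j
      have h0 := xi_ne j
      simp only [mα, mβ] at h
      field_simp at h
      linear_combination (1/18)*h)
  obtain rfl : b = 4*e := by linear_combination -h3
  obtain rfl : d = 4*a := by linear_combination (1/2)*h1
  have h4 := fun j => by
      have h := hJ j
      have h7 := LJ_m j
      rw [LJ_kA] at h7
      have h0 := xi_ne j
      have h8 := sub_eq_zero.2 (h.trans h7.symm)
      simp only [mα, mβ] at h8
      field_simp at h8
      ring_nf at h8
      exact h8
  obtain ⟨h5, -, -, -, h6⟩ := xi5_roots (a := -e*5832)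
    (b := c*1296 - c*a*3888 + e*7776 + e^2*23328)
    (c := -c*1620 + c*a*1944 + c*a*e*11664 - c*e*3888 - c^3*108 - a*7776 + a^2*23328 - a^3*23328
      - e*1944 - e^2*11664 - e^3*23328)
    (d := c*324 + c*e*1944 + a*7776 - a^2*11664) (e := -a*1458) (fun j => by
      refine (mul_eq_zero_iff_left (xi_ne j)).1 ?_
      linear_combination h4 j)
  obtain rfl : e = 0 := by simpa using h5
  obtain rfl : a = 0 := by simpa using h6
  have : c = 0 := by simpa using h2
  simp [this]

/-- no triple line in the quartic -/
def NoTL (f : ℂ → ℂ → ℂ → ℂ) : Prop :=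
  ∀ l m : Fin 3 → ℂ, l ≠ 0 → ¬ ∀ x y z, f x y z = lf l x y z ^ 3 * lf m x y z

/-- the extra hypothesis in the fourth power case -/
def TypeB (B : ℕ → Fin 15 → ℂ) (h : ℂ → ℂ → ℂ) : Prop :=
  ∀ κ P Q : ℂ, κ ≠ 0 → (P ≠ 0 ∨ Q ≠ 0) → (∀ x y, h x y = κ * (Q*x - P*y)^4) →
    (P^3 + Q^3 = 0 ∨ Q = 0) ∧ ∃ (ζ₁ ζ₂ t : ℕ → ℂ) (ζ₁' ζ₂' : ℂ),
      Tendsto ζ₁ atTop (nhds ζ₁') ∧ Tendsto ζ₂ atTop (nhds ζ₂') ∧ ζ₁' * P + ζ₂' * Q ≠ 0 ∧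
      Tendsto t atTop (nhds 0) ∧ (∀ n, t n ≠ 0) ∧
      ∀ᶠ n in atTop, Tri (onLine' (B n) (ζ₁ n / t n) (ζ₂ n / t n))

lemma TypeB.sub {B h} (hB : TypeB B h) {φ : ℕ → ℕ} (hφ : StrictMono φ) :
    TypeB (fun n => B (φ n)) h := by
  intro κ P Q h1 h2 h3
  obtain ⟨h4, ζ₁, ζ₂, t, ζ₁', ζ₂', g1, g2, g3, g4, g5, g6⟩ := hB κ P Q h1 h2 h3
  have ht := hφ.tendsto_atTop
  exact ⟨h4, fun n => ζ₁ (φ n), fun n => ζ₂ (φ n), fun n => t (φ n), ζ₁', ζ₂', g1.comp ht,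
    g2.comp ht, g3, g4.comp ht, fun n => g5 _, ht.eventually g6⟩

lemma onLine'_smul (t : ℂ) (k : Fin 15 → ℂ) (s r : ℂ) :
    onLine' (t • k) s r = fun x y => t * onLine' k s r x y := by
  funext x y; simp only [onLine', QF, Pi.smul_apply, smul_eq_mul]; ring

lemma QF_smul (t : ℂ) (k : Fin 15 → ℂ) (x y z : ℂ) : QF (t • k) x y z = t * QF k x y z := by
  simp only [QF, Pi.smul_apply, smul_eq_mul]; ring

lemma QF_add (l k : Fin 15 → ℂ) (x y z : ℂ) : QF (l + k) x y z = QF l x y z + QF k x y z := by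
  simp only [QF, Pi.add_apply]; ring

lemma TypeB.smul {B h} (hB : TypeB B h) (v : ℕ → ℂ) : TypeB (fun n => v n • B n) h := by
  intro κ P Q h1 h2 h3
  obtain ⟨h4, ζ₁, ζ₂, t, ζ₁', ζ₂', g1, g2, g3, g4, g5, g6⟩ := hB κ P Q h1 h2 h3
  exact ⟨h4, ζ₁, ζ₂, t, ζ₁', ζ₂', g1, g2, g3, g4, g5, g6.mono fun n hn => by
    rw [onLine'_smul]; exact hn.smul _⟩

lemma NoTL.smul {k : Fin 15 → ℂ} (h : NoTL (QF k)) {t : ℂ} (ht : t ≠ 0) : NoTL (QF (t • k)) := by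
  intro l m hl hh
  refine h l (t⁻¹ • m) hl fun x y z => ?_
  have := hh x y z
  rw [QF_smul] at this
  simp only [lf, Pi.smul_apply, smul_eq_mul] at *
  field_simp
  linear_combination this

lemma frame3 (K : ℕ → Fin 15 → ℂ) (K' : Fin 15 → ℂ) (hK : Tendsto K atTop (nhds K'))
    {a b c d e : ℂ} (hK' : ∀ x y z, QF K' x y z = bq a b c d e x y)
    (hne : ¬ (a = 0 ∧ b = 0 ∧ c = 0 ∧ d = 0 ∧ e = 0))
    (σ τ : ℕ → Fin 6 → ℂ) (hσ : ∀ j, Tendsto (fun n => σ n j) atTop (nhds (mα j)))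
    (hτ : ∀ j, Tendsto (fun n => τ n j) atTop (nhds (mβ j)))
    (htri : ∀ j, ∀ᶠ n in atTop, Tri (onLine' (K n) (σ n j) (τ n j)))
    (hno : ∀ n, NoTL (QF (K n))) (hB : TypeB K (bq a b c d e)) : False := by
  have hT : Tri (bq a b c d e) := Tri.lim' (htri 0) fun x y => by
    have := QF_lim hK (x := fun _ => x) (y := fun _ => y) (z := fun n => σ n 0 * x + τ n 0 * y)
      tendsto_const_nhds tendsto_const_nhds (((hσ 0).mul_const x).add ((hτ 0).mul_const y))
    rw [hK'] at this
    exact this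
  rw [Tri_iff (fun x y => rfl)] at hT
  obtain ⟨u, v, r, s, huv, hh⟩ := exists_triple hT.1 hT.2
  obtain ⟨p, q, hpq⟩ : ∃ p q : ℂ, v * p - u * q = 1 := by
    rcases huv with hu | hv
    · exact ⟨0, -u⁻¹, by field_simp; ring⟩
    · exact ⟨v⁻¹, 0, by field_simp; ring⟩
  choose k hk using fun n => QF_sub (K n) ![0, p, u] ![0, q, v] ![1, 0, 0]
  obtain ⟨k', hk'⟩ := QF_sub K' ![0, p, u] ![0, q, v] ![1, 0, 0]
  simp only [lf, Matrix.cons_val_zero, Matrix.cons_val_one, Matrix.cons_val, zero_mul, zero_add,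
    one_mul, add_zero] at hk hk'
  have hlim : Tendsto k atTop (nhds k') := QF_tendsto fun x y z => by
    rw [← hk']
    simp only [← hk]
    exact QF_lim hK tendsto_const_nhds tendsto_const_nhds tendsto_const_nhds
  have hk'2 : k' = ![0, r*p+s*q, 0, 0, 0, r*u+s*v, 0, 0, 0, 0, 0, 0, 0, 0, 0] := by
    apply QF_inj
    intro x y z
    rw [← hk', hK', hh]
    have : v * (p * y + u * z) - u * (q * y + v * z) = y := by linear_combination y * hpq
    rw [this]
    simp [QF]; ring
  have hnc : ∀ n, NoCube (QF (k n)) := by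
    intro n a' b' l m n' h
    refine hno n ![v + b' * q, -u - b' * p, -a'] ![m*v-n'*q, n'*p-m*u, l] ?_ ?_
    · intro h0
      have h1 := congrFun h0 0
      have h2 := congrFun h0 1
      simp at h1 h2
      have : (1:ℂ) = 0 := by linear_combination -hpq + p * h1 + q * h2
      exact one_ne_zero this
    · intro x y z
      have h1 := h z (v*x-u*y) (p*y-q*x)
      rw [← hk n] at h1
      have e1 : p * (v*x-u*y) + u * (p*y-q*x) = x := by linear_combination x * hpq
      have e2 : q * (v*x-u*y) + v * (p*y-q*x) = y := by linear_combination y * hpq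
      rw [e1, e2] at h1
      rw [h1]
      simp [lf]; ring
  have htri' : ∀ j, ∀ᶠ n in atTop, Tri (onLine (k n) (σ n j*u+τ n j*v) (σ n j*p+τ n j*q)) := by
    intro j
    filter_upwards [htri j] with n hn
    convert hn.comp u p v q using 3 with z y
    simp only [onLine, onLine', ← hk]
    congr 1 <;> ring
  by_cases hn0 : r*u+s*v = 0
  · have hn1 : r*p+s*q ≠ 0 := by
      intro hn1
      apply hne
      have hr : r = 0 := by linear_combination v * hn1 - q * hn0 - r * hpq
      have hs : s = 0 := by linear_combination p * hn0 - u * hn1 - s * hpq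
      refine bq_inj (a' := 0) (b' := 0) (c' := 0) (d' := 0) (e' := 0) fun x y => ?_
      rw [hh, hr, hs]; simp [bq]
    obtain ⟨h4, ζ₁, ζ₂, t, ζ₁', ζ₂', g1, g2, g3, g4, g5, g6⟩ := hB (r*p+s*q) u v hn1 huv (by
      intro x y
      rw [hh]
      linear_combination (v*x-u*y)^3 * ((p*y-q*x)*hn0 - (r*x+s*y)*hpq))
    have gP : Tendsto (fun n => ζ₁ n * u + ζ₂ n * v) atTop (nhds (ζ₁' * u + ζ₂' * v)) :=
      (g1.mul_const u).add (g2.mul_const v)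
    have gP' : Tendsto (fun n => ζ₁ n * p + ζ₂ n * q) atTop (nhds (ζ₁' * p + ζ₂' * q)) :=
      (g1.mul_const p).add (g2.mul_const q)
    refine ELB k k' hlim ?_ ?_ (fun n j => σ n j*u+τ n j*v) (fun n j => σ n j*p+τ n j*q) _
      (fun j => mα j*p+mβ j*q) (fun j => ((hσ j).mul_const u).add ((hτ j).mul_const v))
      (fun j => ((hσ j).mul_const p).add ((hτ j).mul_const q)) (m_six huv h4) htri'
      (fun n => t n / (ζ₁ n * u + ζ₂ n * v))
      (fun n => -(ζ₁ n * p + ζ₂ n * q) / (ζ₁ n * u + ζ₂ n * v))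
      (-(ζ₁' * p + ζ₂' * q) / (ζ₁' * u + ζ₂' * v)) ?_ (gP'.neg.div gP g3) ?_ hnc
    · rw [hk'2]; intro i hi; fin_cases i <;> simp [yd, hn0] at hi ⊢
    · rw [hk'2]; simpa using hn1
    · have := g4.div gP g3
      rw [zero_div] at this
      exact this
    · filter_upwards [g6, gP.eventually_ne g3] with n hn hz
      set ε := t n / (ζ₁ n * u + ζ₂ n * v) with hε
      set ρ := -(ζ₁ n * p + ζ₂ n * q) / (ζ₁ n * u + ζ₂ n * v) with hρ
      convert hn.comp (u*ε) (u*ρ+p) (v*ε) (v*ρ+q) using 3 with x y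
      simp only [onLine', ← hk]
      have := g5 n
      congr 1
      · ring
      · ring
      · rw [hε, hρ]; field_simp; ring
  · obtain ⟨j0, hj⟩ := m_five huv
    refine ELA k k' hlim ?_ (fun n j => σ n (j0.succAbove j)*u+τ n (j0.succAbove j)*v)
      (fun n j => σ n (j0.succAbove j)*p+τ n (j0.succAbove j)*q) _
      (fun j => mα (j0.succAbove j)*p+mβ (j0.succAbove j)*q)
      (fun j => ((hσ _).mul_const u).add ((hτ _).mul_const v))
      (fun j => ((hσ _).mul_const p).add ((hτ _).mul_const q)) hj ?_ (fun j => htri' _) hnc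
    · rw [hk'2]; intro i hi; fin_cases i <;> simp [yd] at hi ⊢
    · rw [hk'2]; intro j; simpa using hn0

set_option maxHeartbeats 1000000 in
lemma l_lim {k : ℕ → Fin 15 → ℂ} {k' : Fin 15 → ℂ} (hk : Tendsto k atTop (nhds k')) {s r : ℕ → ℂ}
    {s' r' : ℂ} (hs : Tendsto s atTop (nhds s')) (hr : Tendsto r atTop (nhds r')) :
    Tendsto (fun n => lA (k n) (s n) (r n)) atTop (nhds (lA k' s' r')) ∧
    Tendsto (fun n => lB (k n) (s n) (r n)) atTop (nhds (lB k' s' r')) ∧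
    Tendsto (fun n => lC (k n) (s n) (r n)) atTop (nhds (lC k' s' r')) ∧
    Tendsto (fun n => lD (k n) (s n) (r n)) atTop (nhds (lD k' s' r')) ∧
    Tendsto (fun n => lE (k n) (s n) (r n)) atTop (nhds (lE k' s' r')) := by
  have h := hk.prodMk_nhds (hs.prodMk_nhds hr)
  have c1 : Continuous (fun q : (Fin 15 → ℂ) × ℂ × ℂ => lA q.1 q.2.1 q.2.2) := by
    unfold lA; fun_prop
  have c2 : Continuous (fun q : (Fin 15 → ℂ) × ℂ × ℂ => lB q.1 q.2.1 q.2.2) := by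
    unfold lB; fun_prop
  have c3 : Continuous (fun q : (Fin 15 → ℂ) × ℂ × ℂ => lC q.1 q.2.1 q.2.2) := by
    unfold lC; fun_prop
  have c4 : Continuous (fun q : (Fin 15 → ℂ) × ℂ × ℂ => lD q.1 q.2.1 q.2.2) := by
    unfold lD; fun_prop
  have c5 : Continuous (fun q : (Fin 15 → ℂ) × ℂ × ℂ => lE q.1 q.2.1 q.2.2) := by
    unfold lE; fun_prop
  have t := fun (F : (Fin 15 → ℂ) × ℂ × ℂ → ℂ) (hF : Continuous F) =>
    (hF.tendsto (k', s', r')).comp h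
  exact ⟨t _ c1, t _ c2, t _ c3, t _ c4, t _ c5⟩

lemma l_const {k : Fin 15 → ℂ} {a b c d e : ℂ} (h : ∀ x y z, QF k x y z = bq a b c d e x y)
    (s r : ℂ) : lA k s r = a ∧ lB k s r = b ∧ lC k s r = c ∧ lD k s r = d ∧ lE k s r = e :=
  bq_inj fun x y => by rw [← onLine'_bq, onLine', h]

lemma l_kA (s r : ℂ) : lA kA s r = s ∧ lB kA s r = r ∧ lC kA s r = 0 ∧ lD kA s r = s - 1 ∧
    lE kA s r = r - 1/2 :=
  bq_inj fun x y => by rw [← onLine'_bq, onLine', QF_kA]; simp only [bq]; ring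

lemma tri_comb {A H : Fin 15 → ℂ} {u v s r : ℂ} (h : Tri (onLine' (u • A + v • H) s r)) :
    bI (u * lA A s r + v * lA H s r) (u * lB A s r + v * lB H s r) (u * lC A s r + v * lC H s r)
      (u * lD A s r + v * lD H s r) (u * lE A s r + v * lE H s r) = 0 ∧
    bJ (u * lA A s r + v * lA H s r) (u * lB A s r + v * lB H s r) (u * lC A s r + v * lC H s r)
      (u * lD A s r + v * lD H s r) (u * lE A s r + v * lE H s r) = 0 := by
  refine (Tri_iff fun x y => ?_).1 h
  have h1 := onLine'_bq A s r x y
  have h2 := onLine'_bq H s r x y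
  simp only [onLine'] at *
  rw [QF_add, QF_smul, QF_smul, h1, h2]
  simp only [bq]; ring

lemma frame_theorem (A H : ℕ → Fin 15 → ℂ) (H' : Fin 15 → ℂ)
    (hA : Tendsto A atTop (nhds kA)) (hH : Tendsto H atTop (nhds H'))
    {a b c d e : ℂ} (hH' : ∀ x y z, QF H' x y z = bq a b c d e x y)
    (hne : ¬ (a = 0 ∧ b = 0 ∧ c = 0 ∧ d = 0 ∧ e = 0))
    (u v : ℕ → ℂ) (hv : ∀ n, v n ≠ 0)
    (σ τ : ℕ → Fin 6 → ℂ) (hσ : ∀ j, Tendsto (fun n => σ n j) atTop (nhds (mα j)))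
    (hτ : ∀ j, Tendsto (fun n => τ n j) atTop (nhds (mβ j)))
    (htriA : ∀ j, ∀ᶠ n in atTop, Tri (onLine' (A n) (σ n j) (τ n j)))
    (htri : ∀ j, ∀ᶠ n in atTop, Tri (onLine' (u n • A n + v n • H n) (σ n j) (τ n j)))
    (hno : ∀ n, NoTL (QF (u n • A n + v n • H n)))
    (hB : TypeB (fun n => u n • A n + v n • H n) (bq a b c d e)) : False := by
  -- limits of coefficients
  have hLA := fun j => l_lim hA (hσ j) (hτ j)
  have hLH := fun j => l_lim hH (hσ j) (hτ j)
  have hkA := fun j => l_kA (mα j) (mβ j)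
  have hkH := fun j => l_const hH' (mα j) (mβ j)
  simp only [(hkA _).1, (hkA _).2.1, (hkA _).2.2.1, (hkA _).2.2.2.1, (hkA _).2.2.2.2] at hLA
  simp only [(hkH _).1, (hkH _).2.1, (hkH _).2.2.1, (hkH _).2.2.2.1, (hkH _).2.2.2.2] at hLH
  by_cases hbd : ∃ R, ∃ᶠ n in atTop, ‖u n / v n‖ ≤ R
  · obtain ⟨R, hR⟩ := hbd
    obtain ⟨w, -, φ, hφ, hw⟩ := tendsto_subseq_of_frequently_bounded
      (x := fun n => u n / v n) (Metric.isBounded_closedBall (x := (0:ℂ)) (r := R))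
      (hR.mono fun n hn => by simpa using hn)
    have hφt := hφ.tendsto_atTop
    by_cases hw0 : w = 0
    · subst hw0
      have hK : Tendsto (fun n => (v (φ n))⁻¹ • (u (φ n) • A (φ n) + v (φ n) • H (φ n))) atTop
          (nhds H') := by
        have : Tendsto (fun n => (u (φ n) / v (φ n)) • A (φ n) + H (φ n)) atTop
          (nhds ((0:ℂ) • kA + H')) := (hw.smul (hA.comp hφt)).add (hH.comp hφt)
        rw [zero_smul, zero_add] at this
        refine this.congr fun n => ?_
        rw [smul_add, smul_smul, smul_smul, inv_mul_cancel₀ (hv _), one_smul, div_eq_inv_mul]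
      refine frame3 _ _ hK hH' hne (fun n => σ (φ n)) (fun n => τ (φ n))
        (fun j => (hσ j).comp hφt) (fun j => (hτ j).comp hφt) (fun j => ?_)
        (fun n => (hno _).smul (inv_ne_zero (hv _))) ((hB.sub hφ).smul _)
      filter_upwards [hφt.eventually (htri j)] with n hn
      rw [onLine'_smul]
      exact hn.smul _
    · -- comparable case
      have key : ∀ j, bI (mα j + a/w) (mβ j + b/w) (c/w) (mα j - 1 + d/w) (mβ j - 1/2 + e/w) = 0 ∧
          bJ (mα j + a/w) (mβ j + b/w) (c/w) (mα j - 1 + d/w) (mβ j - 1/2 + e/w) = 0 := by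
        intro j
        refine (Tri_iff (φ := bq (mα j + a/w) (mβ j + b/w) (c/w) (mα j - 1 + d/w)
          (mβ j - 1/2 + e/w)) fun x y => rfl).1 ?_
        refine Tri.lim' (φ := fun n x y => (u (φ n))⁻¹ *
          onLine' (u (φ n) • A (φ n) + v (φ n) • H (φ n)) (σ (φ n) j) (τ (φ n) j) x y) ?_ ?_
        · filter_upwards [hφt.eventually (htri j)] with n hn
          exact hn.smul _
        · intro x y
          have l1 := (QF_lim hA (x := fun _ => x) (y := fun _ => y)
            (z := fun n => σ n j * x + τ n j * y)
            tendsto_const_nhds tendsto_const_nhds (((hσ j).mul_const x).add ((hτ j).mul_const y))).comp hφt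
          have l2 := (QF_lim hH (x := fun _ => x) (y := fun _ => y)
            (z := fun n => σ n j * x + τ n j * y)
            tendsto_const_nhds tendsto_const_nhds (((hσ j).mul_const x).add ((hτ j).mul_const y))).comp hφt
          rw [QF_kA] at l1
          rw [hH'] at l2
          have l3 := l1.add ((hw.inv₀ hw0).mul l2)
          have e1 : bq (mα j + a/w) (mβ j + b/w) (c/w) (mα j - 1 + d/w) (mβ j - 1/2 + e/w) x y =
            (mα j * x + mβ j * y) * (x^3+y^3) - y^3*(x+y/2) + w⁻¹ * bq a b c d e x y := by
            simp only [bq]; field_simp; ring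
          rw [e1]
          refine l3.congr' ?_
          filter_upwards [hw.eventually_ne hw0] with n hn
          have hu : u (φ n) ≠ 0 := by
            intro h0; apply hn; simp [h0]
          simp only [onLine', Function.comp_apply]
          rw [QF_add, QF_smul, QF_smul]
          have := hv (φ n)
          field_simp
      obtain ⟨h1, h2, h3, h4, h5⟩ := comparable_case (fun j => (key j).1) (fun j => (key j).2)
      apply hne
      simp only [div_eq_zero_iff, hw0, or_false] at h1 h2 h3 h4 h5
      exact ⟨h1, h2, h3, h4, h5⟩
  · -- the polar case
    push Not at hbd
    have hun : Tendsto (fun n => ‖u n / v n‖) atTop atTop := tendsto_atTop.2 fun R => by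
      filter_upwards [hbd R] with n hn using hn.le
    have hδ : Tendsto (fun n => v n / u n) atTop (nhds 0) := by
      rw [tendsto_zero_iff_norm_tendsto_zero]
      refine hun.inv_tendsto_atTop.congr fun n => ?_
      simp
    have hu0 : ∀ᶠ n in atTop, u n ≠ 0 := by
      filter_upwards [hbd 0] with n hn h0
      simp [h0] at hn
    apply hne
    apply polar_case
    · intro j
      obtain ⟨a1, a2, a3, a4, a5⟩ := hLA j
      obtain ⟨b1, b2, b3, b4, b5⟩ := hLH j
      have hl := (((((a1.mul b5).add (a5.mul b1)).const_mul 12).sub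
        (((a2.mul b4).add (a4.mul b2)).const_mul 3)).add ((a3.mul b3).const_mul 2)).add
        (hδ.mul ((((b1.mul b5).const_mul 12).sub ((b2.mul b4).const_mul 3)).add (b3.mul b3)))
      have hz := tendsto_nhds_unique (hl.congr' (f₂ := fun _ => (0:ℂ)) ?_) tendsto_const_nhds
      · linear_combination hz
      · filter_upwards [htriA j, htri j, hu0] with n h1 h2 h3
        obtain ⟨h1, -⟩ := (tri_iff_LIJ _ _ _).1 h1
        obtain ⟨h2, -⟩ := tri_comb h2
        simp only [LI, bI] at h1 h2
        have hvn := hv n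
        generalize lA (A n) (σ n j) (τ n j) = x1 at *
        generalize lB (A n) (σ n j) (τ n j) = x2 at *
        generalize lC (A n) (σ n j) (τ n j) = x3 at *
        generalize lD (A n) (σ n j) (τ n j) = x4 at *
        generalize lE (A n) (σ n j) (τ n j) = x5 at *
        generalize lA (H n) (σ n j) (τ n j) = y1 at *
        generalize lB (H n) (σ n j) (τ n j) = y2 at *
        generalize lC (H n) (σ n j) (τ n j) = y3 at *
        generalize lD (H n) (σ n j) (τ n j) = y4 at *
        generalize lE (H n) (σ n j) (τ n j) = y5 at *
        have := mul_ne_zero hvn h3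
        refine (mul_eq_zero_iff_left (mul_ne_zero hvn h3)).1 ?_
        field_simp
        linear_combination h2 - (u n)^2 * h1
    · intro j
      obtain ⟨a1, a2, a3, a4, a5⟩ := hLA j
      obtain ⟨b1, b2, b3, b4, b5⟩ := hLH j
      -- first order part
      have p1 := (((((a1.mul a3).mul b5).add ((a1.mul b3).mul a5)).add ((b1.mul a3).mul a5)).const_mul 72)
      have p2 := (((((a2.mul a3).mul b4).add ((a2.mul b3).mul a4)).add ((b2.mul a3).mul a4)).const_mul 9)
      have p3 := ((((a1.mul a4).mul b4).const_mul 2).add ((b1.mul a4).mul a4)).const_mul 27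
      have p4 := ((((a5.mul a2).mul b2).const_mul 2).add ((b5.mul a2).mul a2)).const_mul 27
      have p5 := ((a3.mul a3).mul b3).const_mul 6
      have q1 := (((((b1.mul b3).mul a5).add ((b1.mul a3).mul b5)).add ((a1.mul b3).mul b5)).const_mul 72)
      have q2 := (((((b2.mul b3).mul a4).add ((b2.mul a3).mul b4)).add ((a2.mul b3).mul b4)).const_mul 9)
      have q3 := ((((b1.mul b4).mul a4).const_mul 2).add ((a1.mul b4).mul b4)).const_mul 27
      have q4 := ((((b5.mul b2).mul a2).const_mul 2).add ((a5.mul b2).mul b2)).const_mul 27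
      have q5 := ((b3.mul b3).mul a3).const_mul 6
      have r1 := (((((b1.mul b3).mul b5).const_mul 72).add (((b2.mul b3).mul b4).const_mul 9)).sub
        (((b1.mul b4).mul b4).const_mul 27)).sub (((b5.mul b2).mul b2).const_mul 27)
      have r2 := ((b3.mul b3).mul b3).const_mul 2
      have hl := (((((p1.add p2).sub p3).sub p4).sub p5).add
        (hδ.mul ((((q1.add q2).sub q3).sub q4).sub q5))).add ((hδ.mul hδ).mul (r1.sub r2))
      have hz := tendsto_nhds_unique (hl.congr' (f₂ := fun _ => (0:ℂ)) ?_) tendsto_const_nhds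
      · linear_combination hz
      · filter_upwards [htriA j, htri j, hu0] with n h1 h2 h3
        obtain ⟨-, h1⟩ := (tri_iff_LIJ _ _ _).1 h1
        obtain ⟨-, h2⟩ := tri_comb h2
        simp only [LJ, bJ] at h1 h2
        have hvn := hv n
        clear p1 p2 p3 p4 p5 q1 q2 q3 q4 q5 r1 r2 hl
        generalize lA (A n) (σ n j) (τ n j) = x1 at *
        generalize lB (A n) (σ n j) (τ n j) = x2 at *
        generalize lC (A n) (σ n j) (τ n j) = x3 at *
        generalize lD (A n) (σ n j) (τ n j) = x4 at *
        generalize lE (A n) (σ n j) (τ n j) = x5 at *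
        generalize lA (H n) (σ n j) (τ n j) = y1 at *
        generalize lB (H n) (σ n j) (τ n j) = y2 at *
        generalize lC (H n) (σ n j) (τ n j) = y3 at *
        generalize lD (H n) (σ n j) (τ n j) = y4 at *
        generalize lE (H n) (σ n j) (τ n j) = y5 at *
        refine (mul_eq_zero_iff_left (mul_ne_zero hvn (pow_ne_zero 2 h3))).1 ?_
        field_simp
        linear_combination h2 - (u n)^3 * h1

/-- the linear substitution in a frame -/
structure Fr where
  (m0 m1 m2 m3 α β δ : ℂ)
  e0 : m0*m0+m1*m2 = 1
  e1 : m0*m1+m1*m3 = 0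
  e2 : m2*m0+m3*m2 = 0
  e3 : m2*m1+m3*m3 = 1

def Fr.a (F : Fr) (t : ℂ) : ℂ := F.α + t * (F.δ/3)
def Fr.b (F : Fr) (t : ℂ) : ℂ := F.β - t * (2*F.δ/3)

def Fr.app (F : Fr) (k : Fin 15 → ℂ) (t x y z : ℂ) : ℂ :=
  QF k (F.m0*x+F.m1*y) (F.m2*x+F.m3*y) (F.a t*x+F.b t*y+t*z)

lemma Fr.isQ (F : Fr) (k : Fin 15 → ℂ) (t : ℂ) : IsQ (F.app k t) := by
  obtain ⟨l, hl⟩ := QF_sub k ![F.m0, F.m1, 0] ![F.m2, F.m3, 0] ![F.a t, F.b t, t]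
  refine ⟨l, fun x y z => ?_⟩
  rw [← hl]
  simp [lf, Fr.app]

lemma Fr.tri (F : Fr) {k c : Fin 15 → ℂ} {t : ℂ} (hk : ∀ x y z, F.app c t x y z = QF k x y z)
    {σ τ a b : ℂ} (h1 : a * F.m0 + b * F.m2 = F.a t + t * σ)
    (h2 : a * F.m1 + b * F.m3 = F.b t + t * τ) :
    Tri (onLine' c a b) ↔ Tri (onLine' k σ τ) := by
  constructor
  · intro h
    convert h.comp F.m0 F.m1 F.m2 F.m3 using 3 with x y
    simp only [onLine', ← hk, Fr.app]
    congr 1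
    linear_combination -x * h1 - y * h2
  · intro h
    convert h.comp F.m0 F.m1 F.m2 F.m3 using 3 with x y
    simp only [onLine', ← hk, Fr.app]
    have e0 := F.e0
    have e1 := F.e1
    have e2 := F.e2
    have e3 := F.e3
    congr 1
    · linear_combination -x * e0 - y * e1
    · linear_combination -x * e2 - y * e3
    · linear_combination (F.m0*x+F.m1*y) * h1 + (F.m2*x+F.m3*y)*h2 -
        a * x * e0 - a * y * e1 - b * x * e2 - b * y * e3

lemma lf_sub (l u v w : Fin 3 → ℂ) : ∃ l' : Fin 3 → ℂ, ∀ x y z,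
    lf l (lf u x y z) (lf v x y z) (lf w x y z) = lf l' x y z :=
  ⟨fun i => l 0 * u i + l 1 * v i + l 2 * w i, fun x y z => by simp only [lf]; ring⟩

lemma lf_zero {l : Fin 3 → ℂ} (h : ∀ x y z, lf l x y z = 0) : l = 0 := by
  have h0 := h 1 0 0
  have h1 := h 0 1 0
  have h2 := h 0 0 1
  simp [lf] at h0 h1 h2
  funext i; fin_cases i <;> assumption

lemma Fr.noTL (F : Fr) {k c : Fin 15 → ℂ} {t : ℂ} (ht : t ≠ 0)
    (hk : ∀ x y z, F.app c t x y z = QF k x y z) (h : NoTL (QF c)) : NoTL (QF k) := by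
  intro l m hl hh
  -- the inverse substitution
  have e0 := F.e0
  have e1 := F.e1
  have e2 := F.e2
  have e3 := F.e3
  set w : Fin 3 → ℂ := ![-(F.a t * F.m0 + F.b t * F.m2)/t, -(F.a t * F.m1 + F.b t * F.m3)/t, 1/t]
    with hw
  have key : ∀ x y z, F.a t * (F.m0*x+F.m1*y) + F.b t * (F.m2*x+F.m3*y) + t * lf w x y z = z := by
    intro x y z
    simp [lf, hw]; field_simp; ring
  have key2 : ∀ x y z, lf w (F.m0*x+F.m1*y) (F.m2*x+F.m3*y) (F.a t*x+F.b t*y+t*z) = z := by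
    intro x y z
    simp [lf, hw]; field_simp
    linear_combination -F.a t * x * e0 - F.a t * y * e1 - F.b t * x * e2 - F.b t * y * e3
  obtain ⟨l', hl'⟩ := lf_sub l ![F.m0, F.m1, 0] ![F.m2, F.m3, 0] w
  obtain ⟨m', hm'⟩ := lf_sub m ![F.m0, F.m1, 0] ![F.m2, F.m3, 0] w
  simp only [show ∀ p q x y z : ℂ, lf ![p, q, 0] x y z = p*x+q*y by intros; simp [lf]] at hl' hm'
  have c0 : ∀ x y, F.m0 * (F.m0*x+F.m1*y) + F.m1 * (F.m2*x+F.m3*y) = x := fun x y => by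
    linear_combination x * e0 + y * e1
  have c1 : ∀ x y, F.m2 * (F.m0*x+F.m1*y) + F.m3 * (F.m2*x+F.m3*y) = y := fun x y => by
    linear_combination x * e2 + y * e3
  refine h l' m' ?_ ?_
  · rintro rfl
    apply hl
    apply lf_zero
    intro x y z
    have := hl' (F.m0*x+F.m1*y) (F.m2*x+F.m3*y) (F.a t*x+F.b t*y+t*z)
    rw [c0, c1, key2] at this
    rw [this]; simp [lf]
  · intro x y z
    rw [← hl', ← hm', ← hh, ← hk, Fr.app, c0, c1, key]

section core

/-- validity of a frame -/
def Fr.OK (F : Fr) (C₀ G : Fin 15 → ℂ) : Prop :=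
  (∀ x y z, QF C₀ (F.m0*x+F.m1*y) (F.m2*x+F.m3*y) (F.α*x+F.β*y+z) = QF C₀ x y z) ∧
  (∀ x y, QF G (F.m0*x+F.m1*y) (F.m2*x+F.m3*y) (F.α*x+F.β*y) =
    -y^3*(x+y/2) - F.δ * ((x-2*y)/3) * (x^3+y^3))

lemma Fr.limit (F : Fr) {C₀ G : Fin 15 → ℂ} (hF : F.OK C₀ G) {ω : ℂ} (hω : ω^2+ω+1 = 0)
    (hC₀ : ∀ x y z, QF C₀ x y z = z*(z-(x+y))*(z-(ω*x+ω^2*y))*(z-(x+y)-(ω*x+ω^2*y)))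
    {t : ℕ → ℂ} (ht : ∀ n, t n ≠ 0) (ht0 : Tendsto t atTop (nhds 0))
    {Gn : ℕ → Fin 15 → ℂ} (hGn : Tendsto Gn atTop (nhds G)) :
    ∃ A : ℕ → Fin 15 → ℂ, Tendsto A atTop (nhds kA) ∧
      ∀ n x y z, F.app (C₀ + t n • Gn n) (t n) x y z = QF (t n • A n) x y z := by
  choose k hk using fun n => F.isQ (C₀ + t n • Gn n) (t n)
  refine ⟨fun n => (t n)⁻¹ • k n, QF_tendsto fun x y z => ?_, fun n x y z => ?_⟩
  · set Z := z + F.δ * ((x-2*y)/3) with hZ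
    have ha : Tendsto (fun n => F.a (t n)) atTop (nhds F.α) := by
      simpa [Fr.a] using (ht0.mul_const (F.δ/3)).const_add F.α
    have hb : Tendsto (fun n => F.b (t n)) atTop (nhds F.β) := by
      simpa [Fr.b] using (ht0.mul_const (2*F.δ/3)).const_sub F.β
    have h1 := QF_lim hGn (tendsto_const_nhds (x := F.m0*x+F.m1*y))
      (tendsto_const_nhds (x := F.m2*x+F.m3*y))
      (((ha.mul_const x).add (hb.mul_const y)).add (ht0.mul_const z))
    have h2 : Tendsto (fun n => Z * (t n * Z -(x+y))*(t n*Z-(ω*x+ω^2*y))*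
      (t n*Z-(x+y)-(ω*x+ω^2*y))) atTop (nhds (Z * (0*Z -(x+y))*(0*Z-(ω*x+ω^2*y))*
      (0*Z-(x+y)-(ω*x+ω^2*y)))) := by
      have hz := ht0.mul_const Z
      exact (((hz.sub_const _).const_mul Z).mul (hz.sub_const _)).mul
        ((hz.sub_const _).sub_const _)
    have h3 := h2.add h1
    have e1 : QF kA x y z = (Z * (0*Z -(x+y))*(0*Z-(ω*x+ω^2*y))*
      (0*Z-(x+y)-(ω*x+ω^2*y))) + QF G (F.m0*x+F.m1*y) (F.m2*x+F.m3*y) (F.α*x+F.β*y+0*z) := by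
      rw [zero_mul z, add_zero, hF.2, QF_kA, hZ]
      have h3 : ω^3 = 1 := by linear_combination (ω-1)*hω
      have h4 : ω^4 = ω := by linear_combination ω*h3
      have h2 : ω^2 = -1-ω := by linear_combination hω
      ring_nf
      simp only [h3, h4, h2]
      ring_nf
      try simp only [h3, h4, h2]
      try ring
    rw [e1]
    refine h3.congr fun n => ?_
    rw [QF_smul, ← hk, Fr.app, QF_add, QF_smul]
    have := ht n
    have e2 : F.a (t n)*x+F.b (t n)*y+t n*z = F.α*x+F.β*y+t n*Z := by
      simp only [Fr.a, Fr.b, hZ]; ring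
    rw [e2, hF.1, hC₀]
    field_simp
  · simp only
    rw [smul_smul, mul_inv_cancel₀ (ht n), one_smul, hk]

lemma Fr.flexes (F : Fr) {A c : ℕ → Fin 15 → ℂ} {t : ℕ → ℂ} (ht : ∀ n, t n ≠ 0)
    (hA : Tendsto A atTop (nhds kA))
    (hAc : ∀ n x y z, F.app (c n) (t n) x y z = QF (t n • A n) x y z) :
    ∃ σ τ : ℕ → Fin 6 → ℂ, (∀ j, Tendsto (fun n => σ n j) atTop (nhds (mα j))) ∧
      (∀ j, Tendsto (fun n => τ n j) atTop (nhds (mβ j))) ∧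
      (∀ j, ∀ᶠ n in atTop, Tri (onLine' (A n) (σ n j) (τ n j))) ∧
      (∀ j, ∀ᶠ n in atTop, ∀ a b, a * F.m0 + b * F.m2 = F.a (t n) + t n * σ n j →
        a * F.m1 + b * F.m3 = F.b (t n) + t n * τ n j → Tri (onLine' (c n) a b)) := by
  choose ψ h1 h2 using lift_flex
  refine ⟨fun n j => (ψ j (A n)).1, fun n j => (ψ j (A n)).2, fun j => ?_, fun j => ?_,
    fun j => hA.eventually (h2 j), fun j => ?_⟩
  · exact (continuous_fst.tendsto _).comp ((h1 j).comp hA)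
  · exact (continuous_snd.tendsto _).comp ((h1 j).comp hA)
  · filter_upwards [hA.eventually (h2 j)] with n hn a b hab1 hab2
    rw [F.tri (hAc n) hab1 hab2, onLine'_smul]
    exact hn.smul _
end core

lemma Fr.a_lim (F : Fr) {t : ℕ → ℂ} (ht0 : Tendsto t atTop (nhds 0)) :
    Tendsto (fun n => F.a (t n)) atTop (nhds F.α) := by
  simpa [Fr.a] using (ht0.mul_const (F.δ/3)).const_add F.α
lemma Fr.b_lim (F : Fr) {t : ℕ → ℂ} (ht0 : Tendsto t atTop (nhds 0)) :
    Tendsto (fun n => F.b (t n)) atTop (nhds F.β) := by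
  simpa [Fr.b] using (ht0.mul_const (2*F.δ/3)).const_sub F.β

lemma Fr.cluster (F : Fr) {C₀ G : Fin 15 → ℂ} (hF : F.OK C₀ G) {ω : ℂ} (hω : ω^2+ω+1 = 0)
    (hC₀ : ∀ x y z, QF C₀ x y z = z*(z-(x+y))*(z-(ω*x+ω^2*y))*(z-(x+y)-(ω*x+ω^2*y)))
    {t : ℕ → ℂ} (ht : ∀ n, t n ≠ 0) (ht0 : Tendsto t atTop (nhds 0))
    {Gn : ℕ → Fin 15 → ℂ} (hGn : Tendsto Gn atTop (nhds G)) :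
    ∃ a b : ℕ → ℂ, Tendsto a atTop (nhds (F.α * F.m0 + F.β * F.m2)) ∧
      Tendsto b atTop (nhds (F.α * F.m1 + F.β * F.m3)) ∧
      ∀ᶠ n in atTop, Tri (onLine' (C₀ + t n • Gn n) (a n) (b n)) := by
  obtain ⟨A, hA, hAc⟩ := F.limit hF hω hC₀ ht ht0 hGn
  obtain ⟨σ, τ, hσ, hτ, -, h⟩ := F.flexes ht hA hAc
  have e0 := F.e0
  have e1 := F.e1
  have e2 := F.e2
  have e3 := F.e3
  have hX : Tendsto (fun n => F.a (t n) + t n * σ n 0) atTop (nhds F.α) := by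
    simpa using (F.a_lim ht0).add (ht0.mul (hσ 0))
  have hY : Tendsto (fun n => F.b (t n) + t n * τ n 0) atTop (nhds F.β) := by
    simpa using (F.b_lim ht0).add (ht0.mul (hτ 0))
  refine ⟨_, _, (hX.mul_const F.m0).add (hY.mul_const F.m2),
    (hX.mul_const F.m1).add (hY.mul_const F.m3), ?_⟩
  filter_upwards [h 0] with n hn
  apply hn
  · linear_combination (F.a (t n) + t n * σ n 0) * e0 + (F.b (t n) + t n * τ n 0) * e2
  · linear_combination (F.a (t n) + t n * σ n 0) * e1 + (F.b (t n) + t n * τ n 0) * e3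

lemma Fr.apply (F : Fr) {C₀ G : Fin 15 → ℂ} (hF : F.OK C₀ G) {ω : ℂ} (hω : ω^2+ω+1 = 0)
    (hC₀ : ∀ x y z, QF C₀ x y z = z*(z-(x+y))*(z-(ω*x+ω^2*y))*(z-(x+y)-(ω*x+ω^2*y)))
    {t : ℕ → ℂ} (ht : ∀ n, t n ≠ 0) (ht0 : Tendsto t atTop (nhds 0))
    {Gn : ℕ → Fin 15 → ℂ} (hGn : Tendsto Gn atTop (nhds G))
    {l s : ℕ → ℂ} (hs : ∀ n, s n ≠ 0) {H : ℕ → Fin 15 → ℂ} {H' : Fin 15 → ℂ}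
    (hH : Tendsto H atTop (nhds H'))
    (hfl : ∀ n a b, Tri (onLine' (C₀ + t n • Gn n) a b) →
      Tri (onLine' (l n • (C₀ + t n • Gn n) + s n • H n) a b))
    (hno : ∀ n, NoTL (QF (l n • (C₀ + t n • Gn n) + s n • H n)))
    (hne : ¬ ∀ x y, QF H' (F.m0*x+F.m1*y) (F.m2*x+F.m3*y) (F.α*x+F.β*y) = 0)
    (hTB : ∀ κ P Q : ℂ, κ ≠ 0 → (P ≠ 0 ∨ Q ≠ 0) →
      (∀ x y, QF H' (F.m0*x+F.m1*y) (F.m2*x+F.m3*y) (F.α*x+F.β*y) = κ * (Q*x-P*y)^4) →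
      (P^3+Q^3 = 0 ∨ Q = 0) ∧ ∃ F' : Fr, F'.OK C₀ G ∧
        ((F'.α*F'.m0+F'.β*F'.m2)*F.m0 + (F'.α*F'.m1+F'.β*F'.m3)*F.m2 - F.α) * P +
        ((F'.α*F'.m0+F'.β*F'.m2)*F.m1 + (F'.α*F'.m1+F'.β*F'.m3)*F.m3 - F.β) * Q ≠ 0) :
    False := by
  obtain ⟨A, hA, hAc⟩ := F.limit hF hω hC₀ ht ht0 hGn
  obtain ⟨σ, τ, hσ, hτ, hτA, h⟩ := F.flexes ht hA hAc
  have e0 := F.e0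
  have e1 := F.e1
  have e2 := F.e2
  have e3 := F.e3
  choose k hk using fun n => F.isQ (H n) (t n)
  obtain ⟨k', hk'⟩ := F.isQ H' 0
  have hlim : Tendsto k atTop (nhds k') := QF_tendsto fun x y z => by
    rw [← hk']
    simp only [← hk]
    simp only [Fr.app]
    refine QF_lim hH tendsto_const_nhds tendsto_const_nhds
      (((Tendsto.mul_const x ?_).add (Tendsto.mul_const y ?_)).add (ht0.mul_const z))
    · simpa [Fr.a] using F.a_lim ht0
    · simpa [Fr.b] using F.b_lim ht0
  have hB : ∀ n x y z, F.app (l n • (C₀ + t n • Gn n) + s n • H n) (t n) x y z =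
      QF ((l n * t n) • A n + s n • k n) x y z := by
    intro n x y z
    rw [QF_add, QF_smul (s n), ← hk, mul_smul, QF_smul (l n), ← hAc]
    simp only [Fr.app]
    rw [QF_add (l n • _), QF_smul, QF_smul]
  have hk'0 : ∀ x y z, QF k' x y z = QF H' (F.m0*x+F.m1*y) (F.m2*x+F.m3*y) (F.α*x+F.β*y) := by
    intro x y z
    rw [← hk']; simp [Fr.app, Fr.a, Fr.b]
  have hbq : ∀ x y z, QF k' x y z = bq (k' 12) (k' 13) (k' 14) (k' 0) (k' 1) x y := by
    intro x y z
    rw [hk'0, ← hk'0 x y 0]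
    simp [QF, bq]; ring
  refine frame_theorem A k k' hA hlim hbq ?_ (fun n => l n * t n) s hs σ τ hσ hτ hτA ?_ ?_ ?_
  · rintro ⟨h1, h2, h3, h4, h5⟩
    apply hne
    intro x y
    rw [← hk'0 x y 0, hbq, h1, h2, h3, h4, h5]
    simp [bq]
  · intro j
    filter_upwards [h j] with n hn
    set X := F.a (t n) + t n * σ n j with hX
    set Y := F.b (t n) + t n * τ n j with hY
    have a1 : (X * F.m0 + Y * F.m2) * F.m0 + (X * F.m1 + Y * F.m3) * F.m2 = X := by
      linear_combination X * e0 + Y * e2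
    have a2 : (X * F.m0 + Y * F.m2) * F.m1 + (X * F.m1 + Y * F.m3) * F.m3 = Y := by
      linear_combination X * e1 + Y * e3
    exact (F.tri (hB n) a1 a2).1 (hfl n _ _ (hn _ _ a1 a2))
  · intro n
    exact F.noTL (ht n) (hB n) (hno n)
  · intro κ P Q hκ hPQ hh
    obtain ⟨h4, F', hF', h5⟩ := hTB κ P Q hκ hPQ (fun x y => by rw [← hk'0 x y 0, hbq, hh])
    refine ⟨h4, ?_⟩
    obtain ⟨a, b, ha, hb, hab⟩ := F'.cluster hF' hω hC₀ ht ht0 hGn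
    refine ⟨fun n => a n * F.m0 + b n * F.m2 - F.a (t n), fun n => a n * F.m1 + b n * F.m3 - F.b (t n),
      t, _, _, ((ha.mul_const _).add (hb.mul_const _)).sub (F.a_lim ht0),
      ((ha.mul_const _).add (hb.mul_const _)).sub (F.b_lim ht0), h5, ht0, ht, ?_⟩
    filter_upwards [hab] with n hn
    refine (F.tri (hB n) ?_ ?_).1 (hfl n _ _ hn)
    · have := ht n; field_simp; ring
    · have := ht n; field_simp; ring

lemma exists_omega : ∃ ω : ℂ, ω^2+ω+1 = 0 := by
  obtain ⟨z, hz⟩ := IsAlgClosed.exists_pow_nat_eq (-3 : ℂ) (n := 2) (by norm_num)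
  exact ⟨(z-1)/2, by linear_combination hz/4⟩

def fr1 : Fr := ⟨1, 0, 0, 1, 0, 0, 0, by simp, by simp, by simp, by simp⟩

def fr2 (ω : ℂ) (hω : ω^2+ω+1 = 0) : Fr :=
  ⟨(1+2*ω)/3, -2*(1-ω)/3, -2*(2+ω)/3, -(1+2*ω)/3, -1, -1, 1,
    by linear_combination 0*hω, by ring, by ring, by linear_combination 0*hω⟩

def fr3 (ω : ℂ) (hω : ω^2+ω+1 = 0) : Fr :=
  ⟨-(1+2*ω)/3, 2*(1-ω)/3, 2*(2+ω)/3, (1+2*ω)/3, -ω, 1+ω, 1,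
    by linear_combination 0*hω, by ring, by ring, by linear_combination 0*hω⟩

def fr4 (ω : ℂ) : Fr :=
  ⟨-1, 0, 0, -1, -1-ω, ω, 1, by simp, by simp, by simp, by simp⟩

def fC (ω x y z : ℂ) : ℂ := z*(z-(x+y))*(z-(ω*x+ω^2*y))*(z-(x+y)-(ω*x+ω^2*y))

def fG (ω x y z : ℂ) : ℂ := -1/18 * (x+y)^4 + (-ω^2/9+ω/18) * (ω*x+ω^2*y)^4 +
  (-ω/9+ω^2/18) * (2*z-(x+y)-(ω*x+ω^2*y))^4 +
  (x-2*y)/3*(z-(x+y))*(z-(ω*x+ω^2*y))*(z-(x+y)-(ω*x+ω^2*y))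

lemma fG0 {ω : ℂ} (hω : ω^2+ω+1 = 0) (x y : ℂ) : -1/18 * (x+y)^4 +
   (-ω^2/9+ω/18) * (ω*x+ω^2*y)^4 + (-ω/9+ω^2/18) * ((x+y)+(ω*x+ω^2*y))^4 =
    -y^3*(x+y/2) - ((x-2*y)/3) * (x^3+y^3) := by
  have h2 : ω^2 = -1-ω := by linear_combination hω
  rw [h2]
  grind

lemma fr1_OK {ω : ℂ} (hω : ω^2+ω+1 = 0) {C G : Fin 15 → ℂ} (hC : ∀ x y z, QF C x y z = fC ω x y z)
    (hG : ∀ x y z, QF G x y z = fG ω x y z) : fr1.OK C G := by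
  refine ⟨fun x y z => by simp [fr1], fun x y => ?_⟩
  simp only [fr1, one_mul, zero_mul, zero_add, add_zero, hG]
  have h := fG0 hω x y
  simp only [fG]
  have hp : (x+y)*(ω*x+ω^2*y)*((x+y)+(ω*x+ω^2*y)) = -(x^3+y^3) := by
    have h2 : ω^2 = -1-ω := by linear_combination hω
    rw [h2]
    grind
  linear_combination h - (x-2*y)/3 * hp
lemma fr2_OK {ω : ℂ} (hω : ω^2+ω+1 = 0) {C G : Fin 15 → ℂ} (hC : ∀ x y z, QF C x y z = fC ω x y z)
    (hG : ∀ x y z, QF G x y z = fG ω x y z) : (fr2 ω hω).OK C G := by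
  have hV : ∀ x y, ((1+2*ω)/3*x+-2*(1-ω)/3*y)+(-2*(2+ω)/3*x+-(1+2*ω)/3*y) = -(x+y) := by
    intro x y; ring
  have hW : ∀ x y, ω * ((1+2*ω)/3*x+-2*(1-ω)/3*y)+ω^2*(-2*(2+ω)/3*x+-(1+2*ω)/3*y) = ω*x+ω^2*y := by
    intro x y
    grind
  refine ⟨fun x y z => ?_, fun x y => ?_⟩
  · simp only [fr2, hC, fC, hV, hW]; ring
  · simp only [fr2, hG, fG, hV, hW]; linear_combination fG0 hω x y
lemma fr3_OK {ω : ℂ} (hω : ω^2+ω+1 = 0) {C G : Fin 15 → ℂ} (hC : ∀ x y z, QF C x y z = fC ω x y z)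
    (hG : ∀ x y z, QF G x y z = fG ω x y z) : (fr3 ω hω).OK C G := by
  have hV : ∀ x y, (-(1+2*ω)/3*x+2*(1-ω)/3*y)+(2*(2+ω)/3*x+(1+2*ω)/3*y) = (x+y) := by
    intro x y; ring
  have hW : ∀ x y, ω * (-(1+2*ω)/3*x+2*(1-ω)/3*y)+ω^2*(2*(2+ω)/3*x+(1+2*ω)/3*y) = -(ω*x+ω^2*y) := by
    intro x y
    grind
  have hz : 1+ω = -ω^2 := by linear_combination hω
  refine ⟨fun x y z => ?_, fun x y => ?_⟩
  · simp only [fr3, hC, fC, hV, hW]; rw [hz]; ring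
  · simp only [fr3, hG, fG, hV, hW]; rw [hz]; linear_combination fG0 hω x y
lemma fr4_OK {ω : ℂ} (hω : ω^2+ω+1 = 0) {C G : Fin 15 → ℂ} (hC : ∀ x y z, QF C x y z = fC ω x y z)
    (hG : ∀ x y z, QF G x y z = fG ω x y z) : (fr4 ω).OK C G := by
  have hz : ∀ x y z, (-1-ω)*x+ω*y+z = z-(x+y)-(ω*x+ω^2*y) := by
    intro x y z; linear_combination y * hω
  have hz' : ∀ x y, (-1-ω)*x+ω*y = -(x+y)-(ω*x+ω^2*y) := by
    intro x y; linear_combination y * hω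
  refine ⟨fun x y z => ?_, fun x y => ?_⟩
  · simp only [fr4, hC, fC]; rw [hz]; ring
  · simp only [fr4, hG, fG]; rw [hz']; linear_combination fG0 hω x y

lemma lf3 (p q r x y z : ℂ) : lf ![p, q, r] x y z = p*x+q*y+r*z := by simp [lf]

lemma exists_C (ω : ℂ) : ∃ C : Fin 15 → ℂ, (∀ x y z, QF C x y z = fC ω x y z) ∧
    C 12 = 0 ∧ C 13 = 0 ∧ C 14 = 0 ∧ C 11 = 1 := by
  obtain ⟨C, hC⟩ := IsQ.prod4 ![0,0,1] ![-1,-1,1] ![-ω,-ω^2,1] ![-1-ω,-1-ω^2,1]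
  have h : ∀ x y z, QF C x y z = fC ω x y z := fun x y z => by
    rw [← hC]; simp only [lf3, fC]; ring
  refine ⟨C, h, ?_⟩
  have h1 : ∀ x y, bq (C 12) (C 13) (C 14) (C 0) (C 1) x y = bq 0 0 0 0 0 x y := by
    intro x y
    have := h x y 0
    simp [QF, fC] at this
    simp only [bq]; linear_combination this
  obtain ⟨a, b, c, -, -⟩ := bq_inj h1
  refine ⟨a, b, c, ?_⟩
  have := h 0 0 1
  simpa [QF, fC] using this

lemma exists_G {ω : ℂ} (hω : ω^2+ω+1 = 0) : ∃ G : Fin 15 → ℂ, (∀ x y z, QF G x y z = fG ω x y z) ∧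
    G 12 = 0 ∧ G 13 = 0 ∧ G 14 = 0 := by
  obtain ⟨G, hG⟩ := ((((IsQ.prod4 ![1,1,0] ![1,1,0] ![1,1,0] ![1,1,0]).smul (-1/18)).add
    ((IsQ.prod4 ![ω,ω^2,0] ![ω,ω^2,0] ![ω,ω^2,0] ![ω,ω^2,0]).smul (-ω^2/9+ω/18))).add
    ((IsQ.prod4 ![-1-ω,-1-ω^2,2] ![-1-ω,-1-ω^2,2] ![-1-ω,-1-ω^2,2] ![-1-ω,-1-ω^2,2]).smul
      (-ω/9+ω^2/18))).add (IsQ.prod4 ![1/3,-2/3,0] ![-1,-1,1] ![-ω,-ω^2,1] ![-1-ω,-1-ω^2,1])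
  have h : ∀ x y z, QF G x y z = fG ω x y z := fun x y z => by
    rw [← hG]; simp only [lf3, fG]; ring
  refine ⟨G, h, ?_⟩
  have h1 : ∀ x y, bq (G 12) (G 13) (G 14) (G 0) (G 1) x y = bq 0 0 0 (-1) (-1/2) x y := by
    intro x y
    have h2 := h x y 0
    have h3 := fG0 hω x y
    have hp : (x+y)*(ω*x+ω^2*y)*((x+y)+(ω*x+ω^2*y)) = -(x^3+y^3) := by
      have h2 : ω^2 = -1-ω := by linear_combination hω
      rw [h2]
      grind
    simp only [QF, fG] at h2
    simp only [bq]; linear_combination h2 + h3 - (x-2*y)/3 * hp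
  obtain ⟨a, b, c, -, -⟩ := bq_inj h1
  exact ⟨a, b, c⟩

lemma four_lines {ω : ℂ} (hω : ω^2+ω+1 = 0) {k : Fin 15 → ℂ} (h11 : k 11 = 0) (h12 : k 12 = 0)
    (h13 : k 13 = 0) (h14 : k 14 = 0) (h1 : ∀ x y, QF k x y 0 = 0)
    (h2 : ∀ x y, QF k x y (x+y) = 0) (h3 : ∀ x y, QF k x y (ω*x+ω^2*y) = 0)
    (h4 : ∀ x y, QF k x y ((x+y)+(ω*x+ω^2*y)) = 0) : k = 0 := by
  have h01 : k 0 = 0 ∧ k 1 = 0 := by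
    have a1 := h1 0 1
    have a2 := h1 1 1
    simp [QF, h12, h13, h14] at a1 a2
    exact ⟨by linear_combination a2 - a1, a1⟩
  have key : ∀ x : ℂ, x + 1 ≠ 0 → x^2-x+1 ≠ 0 → x^2+x+1 ≠ 0 →
      k 5 + k 4 * x + k 3 * x^2 + k 2 * x^3 = 0 ∧ k 8 + k 7 * x + k 6 * x^2 + 0*x^3 = 0 ∧
      k 10 + k 9 * x + 0*x^2+0*x^3 = 0 := by
    intro x hx1 hx2 hx3
    have b2 := h2 x 1
    have b3 := h3 x 1
    have b4 := h4 x 1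
    simp only [QF, h11, h12, h13, h14, h01.1, h01.2] at b2 b3 b4
    have n1 : x + 1 ≠ 0 := hx1
    have n2 : ω*x+ω^2 ≠ 0 := by
      intro h; grind
    have n3 : x+1+(ω*x+ω^2) ≠ 0 := by
      intro h; grind
    have n4 : x+1-(ω*x+ω^2) ≠ 0 := by
      intro h; grind
    set V := x + 1 with hV
    set W := ω*x+ω^2 with hW
    set p1 := k 5 + k 4 * x + k 3 * x^2 + k 2 * x^3 with hp1
    set p2 := k 8 + k 7 * x + k 6 * x^2 with hp2
    set p3 := k 10 + k 9 * x with hp3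
    have c2 : p1 + p2 * V + p3 * V^2 = 0 := by
      refine (mul_eq_zero_iff_left n1).1 ?_
      rw [hp1, hp2, hp3]; linear_combination b2
    have c3 : p1 + p2 * W + p3 * W^2 = 0 := by
      refine (mul_eq_zero_iff_left n2).1 ?_
      rw [hp1, hp2, hp3, hW]; linear_combination b3
    have c4 : p1 + p2 * (V+W) + p3 * (V+W)^2 = 0 := by
      refine (mul_eq_zero_iff_left n3).1 ?_
      rw [hp1, hp2, hp3, hW]; linear_combination b4
    have d1 : p2 + p3*(2*V+W) = 0 := by
      refine (mul_eq_zero_iff_left n2).1 ?_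
      linear_combination c4 - c2
    have d2 : p2 + p3*(2*W+V) = 0 := by
      refine (mul_eq_zero_iff_left n1).1 ?_
      linear_combination c4 - c3
    have d3 : p3 = 0 := by
      refine (mul_eq_zero_iff_left n4).1 ?_
      linear_combination d1 - d2
    have d4 : p2 = 0 := by rw [d3] at d1; simpa using d1
    have d5 : p1 = 0 := by rw [d3, d4] at c2; simpa using c2
    exact ⟨d5, by linear_combination d4, by linear_combination d3⟩
  have key2 : ∀ j : Fin 4, _ := fun j => key ((j : ℕ) : ℂ) (by fin_cases j <;> norm_num)
    (by fin_cases j <;> norm_num) (by fin_cases j <;> norm_num)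
  have hinj : Function.Injective (fun j : Fin 4 => ((j : ℕ) : ℂ)) := fun i j h =>
    Fin.ext (Nat.cast_injective (R := ℂ) h)
  obtain ⟨a1, a2, a3, a4⟩ := poly3_roots _ hinj (fun j => (key2 j).1)
  obtain ⟨a5, a6, a7, -⟩ := poly3_roots _ hinj (fun j => (key2 j).2.1)
  obtain ⟨a8, a9, -, -⟩ := poly3_roots _ hinj (fun j => (key2 j).2.2)
  obtain ⟨b1, b2⟩ := h01
  funext i
  fin_cases i <;> assumption

lemma core {ω : ℂ} (hω : ω^2+ω+1 = 0) {C G : Fin 15 → ℂ} (hC : ∀ x y z, QF C x y z = fC ω x y z)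
    (hG : ∀ x y z, QF G x y z = fG ω x y z)
    {t : ℕ → ℂ} (ht : ∀ n, t n ≠ 0) (ht0 : Tendsto t atTop (nhds 0))
    {Gn : ℕ → Fin 15 → ℂ} (hGn : Tendsto Gn atTop (nhds G))
    {l s : ℕ → ℂ} (hs : ∀ n, s n ≠ 0) {H : ℕ → Fin 15 → ℂ} {H' : Fin 15 → ℂ}
    (hH : Tendsto H atTop (nhds H')) (hH0 : H' ≠ 0)
    (h11 : H' 11 = 0) (h12 : H' 12 = 0) (h13 : H' 13 = 0) (h14 : H' 14 = 0)
    (hfl : ∀ n a b, Tri (onLine' (C + t n • Gn n) a b) →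
      Tri (onLine' (l n • (C + t n • Gn n) + s n • H n) a b))
    (hno : ∀ n, NoTL (QF (l n • (C + t n • Gn n) + s n • H n))) : False := by
  have ok1 := fr1_OK hω hC hG
  have ok2 := fr2_OK hω hC hG
  have ok3 := fr3_OK hω hC hG
  have ok4 := fr4_OK hω hC hG
  have hw1 : ω - 1 ≠ 0 := by intro h; grind
  have hw0 : ω ≠ 0 := by intro h; grind
  have hw2 : 1 + 2 * ω ≠ 0 := by intro h; grind
  by_cases h1 : ∀ x y, QF H' x y 0 = 0
  swap
  · refine fr1.apply ok1 hω hC ht ht0 hGn hs hH hfl hno ?_ ?_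
    · intro h; apply h1; simpa [fr1] using h
    · intro κ P Q hκ hPQ hh
      have := hh 1 0
      simp [fr1, QF, h12] at this
      have hQ : Q = 0 := by
        rcases this with h | h
        · exact absurd h hκ
        · exact h
      refine ⟨Or.inr hQ, fr2 ω hω, ok2, ?_⟩
      have hP : P ≠ 0 := by simpa [hQ] using hPQ
      subst hQ
      simp only [fr1, fr2]
      intro h
      apply hP
      linear_combination h
  by_cases h2 : ∀ x y, QF H' ((fr2 ω hω).m0*x+(fr2 ω hω).m1*y) ((fr2 ω hω).m2*x+(fr2 ω hω).m3*y)
      ((fr2 ω hω).α*x+(fr2 ω hω).β*y) = 0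
  swap
  · refine (fr2 ω hω).apply ok2 hω hC ht ht0 hGn hs hH hfl hno h2 ?_
    intro κ P Q hκ hPQ hh
    have := hh 1 (-1)
    have e : (fr2 ω hω).α*1+(fr2 ω hω).β*(-1) = 0 := by simp [fr2]
    rw [e, h1] at this
    have hQ : Q = -P := by
      have := (mul_eq_zero_iff_left hκ).1 this.symm
      have := pow_eq_zero_iff (n := 4) (by norm_num) |>.1 this
      linear_combination this
    subst hQ
    have hP : P ≠ 0 := by simpa using hPQ
    refine ⟨Or.inl (by ring), fr4 ω, ok4, ?_⟩
    simp only [fr2, fr4]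
    intro h
    apply hP
    apply (mul_eq_zero_iff_left hw2).1
    grind
  by_cases h3 : ∀ x y, QF H' ((fr3 ω hω).m0*x+(fr3 ω hω).m1*y) ((fr3 ω hω).m2*x+(fr3 ω hω).m3*y)
      ((fr3 ω hω).α*x+(fr3 ω hω).β*y) = 0
  swap
  · refine (fr3 ω hω).apply ok3 hω hC ht ht0 hGn hs hH hfl hno h3 ?_
    intro κ P Q hκ hPQ hh
    have := hh ω (-1)
    have e : (fr3 ω hω).α*ω+(fr3 ω hω).β*(-1) = 0 := by
      simp only [fr3]; linear_combination -hω
    rw [e, h1] at this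
    have hQ : P = -ω * Q := by
      have := (mul_eq_zero_iff_left hκ).1 this.symm
      have := pow_eq_zero_iff (n := 4) (by norm_num) |>.1 this
      linear_combination this
    subst hQ
    have hP : Q ≠ 0 := by
      rintro rfl; simp at hPQ
    refine ⟨Or.inl (by linear_combination -Q^3*(ω-1)*hω), fr4 ω, ok4, ?_⟩
    simp only [fr3, fr4]
    intro h
    apply hP
    apply (mul_eq_zero_iff_left hw1).1
    grind
  by_cases h4 : ∀ x y, QF H' ((fr4 ω).m0*x+(fr4 ω).m1*y) ((fr4 ω).m2*x+(fr4 ω).m3*y)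
      ((fr4 ω).α*x+(fr4 ω).β*y) = 0
  swap
  · refine (fr4 ω).apply ok4 hω hC ht ht0 hGn hs hH hfl hno h4 ?_
    intro κ P Q hκ hPQ hh
    have := hh 1 (-ω)
    have e : (fr4 ω).α*1+(fr4 ω).β*(-ω) = 0 := by
      simp only [fr4]; linear_combination -hω
    rw [e, h1] at this
    have hQ : Q = -ω * P := by
      have := (mul_eq_zero_iff_left hκ).1 this.symm
      have := pow_eq_zero_iff (n := 4) (by norm_num) |>.1 this
      linear_combination this
    subst hQ
    have hP : P ≠ 0 := by
      rintro rfl; simp at hPQ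
    refine ⟨Or.inl (by linear_combination -P^3*(ω-1)*hω), fr3 ω hω, ok3, ?_⟩
    simp only [fr3, fr4]
    intro h
    apply hP
    apply (mul_eq_zero_iff_left hw1).1
    grind
  apply hH0
  refine four_lines hω h11 h12 h13 h14 h1 ?_ ?_ ?_
  · intro x y
    have := h2 ((fr2 ω hω).m0*x+(fr2 ω hω).m1*y) ((fr2 ω hω).m2*x+(fr2 ω hω).m3*y)
    rw [← this]
    simp only [fr2]
    congr 1
    · ring
    · ring
    · ring
  · intro x y
    have := h3 ((fr3 ω hω).m0*x+(fr3 ω hω).m1*y) ((fr3 ω hω).m2*x+(fr3 ω hω).m3*y)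
    rw [← this]
    simp only [fr3]
    congr 1
    · ring
    · ring
    · grind
  · intro x y
    have := h4 ((fr4 ω).m0*x+(fr4 ω).m1*y) ((fr4 ω).m2*x+(fr4 ω).m3*y)
    rw [← this]
    simp only [fr4]
    congr 1
    · ring
    · ring
    · linear_combination y * hω

/-- the embedding of the coefficient space of `W` -/
def e12 (c : Fin 12 → ℂ) : Fin 15 → ℂ := fun i => if h : i.1 < 12 then c ⟨i.1, h⟩ else 0

def r12 (k : Fin 15 → ℂ) : Fin 12 → ℂ := fun i => k (i.castLE (by norm_num))

lemma e12_r12 {k : Fin 15 → ℂ} (h12 : k 12 = 0) (h13 : k 13 = 0) (h14 : k 14 = 0) :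
    e12 (r12 k) = k := by
  funext i
  fin_cases i <;> simp [e12, r12] <;> first | exact h12.symm | exact h13.symm | exact h14.symm | rfl

lemma r12_e12 (c : Fin 12 → ℂ) : r12 (e12 c) = c := by
  funext i
  simp [e12, r12]

lemma e12_add (c d : Fin 12 → ℂ) : e12 (c + d) = e12 c + e12 d := by
  funext i
  by_cases h : i.1 < 12 <;> simp [e12, h]

lemma e12_smul (t : ℂ) (c : Fin 12 → ℂ) : e12 (t • c) = t • e12 c := by
  funext i
  by_cases h : i.1 < 12 <;> simp [e12, h]

lemma e12_cont : Continuous e12 := by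
  refine continuous_pi fun i => ?_
  by_cases h : i.1 < 12
  · simpa only [e12, h, dif_pos] using continuous_apply _
  · simpa only [e12, h, dif_neg, not_false_eq_true] using continuous_const

lemma poly_dense {n : ℕ} {Ψ : MvPolynomial (Fin n) ℂ} (h : Ψ ≠ 0) (c : Fin n → ℂ) {ε : ℝ}
    (hε : 0 < ε) : ∃ c', dist c' c < ε ∧ MvPolynomial.eval c' Ψ ≠ 0 := by
  by_contra hcon
  push Not at hcon
  apply h
  refine MvPolynomial.funext_set (fun i => Metric.ball (c i) (ε/2)) (fun i => ?_) fun x hx => ?_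
  · exact infinite_of_mem_nhds (c i) (Metric.ball_mem_nhds _ (by positivity))
  · rw [map_zero]
    apply hcon
    refine lt_of_le_of_lt ((dist_pi_le_iff (by positivity)).2 fun i => (hx i trivial).le) (half_lt_self hε)

lemma exists_seq {ω : ℂ} (hω : ω^2+ω+1 = 0) {Ψ : MvPolynomial (Fin 12) ℂ} (hΨ : Ψ ≠ 0) :
    ∃ (C G : Fin 15 → ℂ) (t : ℕ → ℂ) (Gn : ℕ → Fin 15 → ℂ),
      (∀ x y z, QF C x y z = fC ω x y z) ∧ (∀ x y z, QF G x y z = fG ω x y z) ∧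
      (∀ n, t n ≠ 0) ∧ Tendsto t atTop (nhds 0) ∧ Tendsto Gn atTop (nhds G) ∧
      (∀ n, e12 (r12 (C + t n • Gn n)) = C + t n • Gn n) ∧
      (∀ n, MvPolynomial.eval (r12 (C + t n • Gn n)) Ψ ≠ 0) := by
  obtain ⟨C, hC, C12, C13, C14, C11⟩ := exists_C ω
  obtain ⟨G, hG, G12, G13, G14⟩ := exists_G hω
  have hC' := e12_r12 C12 C13 C14
  have hG' := e12_r12 G12 G13 G14
  set t : ℕ → ℂ := fun n => 1 / ((n:ℂ)+1) with ht
  have ht0 : ∀ n, t n ≠ 0 := fun n => one_div_ne_zero (Nat.cast_add_one_ne_zero n)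
  choose c hc1 hc2 using fun n => poly_dense hΨ (r12 C + t n • r12 G)
    (ε := ‖t n‖ * (1/((n:ℝ)+1))) (mul_pos (norm_pos_iff.2 (ht0 n)) (by positivity))
  set g : ℕ → Fin 12 → ℂ := fun n => (t n)⁻¹ • (c n - r12 C) with hg
  have hcg : ∀ n, c n = r12 C + t n • g n := fun n => by
    rw [hg]; simp only; rw [smul_smul, mul_inv_cancel₀ (ht0 n), one_smul]; abel
  have hglim : Tendsto g atTop (nhds (r12 G)) := by
    rw [tendsto_iff_dist_tendsto_zero]
    refine squeeze_zero (fun _ => dist_nonneg) (fun n => ?_) tendsto_one_div_add_atTop_nhds_zero_nat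
    have := hc1 n
    rw [hcg, dist_add_left, dist_smul₀] at this
    exact (lt_of_mul_lt_mul_left this (norm_nonneg _)).le
  have he : ∀ n, C + t n • e12 (g n) = e12 (c n) := fun n => by
    have h1 : e12 (r12 C + t n • g n) = C + t n • e12 (g n) := by
      rw [e12_add, e12_smul (t n) (g n), hC']
    rw [← h1, ← hcg n]
  refine ⟨C, G, t, fun n => e12 (g n), hC, hG, ht0, tendsto_one_div_add_atTop_nhds_zero_nat, ?_, ?_, ?_⟩
  · have := (e12_cont.tendsto _).comp hglim
    rwa [hG'] at this
  · intro n; rw [he, r12_e12]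
  · intro n; rw [he, r12_e12]; exact hc2 n

theorem thmA {Ψ : MvPolynomial (Fin 12) ℂ} (hΨ : Ψ ≠ 0)
    (h : ∀ c, MvPolynomial.eval c Ψ ≠ 0 → ∃ c', NoTL (QF (e12 c')) ∧ (∀ μ : ℂ, c' ≠ μ • c) ∧
      ∀ a b, Tri (onLine' (e12 c) a b) → Tri (onLine' (e12 c') a b)) : False := by
  obtain ⟨ω, hω⟩ := exists_omega
  obtain ⟨C, G, t, Gn, hC, hG, ht, ht0, hGn, hcn, hΨn⟩ := exists_seq hω
    (mul_ne_zero hΨ (MvPolynomial.X_ne_zero (R := ℂ) (11 : Fin 12)))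
  simp only [map_mul, MvPolynomial.eval_X] at hΨn
  set c : ℕ → Fin 12 → ℂ := fun n => r12 (C + t n • Gn n) with hc
  have hc11 : ∀ n, c n 11 ≠ 0 := fun n => right_ne_zero_of_mul (hΨn n)
  choose c' hno hprop hfl using fun n => h (c n) (left_ne_zero_of_mul (hΨn n))
  set l : ℕ → ℂ := fun n => c' n 11 / c n 11 with hl
  set D : ℕ → Fin 12 → ℂ := fun n => c' n - l n • c n with hD
  have hD0 : ∀ n, D n ≠ 0 := fun n h0 => hprop n (l n) (sub_eq_zero.1 h0)
  have hD11 : ∀ n, D n 11 = 0 := fun n => by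
    have := hc11 n
    simp only [hD, hl, Pi.sub_apply, Pi.smul_apply, smul_eq_mul]
    field_simp; ring
  set s : ℕ → ℂ := fun n => (‖D n‖ : ℂ) with hs
  have hs0 : ∀ n, s n ≠ 0 := fun n => by simpa [hs] using hD0 n
  set H : ℕ → Fin 12 → ℂ := fun n => (s n)⁻¹ • D n with hH
  have hHn : ∀ n, H n ∈ Metric.sphere (0 : Fin 12 → ℂ) 1 := fun n => by
    have := norm_ne_zero_iff.2 (hD0 n)
    simp [hH, hs, norm_smul, this]
  have hH11 : ∀ n, H n 11 = 0 := fun n => by simp [hH, hD11]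
  obtain ⟨H', hH'1, φ, hφ, hlim⟩ := (isCompact_sphere (0 : Fin 12 → ℂ) 1).tendsto_subseq hHn
  have hφt := hφ.tendsto_atTop
  have hH'11 : H' 11 = 0 := by
    have := ((continuous_apply (11 : Fin 12)).tendsto H').comp hlim
    refine tendsto_nhds_unique this ?_
    simp [Function.comp_def, hH11]
  have hH'0 : H' ≠ 0 := by
    rintro rfl; simp at hH'1
  have hc' : ∀ n, l n • (C + t n • Gn n) + s n • e12 (H n) = e12 (c' n) := fun n => by
    rw [← hcn, ← e12_smul, ← e12_smul, ← e12_add, hH]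
    congr 1
    simp only
    rw [smul_smul, mul_inv_cancel₀ (hs0 n), one_smul, hD, hc]
    simp
  refine core hω hC hG (t := fun n => t (φ n)) (fun n => ht _) (ht0.comp hφt)
    (Gn := fun n => Gn (φ n)) (hGn.comp hφt) (l := fun n => l (φ n)) (s := fun n => s (φ n))
    (fun n => hs0 _) (H := fun n => e12 (H (φ n))) ((e12_cont.tendsto _).comp hlim) ?_ ?_ ?_ ?_ ?_ ?_ ?_
  · intro h0
    apply hH'0
    rw [← r12_e12 H', h0]; rfl
  · exact hH'11
  · rfl
  · rfl
  · rfl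
  · intro n a b
    simp only [hc']
    intro h1
    apply hfl
    rwa [hc, hcn]
  · intro n
    simp only [hc']
    exact hno _

theorem KL_aux2 {R F E : Type} [CommRing R] [IsDomain R] [Field F] [Algebra R F]
    [IsFractionRing R F] [Field E] [Algebra F E] [Module.Finite F E] :
    ∃ _ : Algebra R E, algebraMap R E = (algebraMap F E).comp (algebraMap R F) ∧
      Function.Injective (algebraMap R E) ∧ Algebra.IsAlgebraic R E := by
  letI : Algebra R E := ((algebraMap F E).comp (algebraMap R F)).toAlgebra
  haveI : IsScalarTower R F E := IsScalarTower.of_algebraMap_eq (fun _ => rfl)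
  refine ⟨inferInstance, rfl, ?_, ?_⟩
  · rw [IsScalarTower.algebraMap_eq R F E]
    exact (algebraMap F E).injective.comp (IsFractionRing.injective R F)
  · exact (IsFractionRing.comap_isAlgebraic_iff (A := R) (K := F) (C := E)).2 inferInstance

theorem KL_aux {σ τ : Type} [Finite σ] [Finite τ]
    (S : Set (MvPolynomial τ (MvPolynomial σ ℂ)))
    (hS : ∀ r : MvPolynomial σ ℂ, r ≠ 0 → MvPolynomial.C r ∉ Ideal.span S) :
    ∃ (E : Type) (_ : Field E) (_ : Algebra (MvPolynomial σ ℂ) E) (y0 : τ → E),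
      Function.Injective (algebraMap (MvPolynomial σ ℂ) E) ∧
      Algebra.IsAlgebraic (MvPolynomial σ ℂ) E ∧
      ∀ p ∈ S, MvPolynomial.eval₂ (algebraMap (MvPolynomial σ ℂ) E) y0 p = 0 := by
  classical
  let R := MvPolynomial σ ℂ
  let F := FractionRing R
  letI : Algebra (MvPolynomial τ R) (MvPolynomial τ F) := MvPolynomial.algebraMvPolynomial
  have hloc : IsLocalization ((nonZeroDivisors R).map (MvPolynomial.C (σ := τ)))
    (MvPolynomial τ F) := MvPolynomial.isLocalization _ _
  have hne : (Ideal.span S).map (algebraMap (MvPolynomial τ R) (MvPolynomial τ F)) ≠ ⊤ := by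
    rw [IsLocalization.map_algebraMap_ne_top_iff_disjoint
      ((nonZeroDivisors R).map (MvPolynomial.C (σ := τ)))]
    rw [Set.disjoint_left]
    rintro _ ⟨r, hr, rfl⟩ h2
    exact hS r (nonZeroDivisors.ne_zero hr) h2
  obtain ⟨m, hm, hle⟩ := Ideal.exists_le_maximal _ hne
  let E := MvPolynomial τ F ⧸ m
  letI : Field E := Ideal.Quotient.field m
  haveI : Algebra.FiniteType F E := inferInstance
  haveI : Module.Finite F E := finite_of_finite_type_of_isJacobsonRing F E
  obtain ⟨alg, halg, hinj, hal⟩ := KL_aux2 (R := R) (F := F) (E := E)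
  let y0 : τ → E := fun i => Ideal.Quotient.mk m (MvPolynomial.X i)
  refine ⟨E, inferInstance, alg, y0, hinj, hal, ?_⟩
  intro p hp
  have h1 : algebraMap (MvPolynomial τ R) (MvPolynomial τ F) p ∈ m :=
    hle (Ideal.mem_map_of_mem _ (Ideal.subset_span hp))
  have h2 := Ideal.Quotient.eq_zero_iff_mem.2 h1
  rw [← h2, halg]
  have h3 : MvPolynomial.eval₂Hom ((algebraMap F E).comp (algebraMap R F)) y0 =
    (Ideal.Quotient.mk m).comp (algebraMap (MvPolynomial τ R) (MvPolynomial τ F)) := by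
    apply MvPolynomial.ringHom_ext
    · intro r
      rw [MvPolynomial.algebraMap_def, RingHom.comp_apply]
      erw [MvPolynomial.map_C]
      simp
      rfl
    · intro i
      rw [MvPolynomial.algebraMap_def, RingHom.comp_apply]
      erw [MvPolynomial.map_X]
      simp [y0]
  exact congrArg (fun g => g p) h3

theorem KL_one {σ τ : Type} [Finite σ] [Finite τ]
    (S : Set (MvPolynomial τ (MvPolynomial σ ℂ)))
    (hS : ∀ r : MvPolynomial σ ℂ, r ≠ 0 → MvPolynomial.C r ∉ Ideal.span S) :
    ∃ Ψ : MvPolynomial σ ℂ, Ψ ≠ 0 ∧ ∀ c, MvPolynomial.eval c Ψ ≠ 0 →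
      ∃ y : τ → ℂ, ∀ p ∈ S, MvPolynomial.eval₂ (MvPolynomial.eval c) y p = 0 := by
  classical
  cases nonempty_fintype τ
  let R := MvPolynomial σ ℂ
  obtain ⟨E, iE, iA, y0, hinj, hal, hy0⟩ := KL_aux S hS
  obtain ⟨Ψ, hΨ, hInt⟩ := Algebra.IsAlgebraic.exists_integral_multiples R
    (Finset.univ.image y0)
  have hInt' : ∀ i, IsIntegral R (Ψ • y0 i) := fun i => hInt _ (by simp)
  refine ⟨Ψ, hΨ, fun c hc => ?_⟩
  let B := integralClosure R E
  have hinjB : Function.Injective (algebraMap R B) := fun x y h => hinj (congrArg Subtype.val h)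
  let mc : Ideal R := RingHom.ker (MvPolynomial.eval c)
  have hsurj : Function.Surjective (MvPolynomial.eval c : R →+* ℂ) := fun z =>
    ⟨MvPolynomial.C z, by simp⟩
  haveI : mc.IsMaximal := RingHom.ker_isMaximal_of_surjective _ hsurj
  haveI : Algebra.IsIntegral R B := integralClosure.AlgebraIsIntegral
  obtain ⟨Q, hQ, hQc⟩ := Ideal.exists_ideal_over_maximal_of_isIntegral (S := B) mc (by
    rw [(RingHom.injective_iff_ker_eq_bot _).1 hinjB]; exact bot_le)
  letI : Field (B ⧸ Q) := Ideal.Quotient.field Q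
  let q := Ideal.Quotient.mk Q
  let g : ℂ →+* B ⧸ Q := (q.comp (algebraMap R B)).comp MvPolynomial.C
  have hg : ∀ r : R, q (algebraMap R B r) = g (MvPolynomial.eval c r) := by
    intro r
    have : r - MvPolynomial.C (MvPolynomial.eval c r) ∈ Q.comap (algebraMap R B) := by
      rw [hQc, RingHom.mem_ker, map_sub, MvPolynomial.eval_C, sub_self]
    have h2 := Ideal.Quotient.eq_zero_iff_mem.2 (Ideal.mem_comap.1 this)
    rw [map_sub, map_sub, sub_eq_zero] at h2
    exact h2
  have hgint : g.IsIntegral := by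
    intro x
    obtain ⟨b, rfl⟩ := Ideal.Quotient.mk_surjective x
    obtain ⟨P, hP, hP0⟩ := Algebra.IsIntegral.isIntegral (R := R) b
    refine ⟨P.map (MvPolynomial.eval c), hP.map _, ?_⟩
    have h1 : g.comp (MvPolynomial.eval c) = q.comp (algebraMap R B) :=
      RingHom.ext fun r => (hg r).symm
    rw [Polynomial.eval₂_map, h1]
    have h2 := Polynomial.hom_eval₂ P (algebraMap R B) q b
    rw [hP0, map_zero] at h2
    exact h2.symm
  obtain ⟨gi, gs⟩ := IsAlgClosed.ringHom_bijective_of_isIntegral g hgint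
  let ge := RingEquiv.ofBijective g ⟨gi, gs⟩
  let ψ : B →+* ℂ := (ge.symm : B ⧸ Q →+* ℂ).comp q
  have hψ : ∀ r : R, ψ (algebraMap R B r) = MvPolynomial.eval c r := by
    intro r
    change ge.symm (q (algebraMap R B r)) = _
    rw [hg]
    exact ge.symm_apply_apply _
  let Y : τ → B := fun i => ⟨Ψ • y0 i, hInt' i⟩
  let cΨ := MvPolynomial.eval c Ψ
  have hcΨ : cΨ ≠ 0 := hc
  let y : τ → ℂ := fun i => ψ (Y i) / cΨ
  have key : ∀ p : MvPolynomial τ R, ∃ (N : ℕ) (b : B),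
      (b : E) = (algebraMap R E Ψ)^N * MvPolynomial.eval₂ (algebraMap R E) y0 p ∧
      ψ b = cΨ ^ N * MvPolynomial.eval₂ (MvPolynomial.eval c) y p := by
    intro p
    induction p using MvPolynomial.induction_on with
    | C r => exact ⟨0, algebraMap R B r, by simp, by simp [hψ]⟩
    | add p1 p2 h1 h2 =>
      obtain ⟨N1, b1, e1, f1⟩ := h1
      obtain ⟨N2, b2, e2, f2⟩ := h2
      refine ⟨N1 + N2, algebraMap R B (Ψ^N2) * b1 + algebraMap R B (Ψ^N1) * b2, ?_, ?_⟩
      · have h3 : ∀ r : R, ((algebraMap R B r : B) : E) = algebraMap R E r := fun r => rfl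
        push_cast
        rw [e1, e2, MvPolynomial.eval₂_add]; ring
      · rw [map_add, map_mul, map_mul, hψ, hψ, f1, f2, MvPolynomial.eval₂_add, map_pow, map_pow]
        ring
    | mul_X p i h =>
      obtain ⟨N, b, e, f⟩ := h
      refine ⟨N + 1, b * Y i, ?_, ?_⟩
      · push_cast
        rw [e, MvPolynomial.eval₂_mul, MvPolynomial.eval₂_X]
        simp only [Y, Algebra.smul_def]
        ring
      · rw [map_mul, f, MvPolynomial.eval₂_mul, MvPolynomial.eval₂_X]
        have : ψ (Y i) = cΨ * y i := by simp only [y]; field_simp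
        rw [this]; ring
  refine ⟨y, fun p hp => ?_⟩
  obtain ⟨N, b, e, f⟩ := key p
  rw [hy0 p hp, mul_zero] at e
  have hb : b = 0 := Subtype.ext e
  rw [hb, map_zero] at f
  exact (mul_eq_zero.1 f.symm).resolve_left (pow_ne_zero _ hcΨ)

def PF {σ τ : Type} (f : (σ → ℂ) → (τ → ℂ) → ℂ) : Prop :=
  ∃ p : MvPolynomial τ (MvPolynomial σ ℂ), ∀ c y,
    f c y = MvPolynomial.eval₂ (MvPolynomial.eval c) y p

section
variable {σ τ : Type} {f g : (σ → ℂ) → (τ → ℂ) → ℂ}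
theorem PF.const (a : ℂ) : PF (fun (_ : σ → ℂ) (_ : τ → ℂ) => a) :=
  ⟨MvPolynomial.C (MvPolynomial.C a), by simp⟩
theorem PF.fst (i : σ) : PF (fun (c : σ → ℂ) (_ : τ → ℂ) => c i) :=
  ⟨MvPolynomial.C (MvPolynomial.X i), by simp⟩
theorem PF.poly (P : MvPolynomial σ ℂ) :
    PF (fun (c : σ → ℂ) (_ : τ → ℂ) => MvPolynomial.eval c P) :=
  ⟨MvPolynomial.C P, by simp⟩
theorem PF.snd (i : τ) : PF (fun (_ : σ → ℂ) (y : τ → ℂ) => y i) :=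
  ⟨MvPolynomial.X i, by simp⟩
theorem PF.add (hf : PF f) (hg : PF g) : PF (fun c y => f c y + g c y) := by
  obtain ⟨p, hp⟩ := hf
  obtain ⟨q, hq⟩ := hg
  exact ⟨p + q, fun c y => by beta_reduce; rw [hp, hq, MvPolynomial.eval₂_add]⟩
theorem PF.mul (hf : PF f) (hg : PF g) : PF (fun c y => f c y * g c y) := by
  obtain ⟨p, hp⟩ := hf
  obtain ⟨q, hq⟩ := hg
  exact ⟨p * q, fun c y => by beta_reduce; rw [hp, hq, MvPolynomial.eval₂_mul]⟩
theorem PF.sub (hf : PF f) (hg : PF g) : PF (fun c y => f c y - g c y) := by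
  have := hf.add ((PF.const (-1)).mul hg)
  simpa [sub_eq_add_neg] using this
theorem PF.neg (hf : PF f) : PF (fun c y => - f c y) := by
  simpa using (PF.const (-1)).mul hf
theorem PF.pow (hf : PF f) (n : ℕ) : PF (fun c y => f c y ^ n) := by
  induction n with
  | zero => simpa using PF.const 1
  | succ n ih => simpa [pow_succ] using ih.mul hf
theorem PF.sum {ι : Type} (s : Finset ι) {f : ι → (σ → ℂ) → (τ → ℂ) → ℂ} (h : ∀ i, PF (f i)) :
    PF (fun c y => ∑ i ∈ s, f i c y) := by
  classical
  induction s using Finset.induction_on with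
  | empty => simpa using PF.const 0
  | insert a s ha ih => simpa [Finset.sum_insert ha] using (h a).add ih
/-- substitution of polynomial functions into a polynomial -/
theorem PF.subst {ρ : Type} (P : MvPolynomial ρ ℂ) {f : ρ → (σ → ℂ) → (τ → ℂ) → ℂ}
    (h : ∀ i, PF (f i)) : PF (fun c y => MvPolynomial.eval (fun i => f i c y) P) := by
  induction P using MvPolynomial.induction_on with
  | C a => simpa using PF.const a
  | add p q hp hq => simpa using hp.add hq
  | mul_X p i hp => simpa using hp.mul (h i)
end

theorem KL {σ τ ι : Type} [Finite σ] [Finite τ] (f : ι → (σ → ℂ) → (τ → ℂ) → ℂ)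
    (hf : ∀ i, PF (f i)) :
    (∃ Ψ : MvPolynomial σ ℂ, Ψ ≠ 0 ∧ ∀ c, MvPolynomial.eval c Ψ ≠ 0 →
      ∃ y : τ → ℂ, ∀ i, f i c y = 0) ∨
    (∃ Φ : MvPolynomial σ ℂ, Φ ≠ 0 ∧ ∀ c y, (∀ i, f i c y = 0) → MvPolynomial.eval c Φ = 0) := by
  choose p hp using hf
  by_cases h : ∀ r : MvPolynomial σ ℂ, r ≠ 0 → MvPolynomial.C r ∉ Ideal.span (Set.range p)
  · left
    obtain ⟨Ψ, h1, h2⟩ := KL_one (Set.range p) h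
    refine ⟨Ψ, h1, fun c hc => ?_⟩
    obtain ⟨y, hy⟩ := h2 c hc
    exact ⟨y, fun i => by rw [hp]; exact hy _ ⟨i, rfl⟩⟩
  · right
    push Not at h
    obtain ⟨r, hr, hm⟩ := h
    refine ⟨r, hr, fun c y h0 => ?_⟩
    have h1 : Ideal.span (Set.range p) ≤
        RingHom.ker (MvPolynomial.eval₂Hom (MvPolynomial.eval c) y) := by
      rw [Ideal.span_le]
      rintro _ ⟨i, rfl⟩
      have := h0 i
      rw [hp] at this
      exact this
    have h2 := h1 hm
    rw [RingHom.mem_ker] at h2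
    simpa using h2

theorem TD {σ ρ : Type} [Fintype σ] [Fintype ρ] (h : Fintype.card σ < Fintype.card ρ)
    (q : ρ → MvPolynomial σ ℂ) : ∃ P : MvPolynomial ρ ℂ, P ≠ 0 ∧
      ∀ v, MvPolynomial.eval (fun i => MvPolynomial.eval v (q i)) P = 0 := by
  have hn : ¬ AlgebraicIndependent ℂ q := by
    intro ha
    have := ha.cardinalMk_le_trdeg
    rw [MvPolynomial.trdeg_of_isDomain, Cardinal.mk_fintype, Cardinal.mk_fintype] at this
    simp at this
    omega
  rw [algebraicIndependent_iff] at hn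
  push Not at hn
  obtain ⟨P, h1, h2⟩ := hn
  refine ⟨P, h2, fun v => ?_⟩
  have := congrArg (MvPolynomial.eval v) h1
  rw [map_zero, MvPolynomial.aeval_def, MvPolynomial.eval₂_eq_eval_map] at this
  have h3 : MvPolynomial.eval v (MvPolynomial.eval q (MvPolynomial.map (algebraMap ℂ (MvPolynomial σ ℂ)) P)) = MvPolynomial.eval (fun i => MvPolynomial.eval v (q i)) P := by
    clear h1 h2 this
    induction P using MvPolynomial.induction_on with
    | C a => simp [MvPolynomial.algebraMap_eq]
    | add p q hp hq => rw [map_add, map_add, map_add, map_add, hp, hq]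
    | mul_X p i hp => rw [map_mul, map_mul, map_mul, map_mul, hp]; simp
  rw [← h3]; exact this

/-- `q` is a singular point of the quartic function `f` (or `q = 0`). -/
def Sg (f : ℂ → ℂ → ℂ → ℂ) (q : Fin 3 → ℂ) : Prop :=
  ∀ v : Fin 3 → ℂ, ∃ α β γ : ℂ, ∀ t : ℂ,
    f (q 0 + t * v 0) (q 1 + t * v 1) (q 2 + t * v 2) = α*t^2+β*t^3+γ*t^4

lemma e12_vals (c : Fin 12 → ℂ) : e12 c 0 = c 0 ∧ e12 c 1 = c 1 ∧ e12 c 2 = c 2 ∧ e12 c 3 = c 3 ∧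
    e12 c 4 = c 4 ∧ e12 c 5 = c 5 ∧ e12 c 6 = c 6 ∧ e12 c 7 = c 7 ∧ e12 c 8 = c 8 ∧ e12 c 9 = c 9 ∧
    e12 c 10 = c 10 ∧ e12 c 11 = c 11 ∧ e12 c 12 = 0 ∧ e12 c 13 = 0 ∧ e12 c 14 = 0 := by
  refine ⟨?_, ?_, ?_, ?_, ?_, ?_, ?_, ?_, ?_, ?_, ?_, ?_, ?_, ?_, ?_⟩ <;> rfl

lemma QF_e12 (c : Fin 12 → ℂ) (x y z : ℂ) : QF (e12 c) x y z =
    c 0 * x*y^3 + c 1 * y^4 + z*(c 2 * x^3 + c 3 * x^2*y + c 4 * x*y^2 + c 5 * y^3)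
  + z^2*(c 6 * x^2 + c 7 * x*y + c 8 * y^2) + z^3*(c 9 * x + c 10 * y) + c 11 * z^4 := by
  obtain ⟨h0, h1, h2, h3, h4, h5, h6, h7, h8, h9, h10, h11, h12, h13, h14⟩ := e12_vals c
  simp only [QF, h0, h1, h2, h3, h4, h5, h6, h7, h8, h9, h10, h11, h12, h13, h14]
  ring

lemma Sg.scale {f : ℂ → ℂ → ℂ → ℂ} {q : Fin 3 → ℂ} {l : ℂ}
    (hf : ∀ x y z, f (l*x) (l*y) (l*z) = l^4 * f x y z)
    (h : Sg f q) (hl : l ≠ 0) : Sg f (l • q) := by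
  intro v
  obtain ⟨α, β, γ, ha⟩ := h (l⁻¹ • v)
  refine ⟨l^4*α, l^4*β, l^4*γ, fun t => ?_⟩
  have := ha t
  have h2 := hf (q 0 + t * (l⁻¹ • v) 0) (q 1 + t * (l⁻¹ • v) 1) (q 2 + t * (l⁻¹ • v) 2)
  rw [this] at h2
  have h3 : ∀ i, l * (q i + t * (l⁻¹ • v) i) = (l • q) i + t * v i := by
    intro i; simp only [Pi.smul_apply, smul_eq_mul]; field_simp
  rw [h3, h3, h3] at h2
  rw [h2]; ring

lemma QF_homog (k : Fin 15 → ℂ) (l x y z : ℂ) : QF k (l*x) (l*y) (l*z) = l^4 * QF k x y z := by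
  simp only [QF]; ring

theorem gen_smooth : ∃ Ψ : MvPolynomial (Fin 12) ℂ, Ψ ≠ 0 ∧ ∀ c, MvPolynomial.eval c Ψ ≠ 0 →
    c 0 ≠ 0 ∧ c 2 ≠ 0 ∧ ∀ q : Fin 3 → ℂ, q ≠ 0 → ¬ Sg (QF (e12 c)) q := by
  let x : Fin 11 → MvPolynomial (Fin 11) ℂ := MvPolynomial.X
  let fx : MvPolynomial (Fin 11) ℂ :=
    x 0 * x 10^3 + 3*x 2 * x 9^2 + 2 * x 3 * x 9 * x 10 + x 4 * x 10^2 + 2 * x 6 * x 9 + x 7 * x 10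
  let fy : MvPolynomial (Fin 11) ℂ :=
    3*x 0 * x 9 * x 10^2 + 4*x 1 * x 10^3 + x 3 * x 9^2 + 2*x 4 * x 9 * x 10 + 3 * x 5 * x 10^2
      + x 7 * x 9 + 2 * x 8 * x 10
  let ff : MvPolynomial (Fin 11) ℂ :=
    x 0 * x 9 * x 10^3 + x 1 * x 10^4 + x 2 * x 9^3 + x 3 * x 9^2 * x 10 + x 4 * x 9 * x 10^2
      + x 5 * x 10^3 + x 6 * x 9^2 + x 7 * x 9 * x 10 + x 8 * x 10^2 - fx * x 9 - fy * x 10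
  obtain ⟨P, hP, hP0⟩ := TD (σ := Fin 11) (ρ := Fin 12) (by simp)
    ![x 0, x 1, x 2, x 3, x 4, x 5, x 6, x 7, x 8, -fx, -fy, -ff]
  refine ⟨P * (MvPolynomial.X 0 * MvPolynomial.X 2), mul_ne_zero hP
    (mul_ne_zero (MvPolynomial.X_ne_zero _) (MvPolynomial.X_ne_zero _)), fun c hc => ?_⟩
  simp only [map_mul, MvPolynomial.eval_X] at hc
  have h0 := left_ne_zero_of_mul (right_ne_zero_of_mul hc)
  have h2 := right_ne_zero_of_mul (right_ne_zero_of_mul hc)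
  refine ⟨h0, h2, fun q hq hs => ?_⟩
  by_cases hz : q 2 = 0
  · obtain ⟨α1, β1, γ1, e1⟩ := hs ![1, 0, 0]
    obtain ⟨α3, β3, γ3, e3⟩ := hs ![0, 0, 1]
    simp only [QF_e12, hz, Matrix.cons_val] at e1 e3
    have f1 := poly4_zero (a := c 0 * q 0 * q 1^3 + c 1 * q 1^4) (b := c 0 * q 1^3) (c := -α1)
      (d := -β1) (e := -γ1) (fun t => by linear_combination e1 t)
    have hy : q 1 = 0 := by simpa [h0] using f1.2.1
    have f3 := poly4_zero (a := 0) (b := c 2 * q 0^3) (c := c 6 * q 0^2-α3)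
      (d := c 9 * q 0-β3) (e := c 11-γ3) (fun t => by
        have := e3 t
        rw [hy] at this
        linear_combination this)
    have hx : q 0 = 0 := by simpa [h2] using f3.2.1
    apply hq; funext i; fin_cases i <;> assumption
  · have hs' := hs.scale (fun x y z => QF_homog _ _ x y z) (inv_ne_zero hz)
    set s := (q 2)⁻¹ • q with hsdef
    have hs2 : s 2 = 1 := by simp [hsdef, hz]
    obtain ⟨α1, β1, γ1, e1⟩ := hs' ![1, 0, 0]
    obtain ⟨α2, β2, γ2, e2⟩ := hs' ![0, 1, 0]
    simp only [QF_e12, hs2, Matrix.cons_val] at e1 e2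
    have f1 := poly4_zero (a := c 0 * s 0*s 1^3 + c 1 * s 1^4 + (c 2 * s 0^3 + c 3 * s 0^2*s 1
        + c 4 * s 0*s 1^2 + c 5 * s 1^3) + (c 6 * s 0^2 + c 7 * s 0*s 1 + c 8 * s 1^2)
        + (c 9 * s 0 + c 10 * s 1) + c 11)
      (b := c 0 * s 1^3 + 3*c 2 * s 0^2 + 2 * c 3 * s 0 * s 1 + c 4 * s 1^2 + 2 * c 6 * s 0
        + c 7 * s 1 + c 9) (c := 3 * c 2 * s 0 + c 3 * s 1 + c 6 -α1)
      (d := c 2-β1) (e := -γ1) (fun t => by linear_combination e1 t)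
    have f2 := poly4_zero (a := c 0 * s 0*s 1^3 + c 1 * s 1^4 + (c 2 * s 0^3 + c 3 * s 0^2*s 1
        + c 4 * s 0*s 1^2 + c 5 * s 1^3) + (c 6 * s 0^2 + c 7 * s 0*s 1 + c 8 * s 1^2)
        + (c 9 * s 0 + c 10 * s 1) + c 11)
      (b := 3*c 0 * s 0 * s 1^2 + 4*c 1 * s 1^3 + c 3 * s 0^2 + 2*c 4 * s 0 * s 1
        + 3 * c 5 * s 1^2 + c 7 * s 0 + 2 * c 8 * s 1 + c 10)
      (c := 3*c 0 * s 0 * s 1 + 6*c 1 * s 1^2 + c 4 * s 0 + 3*c 5 * s 1 + c 8 - α2)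
      (d := c 0 * s 0 + 4 * c 1 * s 1 + c 5 - β2) (e := c 1 -γ2)
      (fun t => by linear_combination e2 t)
    apply left_ne_zero_of_mul hc
    rw [← hP0 ![c 0, c 1, c 2, c 3, c 4, c 5, c 6, c 7, c 8, s 0, s 1]]
    congr 2
    funext i
    obtain ⟨g0, gx, -⟩ := f1
    obtain ⟨-, gy, -⟩ := f2
    fin_cases i <;> simp [x, fx, fy, ff]
    · linear_combination gx
    · linear_combination gy
    · linear_combination g0 - s 0 * gx - s 1 * gy

lemma NoTL_of_smooth {f : ℂ → ℂ → ℂ → ℂ} (h : ∀ q : Fin 3 → ℂ, q ≠ 0 → ¬ Sg f q) : NoTL f := by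
  intro l m hl hf
  obtain ⟨q, hq, hlq⟩ : ∃ q : Fin 3 → ℂ, q ≠ 0 ∧ lf l (q 0) (q 1) (q 2) = 0 := by
    by_cases h0 : l 0 = 0
    · exact ⟨![1, 0, 0], fun h => by simpa using congrFun h 0, by simp [lf, h0]⟩
    · exact ⟨![l 1, -l 0, 0], fun h => h0 (by simpa using congrFun h 1), by simp [lf]; ring⟩
  refine h q hq fun v => ⟨0, lf l (v 0) (v 1) (v 2)^3 * lf m (q 0) (q 1) (q 2),
    lf l (v 0) (v 1) (v 2)^3 * lf m (v 0) (v 1) (v 2), fun t => ?_⟩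
  rw [hf]
  have : lf l (q 0 + t * v 0) (q 1 + t * v 1) (q 2 + t * v 2) = t * lf l (v 0) (v 1) (v 2) := by
    simp only [lf] at hlq ⊢; linear_combination hlq
  rw [this]
  simp only [lf]; ring

lemma root_finite {P : MvPolynomial (Option (Fin 12)) ℂ} (hP : P ≠ 0) :
    ∃ Ψ : MvPolynomial (Fin 12) ℂ, Ψ ≠ 0 ∧ ∃ D : ℕ, ∀ c, MvPolynomial.eval c Ψ ≠ 0 →
      ∃ T : Finset ℂ, T.card ≤ D ∧
        ∀ m, MvPolynomial.eval (fun o : Option (Fin 12) => o.elim m c) P = 0 → m ∈ T := by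
  set Q := MvPolynomial.optionEquivLeft ℂ (Fin 12) P with hQ
  have hQ0 : Q ≠ 0 := by
    rw [hQ]; simpa using hP
  refine ⟨Q.leadingCoeff, Polynomial.leadingCoeff_ne_zero.2 hQ0, Q.natDegree, fun c hc => ?_⟩
  have key : ∀ (P : MvPolynomial (Option (Fin 12)) ℂ) (m : ℂ),
      MvPolynomial.eval (fun o : Option (Fin 12) => o.elim m c) P =
      ((MvPolynomial.optionEquivLeft ℂ (Fin 12) P).map (MvPolynomial.eval c)).eval m := by
    intro P m
    induction P using MvPolynomial.induction_on with
    | C a => simp [MvPolynomial.optionEquivLeft_C]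
    | add p q hp hq => simp [hp, hq]
    | mul_X p i hp =>
      rw [map_mul, hp, map_mul, Polynomial.map_mul, Polynomial.eval_mul]
      cases i <;> simp
  have hm : Q.map (MvPolynomial.eval c) ≠ 0 := by
    intro h
    apply hc
    have := congrArg (fun p => Polynomial.coeff p Q.natDegree) h
    simpa using this
  refine ⟨(Q.map (MvPolynomial.eval c)).roots.toFinset, ?_, fun m hm0 => ?_⟩
  · exact (Multiset.toFinset_card_le _).trans
      ((Polynomial.card_roots' _).trans Polynomial.natDegree_map_le)
  · rw [Multiset.mem_toFinset, Polynomial.mem_roots hm, Polynomial.IsRoot, ← key]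
    exact hm0

/-- contact order at least three -/
def Fx (f : ℂ → ℂ → ℂ → ℂ) (q v : Fin 3 → ℂ) : Prop :=
  ∃ α β : ℂ, ∀ t : ℂ,
    f (q 0 + t * v 0) (q 1 + t * v 1) (q 2 + t * v 2) = α*t^3+β*t^4

lemma Fx.scale {f : ℂ → ℂ → ℂ → ℂ} {q v : Fin 3 → ℂ} {l r : ℂ}
    (hf : ∀ x y z, f (l*x) (l*y) (l*z) = l^4 * f x y z)
    (h : Fx f q v) (hl : l ≠ 0) : Fx f (l • q) (r • v) := by
  obtain ⟨α, β, ha⟩ := h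
  refine ⟨l^4*α*(l⁻¹*r)^3, l^4*β*(l⁻¹*r)^4, fun t => ?_⟩
  have h2 := hf (q 0 + (l⁻¹*r*t) * v 0) (q 1 + (l⁻¹*r*t) * v 1) (q 2 + (l⁻¹*r*t) * v 2)
  rw [ha] at h2
  have h3 : ∀ i, l * (q i + (l⁻¹*r*t) * v i) = (l • q) i + t * (r • v) i := by
    intro i; simp only [Pi.smul_apply, smul_eq_mul]; field_simp
  rw [h3, h3, h3] at h2
  rw [h2]; ring

lemma flex_coords {c : Fin 12 → ℂ} {x y u m : ℂ} (h : Fx (QF (e12 c)) ![x, y, 1] ![u, m, 0]) :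
    (c 0 * x*y^3 + c 1 * y^4 + (c 2 * x^3 + c 3 * x^2*y
        + c 4 * x*y^2 + c 5 * y^3) + (c 6 * x^2 + c 7 * x*y + c 8 * y^2)
        + (c 9 * x + c 10 * y) + c 11 = 0) ∧
    (u*(c 0 * y^3 + 3*c 2 * x^2 + 2 * c 3 * x * y + c 4 * y^2 + 2 * c 6 * x
        + c 7 * y + c 9) + m * (3*c 0 * x * y^2 + 4*c 1 * y^3 + c 3 * x^2 + 2*c 4 * x * y
        + 3 * c 5 * y^2 + c 7 * x + 2 * c 8 * y + c 10) = 0) ∧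
    (u^2*(3 * c 2 * x + c 3 * y + c 6) + u*m*(3*c 0*y^2+2*c 3*x+2*c 4*y+c 7) +
      m^2 *(3*c 0 * x * y + 6*c 1 * y^2 + c 4 * x + 3*c 5 * y + c 8) = 0) := by
  obtain ⟨α, β, h⟩ := h
  simp only [QF_e12, Matrix.cons_val] at h
  have f1 := poly4_zero (a := c 0 * x*y^3 + c 1 * y^4 + (c 2 * x^3 + c 3 * x^2*y
        + c 4 * x*y^2 + c 5 * y^3) + (c 6 * x^2 + c 7 * x*y + c 8 * y^2)
        + (c 9 * x + c 10 * y) + c 11)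
      (b := u*(c 0 * y^3 + 3*c 2 * x^2 + 2 * c 3 * x * y + c 4 * y^2 + 2 * c 6 * x
        + c 7 * y + c 9) + m * (3*c 0 * x * y^2 + 4*c 1 * y^3 + c 3 * x^2 + 2*c 4 * x * y
        + 3 * c 5 * y^2 + c 7 * x + 2 * c 8 * y + c 10))
      (c := u^2*(3 * c 2 * x + c 3 * y + c 6) + u*m*(3*c 0*y^2+2*c 3*x+2*c 4*y+c 7) +
      m^2 *(3*c 0 * x * y + 6*c 1 * y^2 + c 4 * x + 3*c 5 * y + c 8))
      (d := c 0*(3*u*m^2*y + m^3*x) + 4*c 1*y*m^3 + c 2*u^3 + c 3*u^2*m+c 4*u*m^2+c 5*m^3 - α)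
      (e := c 0*u*m^3+c 1*m^4-β) (fun t => by linear_combination h t)
  exact ⟨f1.1, f1.2.1, f1.2.2.1⟩

theorem gen_dir1 : ∃ Ψ : MvPolynomial (Fin 12) ℂ, Ψ ≠ 0 ∧ ∃ D : ℕ, ∀ c, MvPolynomial.eval c Ψ ≠ 0 →
    ∃ T : Finset (ℂ × ℂ), T.card ≤ D ∧ ∀ x y m : ℂ, Fx (QF (e12 c)) ![x, y, 1] ![1, m, 0] →
      (m, y - m * x) ∈ T := by
  let x : Fin 12 → MvPolynomial (Fin 12) ℂ := MvPolynomial.X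
  -- parameters: slots `6, 9, 11` carry slope and point
  let k6 : MvPolynomial (Fin 12) ℂ := -(3 * x 2 * x 9 + x 3 * x 11
    + x 6*(3*x 0*x 11^2+2*x 3*x 9+2*x 4*x 11+x 7)
    + x 6^2 *(3*x 0 * x 9 * x 11 + 6*x 1 * x 11^2 + x 4 * x 9 + 3*x 5 * x 11 + x 8))
  let k9 : MvPolynomial (Fin 12) ℂ := -(x 0 * x 11^3 + 3*x 2 * x 9^2 + 2 * x 3 * x 9 * x 11
    + x 4 * x 11^2 + 2 * k6 * x 9
        + x 7 * x 11 + x 6 * (3*x 0 * x 9 * x 11^2 + 4*x 1 * x 11^3 + x 3 * x 9^2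
        + 2*x 4 * x 9 * x 11 + 3 * x 5 * x 11^2 + x 7 * x 9 + 2 * x 8 * x 11 + x 10))
  let k11 : MvPolynomial (Fin 12) ℂ := -(x 0 * x 9*x 11^3 + x 1 * x 11^4
        + (x 2 * x 9^3 + x 3 * x 9^2*x 11
        + x 4 * x 9*x 11^2 + x 5 * x 11^3) + (k6 * x 9^2 + x 7 * x 9*x 11 + x 8 * x 11^2)
        + (k9 * x 9 + x 10 * x 11))
  let k : Fin 12 → MvPolynomial (Fin 12) ℂ :=
    ![x 0, x 1, x 2, x 3, x 4, x 5, k6, x 7, x 8, k9, x 10, k11]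
  obtain ⟨P, hP, hP0⟩ := TD (σ := Fin 12) (ρ := Option (Fin 12)) (by simp)
    (fun o => o.elim (x 6) k)
  obtain ⟨P', hP', hP0'⟩ := TD (σ := Fin 12) (ρ := Option (Fin 12)) (by simp)
    (fun o => o.elim (x 11 - x 6 * x 9) k)
  obtain ⟨Ψ1, h1, D1, H1⟩ := root_finite hP
  obtain ⟨Ψ2, h2, D2, H2⟩ := root_finite hP'
  refine ⟨Ψ1 * Ψ2, mul_ne_zero h1 h2, D1 * D2, fun c hc => ?_⟩
  rw [map_mul] at hc
  obtain ⟨T1, a1, b1⟩ := H1 c (left_ne_zero_of_mul hc)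
  obtain ⟨T2, a2, b2⟩ := H2 c (right_ne_zero_of_mul hc)
  refine ⟨T1 ×ˢ T2, by rw [Finset.card_product]; exact Nat.mul_le_mul a1 a2, fun s1 s2 m hfl => ?_⟩
  obtain ⟨g0, g1, g2⟩ := flex_coords hfl
  have hk : ∀ i, MvPolynomial.eval ![c 0, c 1, c 2, c 3, c 4, c 5, m, c 7, c 8, s1, c 10, s2] (k i)
      = c i := by
    have e6 : MvPolynomial.eval ![c 0, c 1, c 2, c 3, c 4, c 5, m, c 7, c 8, s1, c 10, s2] k6
      = c 6 := by
      simp [x, k6]; linear_combination (-1) * g2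
    have e9 : MvPolynomial.eval ![c 0, c 1, c 2, c 3, c 4, c 5, m, c 7, c 8, s1, c 10, s2] k9
      = c 9 := by
      simp only [k9, map_neg, map_add, map_mul, e6]
      simp [x]; linear_combination (-1) * g1
    have e11 : MvPolynomial.eval ![c 0, c 1, c 2, c 3, c 4, c 5, m, c 7, c 8, s1, c 10, s2] k11
      = c 11 := by
      simp only [k11, map_neg, map_add, map_mul, e6, e9]
      simp [x]; linear_combination (-1) * g0
    intro i
    fin_cases i
    all_goals simp [k, e6, e9, e11]
    all_goals simp [x]
  rw [Finset.mem_product]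
  constructor
  · apply b1
    rw [← hP0 ![c 0, c 1, c 2, c 3, c 4, c 5, m, c 7, c 8, s1, c 10, s2]]
    congr 2
    funext o
    cases o with
    | none => simp [x]
    | some i => simp [hk]
  · apply b2
    rw [← hP0' ![c 0, c 1, c 2, c 3, c 4, c 5, m, c 7, c 8, s1, c 10, s2]]
    congr 2
    funext o
    cases o with
    | none => simp [x]
    | some i => simp [hk]

theorem gen_dir2 : ∃ Ψ : MvPolynomial (Fin 12) ℂ, Ψ ≠ 0 ∧ ∀ c, MvPolynomial.eval c Ψ ≠ 0 →
    ∀ x y : ℂ, ¬ Fx (QF (e12 c)) ![x, y, 1] ![0, 1, 0] := by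
  let x : Fin 11 → MvPolynomial (Fin 11) ℂ := MvPolynomial.X
  let k8 : MvPolynomial (Fin 11) ℂ := -(3*x 0 * x 8 * x 10 + 6*x 1 * x 10^2 + x 4 * x 8
    + 3*x 5 * x 10)
  let k10 : MvPolynomial (Fin 11) ℂ := -(3*x 0 * x 8 * x 10^2 + 4*x 1 * x 10^3 + x 3 * x 8^2
        + 2*x 4 * x 8 * x 10 + 3 * x 5 * x 10^2 + x 7 * x 8 + 2 * k8 * x 10)
  let k11 : MvPolynomial (Fin 11) ℂ := -(x 0 * x 8*x 10^3 + x 1 * x 10^4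
        + (x 2 * x 8^3 + x 3 * x 8^2*x 10
        + x 4 * x 8*x 10^2 + x 5 * x 10^3) + (x 6 * x 8^2 + x 7 * x 8*x 10 + k8 * x 10^2)
        + (x 9 * x 8 + k10 * x 10))
  let k : Fin 12 → MvPolynomial (Fin 11) ℂ :=
    ![x 0, x 1, x 2, x 3, x 4, x 5, x 6, x 7, k8, x 9, k10, k11]
  obtain ⟨P, hP, hP0⟩ := TD (σ := Fin 11) (ρ := Fin 12) (by simp) k
  refine ⟨P, hP, fun c hc s1 s2 hfl => ?_⟩
  obtain ⟨g0, g1, g2⟩ := flex_coords hfl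
  have hk : ∀ i, MvPolynomial.eval ![c 0, c 1, c 2, c 3, c 4, c 5, c 6, c 7, s1, c 9, s2] (k i)
      = c i := by
    have e8 : MvPolynomial.eval ![c 0, c 1, c 2, c 3, c 4, c 5, c 6, c 7, s1, c 9, s2] k8
      = c 8 := by
      simp [x, k8]; linear_combination (-1) * g2
    have e10 : MvPolynomial.eval ![c 0, c 1, c 2, c 3, c 4, c 5, c 6, c 7, s1, c 9, s2] k10
      = c 10 := by
      simp only [k10, map_neg, map_add, map_mul, e8]
      simp [x]; linear_combination (-1) * g1
    have e11 : MvPolynomial.eval ![c 0, c 1, c 2, c 3, c 4, c 5, c 6, c 7, s1, c 9, s2] k11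
      = c 11 := by
      simp only [k11, map_neg, map_add, map_mul, e8, e10]
      simp [x]; linear_combination (-1) * g0
    intro i
    fin_cases i
    all_goals simp [k, e8, e10, e11]
    all_goals simp [x]
  apply hc
  rw [← hP0 ![c 0, c 1, c 2, c 3, c 4, c 5, c 6, c 7, s1, c 9, s2]]
  congr 2
  funext i
  exact (hk i).symm

/-- restriction of a ternary function to the line through `A` and `B` -/
def rs (f : ℂ → ℂ → ℂ → ℂ) (A B : Fin 3 → ℂ) (x y : ℂ) : ℂ :=
  f (x * A 0 + y * B 0) (x * A 1 + y * B 1) (x * A 2 + y * B 2)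

def lv (u A : Fin 3 → ℂ) : ℂ := lf u (A 0) (A 1) (A 2)

lemma lv_add (u A B : Fin 3 → ℂ) (x y : ℂ) : lv u (x • A + y • B) = x * lv u A + y * lv u B := by
  simp [lv, lf]; ring

lemma flex_inf {c : Fin 12 → ℂ} {x y : ℂ} {v : Fin 3 → ℂ} (h : Fx (QF (e12 c)) ![x, y, 0] v) :
    c 0 * x * y^3 + c 1 * y^4 = 0 ∧
    c 0 * y^3 * v 0 + (3*c 0*x*y^2 + 4*c 1*y^3) * v 1
      + (c 2 * x^3 + c 3 * x^2*y + c 4 * x*y^2 + c 5 * y^3) * v 2 = 0 := by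
  obtain ⟨α, β, h⟩ := h
  simp only [QF_e12, Matrix.cons_val] at h
  refine ⟨by linear_combination h 0, ?_⟩
  linear_combination (8*(h 1) - 8*h (-1) - h 2 + h (-2))/12

lemma Tri.exists_point {f : ℂ → ℂ → ℂ → ℂ} {A B : Fin 3 → ℂ} (h : Tri (rs f A B)) :
    ∃ u v : ℂ, (u ≠ 0 ∨ v ≠ 0) ∧ ∀ x y : ℂ, Fx f (u • A + v • B) (x • A + y • B) := by
  obtain ⟨a, b, c, d, e, hbq, hI, hJ⟩ := h
  obtain ⟨u, v, r, s, huv, hh⟩ := exists_triple hI hJ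
  refine ⟨u, v, huv, fun x y => ⟨(v*x-u*y)^3*(r*u+s*v), (v*x-u*y)^3*(r*x+s*y), fun t => ?_⟩⟩
  have h1 := hbq (u + t*x) (v + t*y)
  rw [hh] at h1
  have h2 : ∀ i, (u • A + v • B) i + t * (x • A + y • B) i = (u+t*x) * A i + (v+t*y) * B i := by
    intro i; simp; ring
  rw [h2, h2, h2]
  unfold rs at h1
  rw [h1]; ring

theorem gen_flex : ∃ Ψ : MvPolynomial (Fin 12) ℂ, Ψ ≠ 0 ∧ ∃ D : ℕ, ∀ c, MvPolynomial.eval c Ψ ≠ 0 →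
    c 0 ≠ 0 ∧ (∀ q : Fin 3 → ℂ, q ≠ 0 → ¬ Sg (QF (e12 c)) q) ∧
    ∃ T : Finset (Fin 3 → ℂ), T.card ≤ D ∧ (∀ u ∈ T, u ≠ 0) ∧
      ∀ A B : Fin 3 → ℂ, (∀ x y : ℂ, x • A + y • B = 0 → x = 0 ∧ y = 0) →
        Tri (rs (QF (e12 c)) A B) → ∃ u ∈ T, lv u A = 0 ∧ lv u B = 0 := by
  classical
  obtain ⟨Ψ0, n0, H0⟩ := gen_smooth
  obtain ⟨Ψ1, n1, D, H1⟩ := gen_dir1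
  obtain ⟨Ψ2, n2, H2⟩ := gen_dir2
  refine ⟨Ψ0 * (Ψ1 * Ψ2), mul_ne_zero n0 (mul_ne_zero n1 n2), D + 2, fun c hc => ?_⟩
  simp only [map_mul] at hc
  obtain ⟨h0, h2, hsm⟩ := H0 c (left_ne_zero_of_mul hc)
  obtain ⟨T1, hT1, hT1'⟩ := H1 c (left_ne_zero_of_mul (right_ne_zero_of_mul hc))
  have hd2 := H2 c (right_ne_zero_of_mul (right_ne_zero_of_mul hc))
  clear H0 H1 H2 hc
  set u1 : Fin 3 → ℂ := ![c 0 * (-c 0)^3, 3*c 0*c 1*(-c 0)^2 + 4*c 1*(-c 0)^3,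
    c 2 * c 1^3 + c 3 * c 1^2*(-c 0) + c 4 * c 1*(-c 0)^2 + c 5 * (-c 0)^3] with hu1
  refine ⟨h0, hsm, insert u1 (insert ![0, 0, 1] (T1.image fun mn => ![mn.1, -1, mn.2])), ?_, ?_, ?_⟩
  · refine (Finset.card_insert_le _ _).trans ?_
    have := Finset.card_insert_le ![0, 0, 1] (T1.image fun mn => ![mn.1, (-1:ℂ), mn.2])
    have h3 := Finset.card_image_le (s := T1) (f := fun mn => ![mn.1, (-1:ℂ), mn.2])
    omega
  · intro u hu
    rw [Finset.mem_insert, Finset.mem_insert, Finset.mem_image] at hu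
    rcases hu with rfl | rfl | ⟨mn, -, rfl⟩
    · intro h; have := congrFun h 0; simp [hu1, h0] at this
    · intro h; have := congrFun h 2; simp at this
    · intro h; have := congrFun h 1; simp at this
  intro A B hAB hT
  obtain ⟨u, v, huv, hF⟩ := hT.exists_point
  set q := u • A + v • B with hq
  have hq0 : q ≠ 0 := fun h => by
    have := hAB u v h
    rcases huv with h | h
    · exact h this.1
    · exact h this.2
  have hFA : Fx (QF (e12 c)) q A := by simpa using hF 1 0
  have hFB : Fx (QF (e12 c)) q B := by simpa using hF 0 1
  by_cases hz : q 2 = 0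
  · have hqe : q = ![q 0, q 1, 0] := by
      funext i; fin_cases i <;> simp [hz]
    rw [hqe] at hFA hFB
    by_cases hy : q 1 = 0
    · have hx : q 0 ≠ 0 := fun hx => hq0 (by rw [hqe, hx, hy]; funext i; fin_cases i <;> rfl)
      refine ⟨![0, 0, 1], by simp, ?_, ?_⟩
      · have := (flex_inf hFA).2
        rw [hy] at this
        simpa [lv, lf, h2, hx] using this
      · have := (flex_inf hFB).2
        rw [hy] at this
        simpa [lv, lf, h2, hx] using this
    · have hk : c 0 * q 0 + c 1 * q 1 = 0 := by
        have := (flex_inf hFA).1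
        have h3 : q 1^3 * (c 0 * q 0 + c 1 * q 1) = 0 := by linear_combination this
        exact (mul_eq_zero.1 h3).resolve_left (pow_ne_zero _ hy)
      have hsc : (-c 0 / q 1) • ![q 0, q 1, 0] = ![c 1, -c 0, 0] := by
        funext i; fin_cases i
        · simp; field_simp; linear_combination -hk
        · simp; field_simp
        · simp
      have gA := hFA.scale (r := 1) (fun x y z => QF_homog _ _ x y z)
        (div_ne_zero (neg_ne_zero.2 h0) hy)
      have gB := hFB.scale (r := 1) (fun x y z => QF_homog _ _ x y z)
        (div_ne_zero (neg_ne_zero.2 h0) hy)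
      rw [hsc, one_smul] at gA gB
      refine ⟨u1, by simp, ?_, ?_⟩
      · have := (flex_inf gA).2
        simp only [lv, lf, hu1, Matrix.cons_val]
        linear_combination this
      · have := (flex_inf gB).2
        simp only [lv, lf, hu1, Matrix.cons_val]
        linear_combination this
  · set w := B 2 • A + (-A 2) • B with hw
    have hq2 : q 2 = u * A 2 + v * B 2 := by simp [hq]
    have hw2 : w 2 = 0 := by simp [hw]; ring
    have hFw : Fx (QF (e12 c)) q w := hF _ _
    have hqe : (q 2)⁻¹ • q = ![q 0 / q 2, q 1 / q 2, 1] := by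
      funext i; fin_cases i
      · simp; ring
      · simp; ring
      · simp [hz]
    have hfin : ∀ n : Fin 3 → ℂ, lv n q = 0 → lv n w = 0 → lv n A = 0 ∧ lv n B = 0 := by
      intro n a1 a2
      rw [hq, lv_add] at a1
      rw [hw, lv_add] at a2
      constructor
      · refine (mul_eq_zero.1 (?_ : q 2 * lv n A = 0)).resolve_left hz
        rw [hq2]; linear_combination A 2 * a1 + v * a2
      · refine (mul_eq_zero.1 (?_ : q 2 * lv n B = 0)).resolve_left hz
        rw [hq2]; linear_combination B 2 * a1 - u * a2
    by_cases hw0 : w 0 = 0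
    · exfalso
      have hw1 : w 1 ≠ 0 := by
        intro hw1
        have hw00 : w = 0 := by funext i; fin_cases i <;> assumption
        obtain ⟨a, b⟩ := hAB _ _ hw00
        apply hz; rw [hq2, a, neg_eq_zero.1 b]; ring
      have g := hFw.scale (l := (q 2)⁻¹) (r := (w 1)⁻¹) (fun x y z => QF_homog _ _ x y z)
        (inv_ne_zero hz)
      have hwe : (w 1)⁻¹ • w = ![0, 1, 0] := by
        funext i; fin_cases i <;> simp [hw0, hw1, hw2]
      rw [hqe, hwe] at g
      exact hd2 _ _ g
    · have g := hFw.scale (l := (q 2)⁻¹) (r := (w 0)⁻¹) (fun x y z => QF_homog _ _ x y z)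
        (inv_ne_zero hz)
      have hwe : (w 0)⁻¹ • w = ![1, w 1 / w 0, 0] := by
        funext i; fin_cases i
        · simp [hw0]
        · simp; ring
        · simp [hw2]
      rw [hqe, hwe] at g
      refine ⟨![w 1 / w 0, -1, q 1 / q 2 - w 1 / w 0 * (q 0 / q 2)], ?_, ?_⟩
      · rw [Finset.mem_insert, Finset.mem_insert, Finset.mem_image]
        exact Or.inr (Or.inr ⟨_, hT1' _ _ _ g, rfl⟩)
      · apply hfin
        · simp only [lv, lf, Matrix.cons_val]; field_simp; ring
        · simp only [lv, lf, Matrix.cons_val, hw2]; field_simp; ring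

section
variable {σ τ : Type} {k : (σ → ℂ) → (τ → ℂ) → Fin 15 → ℂ} {a b : (σ → ℂ) → (τ → ℂ) → ℂ}

theorem PF.lABCDE (hk : ∀ i, PF (fun c y => k c y i)) (ha : PF a) (hb : PF b) :
    PF (fun c y => lA (k c y) (a c y) (b c y)) ∧ PF (fun c y => lB (k c y) (a c y) (b c y)) ∧
    PF (fun c y => lC (k c y) (a c y) (b c y)) ∧ PF (fun c y => lD (k c y) (a c y) (b c y)) ∧
    PF (fun c y => lE (k c y) (a c y) (b c y)) := by
  unfold lA lB lC lD lE
  refine ⟨?_, ?_, ?_, ?_, ?_⟩ <;>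
  repeat' first
    | exact hk _
    | exact ha
    | exact hb
    | apply PF.add
    | apply PF.mul
    | apply PF.pow
    | exact PF.const _

theorem PF.LIJ (hk : ∀ i, PF (fun c y => k c y i)) (ha : PF a) (hb : PF b) :
    PF (fun c y => LI (k c y) (a c y) (b c y)) ∧ PF (fun c y => LJ (k c y) (a c y) (b c y)) := by
  obtain ⟨h1, h2, h3, h4, h5⟩ := PF.lABCDE hk ha hb
  unfold LI LJ bI bJ
  refine ⟨?_, ?_⟩ <;>
  repeat' first
    | exact h1
    | exact h2
    | exact h3
    | exact h4
    | exact h5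
    | apply PF.add
    | apply PF.sub
    | apply PF.mul
    | apply PF.pow
    | exact PF.const _

theorem PF.e12 {f : (σ → ℂ) → (τ → ℂ) → Fin 12 → ℂ} (hf : ∀ i, PF (fun c y => f c y i)) (i : Fin 15) :
    PF (fun c y => e12 (f c y) i) := by
  by_cases h : i.1 < 12
  · simp only [Infl.e12, h, dif_pos]; exact hf _
  · simp only [Infl.e12, h, dif_neg, not_false_iff]; exact PF.const 0
end

/-- `n` distinct chart flexes -/
def Dist {n : ℕ} (a b : Fin n → ℂ) : Prop := ∀ i j, i ≠ j → a i ≠ a j ∨ b i ≠ b j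

def Flx (c : Fin 12 → ℂ) (a b : ℂ) : Prop := Tri (onLine' (e12 c) a b)

abbrev TT (n : ℕ) : Type := (Fin n × Bool) ⊕ (Fin n × Fin n × Bool)

def dsq {n : ℕ} (y : TT n → ℂ) (i j : Fin n) : ℂ :=
  if i = j then 0 else
  (y (.inl (i, true)) - y (.inl (j, true))) * y (.inr (i, j, true)) +
  (y (.inl (i, false)) - y (.inl (j, false))) * y (.inr (i, j, false)) - 1

lemma dsq_dist {n : ℕ} {y : TT n → ℂ} (h : ∀ i j, dsq y i j = 0) :
    Dist (fun i => y (.inl (i, true))) (fun i => y (.inl (i, false))) := by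
  intro i j hij
  by_contra! hc
  have := h i j
  simp [dsq, hij, hc.1, hc.2] at this

lemma dist_dsq {n : ℕ} {a b : Fin n → ℂ} (h : Dist a b) : ∃ y : TT n → ℂ,
    (∀ i, y (.inl (i, true)) = a i) ∧ (∀ i, y (.inl (i, false)) = b i) ∧ ∀ i j, dsq y i j = 0 := by
  classical
  refine ⟨Sum.elim (fun p => if p.2 then a p.1 else b p.1)
    (fun p => if a p.1 = a p.2.1 then (if p.2.2 then 0 else (b p.1 - b p.2.1)⁻¹)
      else (if p.2.2 then (a p.1 - a p.2.1)⁻¹ else 0)), fun i => by simp, fun i => by simp, ?_⟩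
  intro i j
  unfold dsq
  split_ifs with hij
  · rfl
  · by_cases h1 : a i = a j
    · have h2 : b i - b j ≠ 0 := sub_ne_zero.2 ((h i j hij).resolve_left (fun h => h h1))
      simp [h1, h2]
    · have h2 : a i - a j ≠ 0 := sub_ne_zero.2 h1
      simp [h1, h2]

def HasN (c : Fin 12 → ℂ) (n : ℕ) : Prop :=
  ∃ a b : Fin n → ℂ, Dist a b ∧ ∀ i, Flx c (a i) (b i)

def Full (n : ℕ) : Prop := ∃ Ψ : MvPolynomial (Fin 12) ℂ, Ψ ≠ 0 ∧
  ∀ c, MvPolynomial.eval c Ψ ≠ 0 → HasN c n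

lemma PF.dsq {σ τ : Type} {n : ℕ} (g : TT n → τ) (i j : Fin n) :
    PF (fun (_ : σ → ℂ) (y : τ → ℂ) => dsq (fun t => y (g t)) i j) := by
  unfold Infl.dsq
  split_ifs
  · exact PF.const 0
  · exact (((PF.snd _).sub (PF.snd _)).mul (PF.snd _)).add
      (((PF.snd _).sub (PF.snd _)).mul (PF.snd _)) |>.sub (PF.const 1)

lemma full_dich (n : ℕ) (h : ¬ Full n) : ∃ Φ : MvPolynomial (Fin 12) ℂ, Φ ≠ 0 ∧
    ∀ c, HasN c n → MvPolynomial.eval c Φ = 0 := by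
  rcases KL (σ := Fin 12) (τ := TT n) (ι := (Fin n ⊕ Fin n) ⊕ (Fin n × Fin n))
    (fun s c y => Sum.elim (Sum.elim
      (fun i => LI (e12 c) (y (.inl (i, true))) (y (.inl (i, false))))
      (fun i => LJ (e12 c) (y (.inl (i, true))) (y (.inl (i, false)))))
      (fun p => dsq y p.1 p.2) s) (by
      have h0 := PF.e12 (σ := Fin 12) (τ := TT n) (f := fun c _ => c) PF.fst
      rintro ((i | i) | p)
      · exact (PF.LIJ h0 (PF.snd _) (PF.snd _)).1
      · exact (PF.LIJ h0 (PF.snd _) (PF.snd _)).2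
      · exact PF.dsq id p.1 p.2) with h1 | h1
  · exfalso
    apply h
    obtain ⟨Ψ, h2, h3⟩ := h1
    refine ⟨Ψ, h2, fun c hc => ?_⟩
    obtain ⟨y, hy⟩ := h3 c hc
    refine ⟨_, _, dsq_dist (y := y) (fun i j => hy (.inr (i, j))), fun i => ?_⟩
    exact (tri_iff_LIJ _ _ _).2 ⟨hy (.inl (.inl i)), hy (.inl (.inr i))⟩
  · obtain ⟨Φ, h2, h3⟩ := h1
    refine ⟨Φ, h2, ?_⟩
    rintro c ⟨a, b, hd, hf⟩
    obtain ⟨y, ya, yb, hy⟩ := dist_dsq hd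
    refine h3 c y ?_
    rintro ((i | i) | p)
    · simp only [Sum.elim_inl, ya, yb]; exact ((tri_iff_LIJ _ _ _).1 (hf i)).1
    · simp only [Sum.elim_inl, Sum.elim_inr, ya, yb]; exact ((tri_iff_LIJ _ _ _).1 (hf i)).2
    · exact hy _ _

/-- pairs of curves sharing `n` distinct flexes -/
def HasE (Ψ0 : MvPolynomial (Fin 12) ℂ) (n : ℕ) (c c' : Fin 12 → ℂ) : Prop :=
  MvPolynomial.eval c' Ψ0 ≠ 0 ∧ (∃ j, c 0 * c' j - c j * c' 0 ≠ 0) ∧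
  ∃ a b : Fin n → ℂ, Dist a b ∧ ∀ i, Flx c (a i) (b i) ∧ Flx c' (a i) (b i)

lemma e_dich (Ψ0 : MvPolynomial (Fin 12) ℂ) (n : ℕ) :
    (∃ Ψ : MvPolynomial (Fin 12) ℂ, Ψ ≠ 0 ∧ ∀ c, MvPolynomial.eval c Ψ ≠ 0 → ∃ c', HasE Ψ0 n c c') ∨
    (∃ Φ : MvPolynomial (Fin 12) ℂ, Φ ≠ 0 ∧ ∀ c c', HasE Ψ0 n c c' → MvPolynomial.eval c Φ = 0) := by
  rcases KL (σ := Fin 12) (τ := TT n ⊕ ((Fin 12 ⊕ Fin 12) ⊕ Unit))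
    (ι := ((Fin n ⊕ Fin n) ⊕ (Fin n ⊕ Fin n)) ⊕ ((Fin n × Fin n) ⊕ Bool))
    (fun s c y => Sum.elim (Sum.elim (Sum.elim
      (fun i => LI (e12 c) (y (.inl (.inl (i, true)))) (y (.inl (.inl (i, false)))))
      (fun i => LJ (e12 c) (y (.inl (.inl (i, true)))) (y (.inl (.inl (i, false))))))
      (Sum.elim
      (fun i => LI (e12 fun j => y (.inr (.inl (.inl j)))) (y (.inl (.inl (i, true))))
        (y (.inl (.inl (i, false)))))
      (fun i => LJ (e12 fun j => y (.inr (.inl (.inl j)))) (y (.inl (.inl (i, true))))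
        (y (.inl (.inl (i, false)))))))
      (Sum.elim (fun p => dsq (fun t => y (.inl t)) p.1 p.2)
        (fun o => if o then MvPolynomial.eval (fun j => y (.inr (.inl (.inl j)))) Ψ0 *
            y (.inr (.inr ())) - 1
          else ∑ j : Fin 12, (c 0 * y (.inr (.inl (.inl j))) - c j * y (.inr (.inl (.inl 0)))) *
            y (.inr (.inl (.inr j))) - 1)) s) (by
      have h0 := PF.e12 (σ := Fin 12) (τ := TT n ⊕ ((Fin 12 ⊕ Fin 12) ⊕ Unit)) (f := fun c _ => c)
        PF.fst
      have h0' := PF.e12 (σ := Fin 12) (τ := TT n ⊕ ((Fin 12 ⊕ Fin 12) ⊕ Unit))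
        (f := fun _ y j => y (.inr (.inl (.inl j)))) (fun i => PF.snd _)
      rintro (((i | i) | (i | i)) | (p | o))
      · exact (PF.LIJ h0 (PF.snd _) (PF.snd _)).1
      · exact (PF.LIJ h0 (PF.snd _) (PF.snd _)).2
      · exact (PF.LIJ h0' (PF.snd _) (PF.snd _)).1
      · exact (PF.LIJ h0' (PF.snd _) (PF.snd _)).2
      · exact PF.dsq _ p.1 p.2
      · cases o
        · refine (PF.sum _ fun j => ?_).sub (PF.const 1)
          exact (((PF.fst _).mul (PF.snd _)).sub ((PF.fst _).mul (PF.snd _))).mul (PF.snd _)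
        · exact ((PF.subst Ψ0 (fun j => PF.snd _)).mul (PF.snd _)).sub (PF.const 1)) with h1 | h1
  · left
    obtain ⟨Ψ, h2, h3⟩ := h1
    refine ⟨Ψ, h2, fun c hc => ?_⟩
    obtain ⟨y, hy⟩ := h3 c hc
    refine ⟨fun j => y (.inr (.inl (.inl j))), ?_, ?_, _, _,
      dsq_dist (y := fun t => y (.inl t)) (fun i j => hy (.inr (.inl (i, j)))), fun i => ⟨?_, ?_⟩⟩
    · intro h0
      have := hy (.inr (.inr true))
      simp [h0] at this
    · by_contra! hall
      have := hy (.inr (.inr false))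
      simp only [Sum.elim_inr, hall] at this
      simp at this
    · exact (tri_iff_LIJ _ _ _).2 ⟨hy (.inl (.inl (.inl i))), hy (.inl (.inl (.inr i)))⟩
    · exact (tri_iff_LIJ _ _ _).2 ⟨hy (.inl (.inr (.inl i))), hy (.inl (.inr (.inr i)))⟩
  · right
    obtain ⟨Φ, h2, h3⟩ := h1
    refine ⟨Φ, h2, ?_⟩
    rintro c c' ⟨hΨ, ⟨j0, hj0⟩, a, b, hd, hf⟩
    obtain ⟨y, ya, yb, hy⟩ := dist_dsq hd
    refine h3 c (Sum.elim y (Sum.elim (Sum.elim c'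
      (fun j => if j = j0 then (c 0 * c' j0 - c j0 * c' 0)⁻¹ else 0))
      (fun _ => (MvPolynomial.eval c' Ψ0)⁻¹))) ?_
    rintro (((i | i) | (i | i)) | (p | o))
    · simp only [Sum.elim_inl, ya, yb]; exact ((tri_iff_LIJ _ _ _).1 (hf i).1).1
    · simp only [Sum.elim_inl, Sum.elim_inr, ya, yb]; exact ((tri_iff_LIJ _ _ _).1 (hf i).1).2
    · simp only [Sum.elim_inl, Sum.elim_inr, ya, yb]; exact ((tri_iff_LIJ _ _ _).1 (hf i).2).1
    · simp only [Sum.elim_inl, Sum.elim_inr, ya, yb]; exact ((tri_iff_LIJ _ _ _).1 (hf i).2).2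
    · exact hy _ _
    · cases o
      · simp [hj0]
      · simp [hΨ]

theorem rs_chart (f : ℂ → ℂ → ℂ → ℂ) (a b x y : ℂ) :
    rs f ![1, 0, a] ![0, 1, b] x y = f x y (a * x + b * y) := by
  simp [rs, mul_comm]

theorem flex_in_T {c : Fin 12 → ℂ} {T : Finset (Fin 3 → ℂ)} (hT0 : ∀ u ∈ T, u ≠ 0)
    (hT : ∀ A B : Fin 3 → ℂ, (∀ x y : ℂ, x • A + y • B = 0 → x = 0 ∧ y = 0) →
        Tri (rs (QF (e12 c)) A B) → ∃ u ∈ T, lv u A = 0 ∧ lv u B = 0)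
    {a b : ℂ} (h : Flx c a b) : ∃ u ∈ T, u 2 ≠ 0 ∧ u 0 = - (a * u 2) ∧ u 1 = - (b * u 2) := by
  have h1 : Tri (rs (QF (e12 c)) ![1, 0, a] ![0, 1, b]) := by
    have : rs (QF (e12 c)) ![1, 0, a] ![0, 1, b] = onLine' (e12 c) a b := by
      funext x y
      rw [rs_chart]; rfl
    rw [this]; exact h
  obtain ⟨u, hu, e1, e2⟩ := hT _ _ (fun x y hxy => by
    have h0 := congrFun hxy 0
    have h1 := congrFun hxy 1
    simp at h0 h1
    exact ⟨h0, h1⟩) h1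
  simp [lv, lf] at e1 e2
  have e1' : u 0 = - (a * u 2) := by linear_combination e1
  have e2' : u 1 = - (b * u 2) := by linear_combination e2
  refine ⟨u, hu, fun h0 => hT0 u hu ?_, e1', e2'⟩
  funext i
  fin_cases i
  · simp [e1', h0]
  · simp [e2', h0]
  · simp [h0]

theorem HasN_le {c : Fin 12 → ℂ} {T : Finset (Fin 3 → ℂ)} (hT0 : ∀ u ∈ T, u ≠ 0)
    (hT : ∀ A B : Fin 3 → ℂ, (∀ x y : ℂ, x • A + y • B = 0 → x = 0 ∧ y = 0) →
        Tri (rs (QF (e12 c)) A B) → ∃ u ∈ T, lv u A = 0 ∧ lv u B = 0)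
    {n : ℕ} (h : HasN c n) : n ≤ T.card := by
  obtain ⟨a, b, hd, hf⟩ := h
  choose u hu hu2 hu0 hu1 using fun i => flex_in_T hT0 hT (hf i)
  have hinj : Function.Injective u := by
    intro i j hij
    by_contra hne
    have e0 := hu0 i
    have e1 := hu1 i
    rw [hij, hu0 j] at e0
    rw [hij, hu1 j] at e1
    have ea : a i = a j := mul_right_cancel₀ (hu2 j) (by linear_combination e0)
    have eb : b i = b j := mul_right_cancel₀ (hu2 j) (by linear_combination e1)
    rcases hd i j hne with h | h
    · exact h ea
    · exact h eb
  have := Finset.card_le_card_of_injOn (s := Finset.univ) (t := T) u (fun i _ => hu i) hinj.injOn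
  simpa using this

theorem HasN_succ {c : Fin 12 → ℂ} {n : ℕ} {a b : Fin n → ℂ} (hd : Dist a b)
    (hf : ∀ i, Flx c (a i) (b i)) {s r : ℂ} (h : Flx c s r) (hne : ∀ i, s ≠ a i ∨ r ≠ b i) :
    HasN c (n+1) := by
  refine ⟨Fin.cons s a, Fin.cons r b, ?_, ?_⟩
  · intro i j
    refine Fin.cases ?_ (fun i => ?_) i <;> refine Fin.cases ?_ (fun j => ?_) j
    · simp
    · intro _; simpa using hne j
    · intro _
      rcases hne i with h | h
      · left; simpa using h.symm
      · right; simpa using h.symm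
    · intro hij
      simpa using hd i j (fun e => hij (by rw [e]))
  · intro i
    refine Fin.cases ?_ (fun i => ?_) i
    · simpa using h
    · simpa using hf i

theorem thmB : ∃ Ψ : MvPolynomial (Fin 12) ℂ, Ψ ≠ 0 ∧
    (∀ c, MvPolynomial.eval c Ψ ≠ 0 →
      c 0 ≠ 0 ∧ (∀ q : Fin 3 → ℂ, q ≠ 0 → ¬ Sg (QF (e12 c)) q) ∧
      ∃ T : Finset (Fin 3 → ℂ), (∀ u ∈ T, u ≠ 0) ∧
      ∀ A B : Fin 3 → ℂ, (∀ x y : ℂ, x • A + y • B = 0 → x = 0 ∧ y = 0) →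
        Tri (rs (QF (e12 c)) A B) → ∃ u ∈ T, lv u A = 0 ∧ lv u B = 0) ∧
    ∀ c c', MvPolynomial.eval c Ψ ≠ 0 → MvPolynomial.eval c' Ψ ≠ 0 →
      (∀ a b, Flx c a b → Flx c' a b) → ∃ μ : ℂ, c' = μ • c := by
  classical
  obtain ⟨Ψ0, n0, D, H⟩ := gen_flex
  have hnot : ¬ Full (D+1) := by
    rintro ⟨Ψ, hΨ, h⟩
    obtain ⟨c, hc⟩ : ∃ c, MvPolynomial.eval c (Ψ * Ψ0) ≠ 0 := by
      by_contra hcon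
      push Not at hcon
      exact mul_ne_zero hΨ n0 (MvPolynomial.funext fun c => by simpa using hcon c)
    rw [map_mul] at hc
    obtain ⟨-, -, T, hTc, hT0, hT⟩ := H c (right_ne_zero_of_mul hc)
    have := HasN_le hT0 hT (h c (left_ne_zero_of_mul hc))
    omega
  have h0 : Full 0 := ⟨1, one_ne_zero, fun c _ => ⟨Fin.elim0, Fin.elim0, fun i => i.elim0, fun i => i.elim0⟩⟩
  obtain ⟨N, hN, hN1⟩ : ∃ N, Full N ∧ ¬ Full (N+1) := by
    by_contra hcon
    push Not at hcon
    have : ∀ n, Full n := fun n => Nat.rec h0 (fun n ih => hcon n ih) n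
    exact hnot (this _)
  obtain ⟨ΨN, hΨN, HN⟩ := hN
  obtain ⟨Φ, hΦ, HΦ⟩ := full_dich _ hN1
  rcases e_dich Ψ0 N with ⟨Ψ2, h2, H2⟩ | ⟨Φ2, h2, H2⟩
  · exfalso
    apply thmA (mul_ne_zero h2 hΦ)
    intro c hc
    rw [map_mul] at hc
    obtain ⟨c', hc', ⟨j, hj⟩, a, b, hd, hf⟩ := H2 c (left_ne_zero_of_mul hc)
    refine ⟨c', NoTL_of_smooth (H c' hc').2.1, ?_, ?_⟩
    · rintro μ rfl
      apply hj
      simp; ring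
    · intro s r hsr
      by_contra hcon
      refine right_ne_zero_of_mul hc (HΦ c (HasN_succ hd (fun i => (hf i).1) hsr fun i => ?_))
      by_contra hi
      push Not at hi
      apply hcon
      rw [hi.1, hi.2]
      exact (hf i).2
  · refine ⟨Ψ0 * (ΨN * Φ2), mul_ne_zero n0 (mul_ne_zero hΨN h2), ?_, ?_⟩
    · intro c hc
      rw [map_mul] at hc
      obtain ⟨h1, h2, T, -, h3, h4⟩ := H c (left_ne_zero_of_mul hc)
      exact ⟨h1, h2, T, h3, h4⟩
    · intro c c' hc hc' hfl
      simp only [map_mul] at hc hc'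
      have hc0 := (H c (left_ne_zero_of_mul hc)).1
      by_cases hall : ∀ j, c 0 * c' j - c j * c' 0 = 0
      · refine ⟨c' 0 / c 0, ?_⟩
        funext j
        have := hall j
        simp only [Pi.smul_apply, smul_eq_mul]
        field_simp
        linear_combination this
      · exfalso
        push Not at hall
        obtain ⟨a, b, hd, hf⟩ := HN c (left_ne_zero_of_mul (right_ne_zero_of_mul hc))
        exact right_ne_zero_of_mul (right_ne_zero_of_mul hc)
          (H2 c c' ⟨left_ne_zero_of_mul hc', hall, a, b, hd, fun i => ⟨hf i, hfl _ _ (hf i)⟩⟩)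

def ex : Fin 15 → Fin 3 → ℕ := ![![1,3,0], ![0,4,0], ![3,0,1], ![2,1,1], ![1,2,1], ![0,3,1],
  ![2,0,2], ![1,1,2], ![0,2,2], ![1,0,3], ![0,1,3], ![0,0,4], ![4,0,0], ![3,1,0], ![2,2,0]]

def mk (i : Fin 15) : Fin 3 →₀ ℕ := Finsupp.equivFunOnFinite.symm (ex i)

lemma mk_apply (i : Fin 15) (j : Fin 3) : mk i j = ex i j := rfl

lemma ex_inj : Function.Injective ex := by decide

lemma mk_inj : Function.Injective mk := fun _ _ h => ex_inj (Finsupp.equivFunOnFinite.symm.injective h)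

lemma mk_degree (i : Fin 15) : (mk i).degree = 4 := by
  rw [Finsupp.degree_eq_sum]
  simp only [mk_apply]
  revert i; decide

lemma mk_surj {m : Fin 3 →₀ ℕ} (h : m.degree = 4) : ∃ i, m = mk i := by
  rw [Finsupp.degree_eq_sum, Fin.sum_univ_three] at h
  have key : ∀ a b c : Fin 5, (a:ℕ)+b+c = 4 → ∃ i, ex i = ![(a:ℕ),b,c] := by decide
  obtain ⟨i, hi⟩ := key ⟨m 0, by omega⟩ ⟨m 1, by omega⟩ ⟨m 2, by omega⟩ h
  refine ⟨i, Finsupp.ext fun j => ?_⟩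
  rw [mk_apply, hi]
  fin_cases j <;> rfl

def PK (k : Fin 15 → ℂ) : MvPolynomial (Fin 3) ℂ := ∑ i, monomial (mk i) (k i)

lemma PK_hom (k : Fin 15 → ℂ) : (PK k).IsHomogeneous 4 := by
  apply IsHomogeneous.sum
  intro i _
  exact isHomogeneous_monomial _ (mk_degree i)

lemma PK_eval (k : Fin 15 → ℂ) (v : Fin 3 → ℂ) : MvPolynomial.eval v (PK k) = QF k (v 0) (v 1) (v 2) := by
  have hm : ∀ i, MvPolynomial.eval v (monomial (mk i) (k i)) =
      k i * (v 0 ^ ex i 0 * v 1 ^ ex i 1 * v 2 ^ ex i 2) := by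
    intro i
    rw [MvPolynomial.eval_monomial, Finsupp.prod_fintype _ _ (by simp), Fin.prod_univ_three]
    rfl
  simp only [PK, map_sum, hm]
  simp only [Fin.sum_univ_succ, Fin.sum_univ_zero]
  simp [ex, QF, Fin.succ]
  ring

lemma PK_coeff (k : Fin 15 → ℂ) (i : Fin 15) : (PK k).coeff (mk i) = k i := by
  classical
  simp only [PK, MvPolynomial.coeff_sum, MvPolynomial.coeff_monomial]
  rw [Finset.sum_eq_single i]
  · simp
  · intro j _ hj; rw [if_neg (fun h => hj (mk_inj h))]
  · simp

lemma eq_PK {G : MvPolynomial (Fin 3) ℂ} (hG : G.IsHomogeneous 4) : G = PK (fun i => G.coeff (mk i)) := by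
  ext m
  by_cases hm : m.degree = 4
  · obtain ⟨i, rfl⟩ := mk_surj hm
    rw [PK_coeff]
  · rw [hG.coeff_eq_zero hm, (PK_hom _).coeff_eq_zero hm]

lemma hom_eval {G : MvPolynomial (Fin 3) ℂ} (hG : G.IsHomogeneous 4) (v : Fin 3 → ℂ) :
    MvPolynomial.eval v G = QF (fun i => G.coeff (mk i)) (v 0) (v 1) (v 2) := by
  conv_lhs => rw [eq_PK hG]
  rw [PK_eval]

lemma tp_hom {G : MvPolynomial (Fin 3) ℂ} (hG : G.IsHomogeneous 4) (g : Matrix (Fin 3) (Fin 3) ℂ) :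
    (transformPoly g G).IsHomogeneous 4 := by
  have := hG.aeval (fun i => ∑ j, MvPolynomial.C (g i j) * X j : Fin 3 → MvPolynomial (Fin 3) ℂ) (n := 1)
    (fun i => IsHomogeneous.sum _ _ _ fun j _ => isHomogeneous_C_mul_X _ _)
  simpa [transformPoly] using this

lemma tp_eval (g : Matrix (Fin 3) (Fin 3) ℂ) (G : MvPolynomial (Fin 3) ℂ) (v : Fin 3 → ℂ) :
    MvPolynomial.eval v (transformPoly g G) = MvPolynomial.eval (g.mulVec v) G := by
  have : (MvPolynomial.eval v) (transformPoly g G) = (((MvPolynomial.aeval v).comp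
    (MvPolynomial.aeval (fun i => ∑ j, MvPolynomial.C (g i j) * X j))) : MvPolynomial (Fin 3) ℂ →ₐ[ℂ] ℂ) G := by
    simp [transformPoly, MvPolynomial.aeval_eq_eval]
  rw [this, ← MvPolynomial.aeval_eq_eval]
  congr 1
  ext i
  simp [Matrix.mulVec, dotProduct]

lemma lr_eval (F : MvPolynomial (Fin 3) ℂ) (a b : Fin 3 → ℂ) (t : ℂ) :
    (lineRestrict F a b).eval t = MvPolynomial.eval (a + t • b) F := by
  have : (lineRestrict F a b).eval t = (((Polynomial.aeval t).comp
    (MvPolynomial.aeval (fun i => Polynomial.C (a i) + Polynomial.C (b i) * Polynomial.X))) : MvPolynomial (Fin 3) ℂ →ₐ[ℂ] ℂ) F := by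
    simp [lineRestrict, Polynomial.coe_aeval_eq_eval]
  rw [this, ← MvPolynomial.aeval_eq_eval]
  congr 1
  ext i
  simp
  ring

/-- derivative along a line -/
lemma lr_deriv (F : MvPolynomial (Fin 3) ℂ) (a b : Fin 3 → ℂ) :
    (Polynomial.derivative (lineRestrict F a b)).eval 0 = ∑ i, b i * MvPolynomial.eval a (pderiv i F) := by
  induction F using MvPolynomial.induction_on with
  | C c => simp [lineRestrict]
  | add p q hp hq =>
    simp only [lineRestrict, map_add] at *
    simp only [Polynomial.eval_add, hp, hq, mul_add, Finset.sum_add_distrib]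
  | mul_X p n hp =>
    have e0 : (lineRestrict p a b).eval 0 = MvPolynomial.eval a p := by rw [lr_eval]; simp
    have e1 : lineRestrict (p * X n) a b = lineRestrict p a b * (Polynomial.C (a n) + Polynomial.C (b n) * Polynomial.X) := by
      simp [lineRestrict]
    rw [e1]
    simp only [Polynomial.derivative_mul, Polynomial.eval_add, Polynomial.eval_mul, hp, e0]
    simp [Derivation.leibniz, mul_add, Finset.sum_add_distrib, Pi.single_apply, Finset.sum_mul,
      MvPolynomial.pderiv_X, apply_ite]
    rw [add_comm, mul_comm]
    congr 1
    apply Finset.sum_congr rfl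
    intros; ring

/-- degree at most four polynomials from values -/
lemma poly_of_vals {P : ℂ[X]} {A0 A1 A2 A3 A4 : ℂ}
    (h : ∀ t, P.eval t = A0 + A1*t + A2*t^2 + A3*t^3 + A4*t^4) :
    P = Polynomial.C A0 + Polynomial.C A1 * Polynomial.X + Polynomial.C A2 * Polynomial.X^2 +
      Polynomial.C A3 * Polynomial.X^3 + Polynomial.C A4 * Polynomial.X^4 := by
  apply Polynomial.funext
  intro t
  rw [h]; simp

lemma poly_coeffs {P : ℂ[X]} {A0 A1 A2 A3 A4 : ℂ}
    (h : ∀ t, P.eval t = A0 + A1*t + A2*t^2 + A3*t^3 + A4*t^4) :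
    P.coeff 0 = A0 ∧ P.coeff 1 = A1 ∧ P.coeff 2 = A2 ∧ P.natDegree ≤ 4 := by
  have := poly_of_vals h
  refine ⟨?_, ?_, ?_, ?_⟩
  · rw [this]; simp
  · rw [this]; simp [Polynomial.coeff_X, Polynomial.coeff_X_pow]
  · rw [this]; simp [Polynomial.coeff_X, Polynomial.coeff_X_pow]
  · rw [this]; compute_degree

def rsF (F : MvPolynomial (Fin 3) ℂ) (A B : Fin 3 → ℂ) : ℂ → ℂ → ℂ :=
  fun x y => MvPolynomial.eval (x • A + y • B) F

def Sing (F : MvPolynomial (Fin 3) ℂ) (q : Fin 3 → ℂ) : Prop :=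
  ∀ v : Fin 3 → ℂ, ∃ α β γ : ℂ, ∀ t : ℂ, MvPolynomial.eval (q + t • v) F = α*t^2+β*t^3+γ*t^4

def Sm (F : MvPolynomial (Fin 3) ℂ) : Prop := F.IsHomogeneous 4 ∧ ∀ q, q ≠ 0 → ¬ Sing F q

lemma rsF_bq {F : MvPolynomial (Fin 3) ℂ} (hF : F.IsHomogeneous 4) (A B : Fin 3 → ℂ) :
    ∃ a b c d e, ∀ x y, rsF F A B x y = bq a b c d e x y := by
  have hQ : IsQ (QF (fun i => F.coeff (mk i))) := ⟨_, fun _ _ _ => rfl⟩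
  obtain ⟨a, b, c, d, e, h⟩ := hQ.line A B
  refine ⟨a, b, c, d, e, fun x y => ?_⟩
  rw [rsF, hom_eval hF, ← h]
  simp only [Pi.add_apply, Pi.smul_apply, smul_eq_mul, mul_comm]

lemma lr_vals {F : MvPolynomial (Fin 3) ℂ} {A B : Fin 3 → ℂ} {a b c d e : ℂ}
    (h : ∀ x y, rsF F A B x y = bq a b c d e x y) (t : ℂ) :
    (lineRestrict F A B).eval t = a + b*t + c*t^2 + d*t^3 + e*t^4 := by
  have := h 1 t
  rw [lr_eval, ← one_smul ℂ A]
  simp only [rsF, bq] at this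
  rw [this]; ring

lemma lr_vals' {F : MvPolynomial (Fin 3) ℂ} {A B : Fin 3 → ℂ} {a b c d e : ℂ}
    (h : ∀ x y, rsF F A B x y = bq a b c d e x y) (t : ℂ) :
    (lineRestrict F B A).eval t = e + d*t + c*t^2 + b*t^3 + a*t^4 := by
  have := h t 1
  rw [lr_eval, ← one_smul ℂ B, add_comm]
  simp only [rsF, bq] at this
  rw [this]; ring

lemma sing_of_dvd {F : MvPolynomial (Fin 3) ℂ} (hF : F.IsHomogeneous 4) {q : Fin 3 → ℂ}
    (h : ∀ v, (lineRestrict F q v).coeff 0 = 0 ∧ (lineRestrict F q v).coeff 1 = 0) : Sing F q := by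
  intro v
  obtain ⟨a, b, c, d, e, hq⟩ := rsF_bq hF q v
  have hv := lr_vals hq
  obtain ⟨h0, h1, -, -⟩ := poly_coeffs hv
  refine ⟨c, d, e, fun t => ?_⟩
  rw [← lr_eval, hv, ← h0, ← h1, (h v).1, (h v).2]; ring

lemma Sm.ne_zero {F : MvPolynomial (Fin 3) ℂ} (h : Sm F) : F ≠ 0 := by
  rintro rfl
  refine h.2 ![1, 0, 0] (fun h => by simpa using congrFun h 0) (fun v => ⟨0, 0, 0, by simp⟩)

lemma Sm.smooth {F : MvPolynomial (Fin 3) ℂ} (h : Sm F) : IsSmoothCurve F 4 := by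
  refine ⟨h.1, h.ne_zero, fun q hq h0 => ?_⟩
  by_contra hcon
  push Not at hcon
  refine h.2 q hq (sing_of_dvd h.1 fun v => ⟨?_, ?_⟩)
  · rw [Polynomial.coeff_zero_eq_eval_zero, lr_eval]; simpa using h0
  · have := lr_deriv F q v
    rw [← Polynomial.coeff_zero_eq_eval_zero, Polynomial.coeff_derivative] at this
    simpa [hcon] using this

lemma Sing.of_tp {F : MvPolynomial (Fin 3) ℂ} {g : Matrix (Fin 3) (Fin 3) ℂ} (hg : IsUnit g.det)
    {q : Fin 3 → ℂ} (h : Sing (transformPoly g F) q) : Sing F (g.mulVec q) := by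
  intro v
  obtain ⟨α, β, γ, hh⟩ := h (g⁻¹.mulVec v)
  refine ⟨α, β, γ, fun t => ?_⟩
  rw [← hh t, tp_eval, Matrix.mulVec_add, Matrix.mulVec_smul, Matrix.mulVec_mulVec,
    Matrix.mul_nonsing_inv _ hg, Matrix.one_mulVec]

lemma mulVec_ne {g : Matrix (Fin 3) (Fin 3) ℂ} (hg : IsUnit g.det) {q : Fin 3 → ℂ} (hq : q ≠ 0) :
    g.mulVec q ≠ 0 := by
  intro h
  apply hq
  have := congrArg (g⁻¹.mulVec) h
  rwa [Matrix.mulVec_mulVec, Matrix.nonsing_inv_mul _ hg, Matrix.one_mulVec, Matrix.mulVec_zero] at this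

lemma Sm.tp {F : MvPolynomial (Fin 3) ℂ} (h : Sm F) {g : Matrix (Fin 3) (Fin 3) ℂ} (hg : IsUnit g.det) :
    Sm (transformPoly g F) :=
  ⟨tp_hom h.1 g, fun _ hq hs => h.2 _ (mulVec_ne hg hq) (hs.of_tp hg)⟩

/-- the differential of `QF` -/
def dQ (k : Fin 15 → ℂ) (q v : Fin 3 → ℂ) : ℂ :=
  v 0 * (k 0 * q 1^3 + q 2 * (3*k 2*q 0^2 + 2*k 3*q 0*q 1 + k 4*q 1^2) + q 2^2*(2*k 6*q 0 + k 7*q 1) +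
    q 2^3*k 9 + 4*k 12*q 0^3 + 3*k 13*q 0^2*q 1 + 2*k 14*q 0*q 1^2) +
  v 1 * (3*k 0*q 0*q 1^2 + 4*k 1*q 1^3 + q 2*(k 3*q 0^2 + 2*k 4*q 0*q 1 + 3*k 5*q 1^2) +
    q 2^2*(k 7*q 0 + 2*k 8*q 1) + q 2^3*k 10 + k 13*q 0^3 + 2*k 14*q 0^2*q 1) +
  v 2 * ((k 2*q 0^3 + k 3*q 0^2*q 1 + k 4*q 0*q 1^2 + k 5*q 1^3) +
    2*q 2*(k 6*q 0^2 + k 7*q 0*q 1 + k 8*q 1^2) + 3*q 2^2*(k 9*q 0 + k 10*q 1) + 4*k 11*q 2^3)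

lemma QF_taylor (k : Fin 15 → ℂ) (q v : Fin 3 → ℂ) (t : ℂ) :
    QF k (q 0 + t * v 0) (q 1 + t * v 1) (q 2 + t * v 2) = QF k (q 0) (q 1) (q 2) + t * dQ k q v +
      t^2 * (QF k (q 0 + v 0) (q 1 + v 1) (q 2 + v 2) - QF k (q 0) (q 1) (q 2) - dQ k q v - dQ k v q -
        QF k (v 0) (v 1) (v 2)) + t^3 * dQ k v q + t^4 * QF k (v 0) (v 1) (v 2) := by
  simp only [QF, dQ]; ring

lemma sing_of_dQ {G : MvPolynomial (Fin 3) ℂ} (hG : G.IsHomogeneous 4) {q : Fin 3 → ℂ}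
    (h0 : QF (fun i => G.coeff (mk i)) (q 0) (q 1) (q 2) = 0)
    (h1 : ∀ v, dQ (fun i => G.coeff (mk i)) q v = 0) : Sing G q := by
  intro v
  have hT := QF_taylor (fun i => G.coeff (mk i)) q v
  simp only [h0, h1] at hT
  generalize dQ (fun i => G.coeff (mk i)) v q = β at hT
  generalize (QF _ (q 0 + v 0) (q 1 + v 1) (q 2 + v 2)) - 0 - 0 - β - _ = α at hT
  refine ⟨α, β, QF (fun i => G.coeff (mk i)) (v 0) (v 1) (v 2), fun t => ?_⟩
  · rw [hom_eval hG]
    simp only [Pi.add_apply, Pi.smul_apply, smul_eq_mul]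
    refine (hT t).trans ?_
    rw [zero_add, mul_zero, zero_add, mul_comm, mul_comm (t^3), mul_comm (t^4)]

lemma GL_det (g : GL (Fin 3) ℂ) : IsUnit (g : Matrix (Fin 3) (Fin 3) ℂ).det :=
  (Matrix.isUnit_iff_isUnit_det _).1 g.isUnit

lemma Sm.git {F : MvPolynomial (Fin 3) ℂ} (h : Sm F) : GITSemistable F := by
  intro g a ha
  by_contra hcon
  push Not at hcon
  obtain ⟨hG, hs⟩ := h.tp (GL_det g)
  set G := transformPoly (g : Matrix (Fin 3) (Fin 3) ℂ) F with hGdef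
  have key : ∀ i, (∑ j, (ex i j : ℤ) * a j) ≤ 0 → G.coeff (mk i) = 0 := by
    intro i hi
    by_contra hne
    have := hcon (mk i) (MvPolynomial.mem_support_iff.2 hne)
    simp only [mk_apply] at this
    omega
  simp only [Fin.sum_univ_three] at key ha
  have k0 := key 0
  have k1 := key 1
  have k2 := key 2
  have k5 := key 5
  have k9 := key 9
  have k10 := key 10
  have k11 := key 11
  have k12 := key 12
  have k13 := key 13
  simp [ex] at k0 k1 k2 k5 k9 k10 k11 k12 k13
  by_cases h0 : a 0 ≤ a 1 ∧ a 0 ≤ a 2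
  · refine hs ![1, 0, 0] (fun h => by simpa using congrFun h 0) (sing_of_dQ hG ?_ fun v => ?_)
    · simp [QF, k12 (by omega)]
    · simp [dQ, k12 (by omega), k13 (by omega), k2 (by omega)]
  by_cases h1 : a 1 ≤ a 0 ∧ a 1 ≤ a 2
  · refine hs ![0, 1, 0] (fun h => by simpa using congrFun h 1) (sing_of_dQ hG ?_ fun v => ?_)
    · simp [QF, k1 (by omega)]
    · simp [dQ, k1 (by omega), k0 (by omega), k5 (by omega)]
  · refine hs ![0, 0, 1] (fun h => by simpa using congrFun h 2) (sing_of_dQ hG ?_ fun v => ?_)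
    · simp [QF, k11 (by omega)]
    · simp [dQ, k9 (by omega), k10 (by omega), k11 (by omega)]

lemma exists_zero {a : MvPolynomial (Fin 3) ℂ} (ha : a ≠ 0) (hu : ¬ IsUnit a) :
    ∃ q, q ≠ 0 ∧ MvPolynomial.eval q a = 0 := by
  by_contra hcon
  push Not at hcon
  set e0 : Fin 3 → ℂ := ![1, 0, 0]
  have key : ∀ u : Fin 3 → ℂ, u 1 ≠ 0 → MvPolynomial.eval u a = MvPolynomial.eval e0 a := by
    intro u hu1
    have hne : ∀ t : ℂ, (lineRestrict a e0 (u - e0)).eval t ≠ 0 := by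
      intro t
      rw [lr_eval]
      apply hcon
      intro h
      have h0 := congrFun h 0
      have h1 := congrFun h 1
      simp [e0] at h0 h1
      rcases h1 with h1 | h1
      · simp [h1] at h0
      · exact hu1 h1
    have hd : (lineRestrict a e0 (u - e0)).degree = 0 := by
      by_contra hd
      obtain ⟨t, ht⟩ := IsAlgClosed.exists_root _ hd
      exact hne t ht
    have hc := Polynomial.eq_C_of_degree_eq_zero hd
    have e1 := lr_eval a e0 (u - e0) 0
    have e2 := lr_eval a e0 (u - e0) 1
    rw [hc, Polynomial.eval_C] at e1 e2
    rw [e1] at e2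
    simpa using e2.symm
  have h2 : (a - MvPolynomial.C (MvPolynomial.eval e0 a)) * X 1 = 0 := by
    apply MvPolynomial.funext
    intro u
    by_cases hu1 : u 1 = 0
    · simp [hu1]
    · simp [key u hu1]
  rcases mul_eq_zero.1 h2 with h | h
  · rw [sub_eq_zero] at h
    apply hu
    rw [h]
    apply IsUnit.map
    apply IsUnit.mk0
    apply hcon
    intro h
    simpa [e0] using congrFun h 0
  · exact MvPolynomial.X_ne_zero _ h

lemma Sm.squarefree {F : MvPolynomial (Fin 3) ℂ} (h : Sm F) : Squarefree F := by
  rintro a ⟨b, hb⟩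
  by_contra hu
  have ha : a ≠ 0 := by
    rintro rfl
    exact h.ne_zero (by simpa using hb)
  obtain ⟨q, hq, hq0⟩ := exists_zero ha hu
  refine h.2 q hq (sing_of_dvd h.1 fun v => ?_)
  have h1 : Polynomial.X ∣ lineRestrict a q v := by
    rw [Polynomial.X_dvd_iff, Polynomial.coeff_zero_eq_eval_zero, lr_eval]
    simpa using hq0
  have h2 : Polynomial.X^2 ∣ lineRestrict F q v := by
    have : lineRestrict F q v = lineRestrict a q v * lineRestrict a q v * lineRestrict b q v := by
      rw [hb]; simp [lineRestrict]
    rw [this, pow_two]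
    exact Dvd.dvd.mul_right (mul_dvd_mul h1 h1) _
  rw [Polynomial.X_pow_dvd_iff] at h2
  exact ⟨h2 0 (by norm_num), h2 1 (by norm_num)⟩

/-- cross product -/
def cr (A B : Fin 3 → ℂ) : Fin 3 → ℂ :=
  ![A 1 * B 2 - A 2 * B 1, A 2 * B 0 - A 0 * B 2, A 0 * B 1 - A 1 * B 0]

def Ind (A B : Fin 3 → ℂ) : Prop := ∀ x y : ℂ, x • A + y • B = 0 → x = 0 ∧ y = 0

lemma Ind_iff {A B : Fin 3 → ℂ} : Ind A B ↔ LinearIndependent ℂ ![A, B] :=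
  LinearIndependent.pair_iff.symm

lemma cr_ne {A B : Fin 3 → ℂ} (h : Ind A B) : cr A B ≠ 0 := by
  intro h0
  have c0 := congrFun h0 0
  have c1 := congrFun h0 1
  have c2 := congrFun h0 2
  simp [cr] at c0 c1 c2
  have hA : A ≠ 0 := by
    rintro rfl
    have := h 1 0 (by simp)
    simp at this
  obtain ⟨i, hi⟩ := Function.ne_iff.1 hA
  have := (h (B i) (- A i) (by
    funext j
    fin_cases i <;> fin_cases j <;> simp <;> grind)).2
  apply hi
  simpa using this

lemma cr_prop {w A B : Fin 3 → ℂ} (hA : dotv w A = 0) (hB : dotv w B = 0) (i j : Fin 3) :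
    w i * cr A B j = w j * cr A B i := by
  simp only [dotv, Fin.sum_univ_three] at hA hB
  fin_cases i <;> fin_cases j <;> simp [cr] <;> grind

lemma eq_smul_cr {w A B : Fin 3 → ℂ} (h : Ind A B) (hA : dotv w A = 0) (hB : dotv w B = 0) :
    ∃ c : ℂ, w = c • cr A B := by
  obtain ⟨i, hi⟩ := Function.ne_iff.1 (cr_ne h)
  refine ⟨w i / cr A B i, funext fun j => ?_⟩
  have := cr_prop hA hB i j
  simp only [Pi.zero_apply] at hi
  simp only [Pi.smul_apply, smul_eq_mul]
  field_simp
  linear_combination -this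

lemma perp_unique {w w' A B : Fin 3 → ℂ} (h : Ind A B) (hA : dotv w A = 0) (hB : dotv w B = 0)
    (hA' : dotv w' A = 0) (hB' : dotv w' B = 0) (hw : w ≠ 0) : ∃ c : ℂ, w' = c • w := by
  obtain ⟨c, hc⟩ := eq_smul_cr h hA hB
  obtain ⟨c', hc'⟩ := eq_smul_cr h hA' hB'
  have : c ≠ 0 := by rintro rfl; exact hw (by simpa using hc)
  refine ⟨c' / c, ?_⟩
  rw [hc, hc', smul_smul, div_mul_cancel₀ _ this]

lemma cr_dot (A B : Fin 3 → ℂ) : dotv (cr A B) A = 0 ∧ dotv (cr A B) B = 0 := by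
  simp [dotv, Fin.sum_univ_three, cr]
  constructor <;> ring

/-- completing to a basis -/
lemma exists_frame {A B : Fin 3 → ℂ} (h : Ind A B) :
    ∃ N : Matrix (Fin 3) (Fin 3) ℂ, IsUnit N.det ∧ ∀ v : Fin 3 → ℂ, ∃ D : Fin 3 → ℂ,
      N.mulVec v = v 0 • A + v 1 • B + v 2 • D := by
  obtain ⟨i, hi⟩ := Function.ne_iff.1 (cr_ne h)
  simp only [Pi.zero_apply] at hi
  refine ⟨Matrix.of (fun r c => ![A r, B r, (Pi.single i 1 : Fin 3 → ℂ) r] c), ?_, fun v => ⟨Pi.single i 1, ?_⟩⟩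
  · apply IsUnit.mk0
    rw [Matrix.det_fin_three]
    fin_cases i <;> simp [cr] at hi ⊢ <;> intro h0 <;> apply hi <;> linear_combination h0
  · funext r
    simp [Matrix.mulVec, dotProduct, Fin.sum_univ_three]
    ring

lemma cubic_root (a b c d : ℂ) : ∃ x y : ℂ, (x ≠ 0 ∨ y ≠ 0) ∧ a*x^3+b*x^2*y+c*x*y^2+d*y^3 = 0 := by
  by_cases ha : a = 0
  · exact ⟨1, 0, by simp, by simp [ha]⟩
  · set P : ℂ[X] := Polynomial.C a * Polynomial.X^3 + Polynomial.C b * Polynomial.X^2 +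
      Polynomial.C c * Polynomial.X + Polynomial.C d with hP
    have hd : P.degree = 3 := by rw [hP]; exact Polynomial.degree_cubic ha
    obtain ⟨x, hx⟩ := IsAlgClosed.exists_root P (by rw [hd]; norm_num)
    refine ⟨x, 1, by simp, ?_⟩
    simp [hP] at hx
    linear_combination hx

lemma Sm.no_line {F : MvPolynomial (Fin 3) ℂ} (h : Sm F) {A B : Fin 3 → ℂ} (hAB : Ind A B) :
    ¬ ∀ x y, rsF F A B x y = 0 := by
  intro h0
  obtain ⟨N, hN, hv⟩ := exists_frame hAB
  obtain ⟨hG, hs⟩ := h.tp hN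
  set G := transformPoly N F
  set k : Fin 15 → ℂ := fun i => G.coeff (mk i) with hk
  have hz : ∀ x y : ℂ, QF k x y 0 = 0 := by
    intro x y
    have h1 := hom_eval hG ![x, y, 0]
    rw [tp_eval] at h1
    obtain ⟨D, hD⟩ := hv ![x, y, 0]
    rw [hD] at h1
    have := h0 x y
    rw [rsF] at this
    simp at h1
    rw [this] at h1
    exact h1.symm
  have h1 := hz 1
  simp [QF] at h1
  obtain ⟨k12, k13, k14, k0, k1⟩ := poly4_zero (a := k 12) (b := k 13) (c := k 14) (d := k 0) (e := k 1)
    (fun t => by linear_combination h1 t)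
  obtain ⟨x, y, hxy, hr⟩ := cubic_root (k 2) (k 3) (k 4) (k 5)
  refine hs ![x, y, 0] ?_ (sing_of_dQ hG ?_ fun v => ?_)
  · intro h
    have a := congrFun h 0
    have b := congrFun h 1
    simp at a b
    tauto
  · exact hz x y
  · change dQ k _ v = 0
    simp [dQ, k12, k13, k14, k0, k1]
    right; linear_combination hr

lemma triple_coeffs {P : ℂ[X]} {A0 A1 A2 A3 A4 t : ℂ}
    (h : ∀ t, P.eval t = A0 + A1*t + A2*t^2 + A3*t^3 + A4*t^4)
    (hd : (Polynomial.X - Polynomial.C t)^3 ∣ P) : bI A0 A1 A2 A3 A4 = 0 ∧ bJ A0 A1 A2 A3 A4 = 0 := by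
  have hdeg := (poly_coeffs h).2.2.2
  obtain ⟨Q, hQ⟩ := hd
  have hQd : Q.natDegree ≤ 1 := by
    by_cases h0 : Q = 0
    · simp [h0]
    · rw [hQ, Polynomial.natDegree_mul (pow_ne_zero _ (Polynomial.X_sub_C_ne_zero t)) h0] at hdeg
      simp at hdeg
      omega
  have hQe := Polynomial.eq_X_add_C_of_natDegree_le_one hQd
  generalize Q.coeff 1 = s at hQe
  generalize Q.coeff 0 = r at hQe
  have hv : ∀ z : ℂ, A0 + A1*z + A2*z^2 + A3*z^3 + A4*z^4 = (z - t)^3 * (s * z + r) := by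
    intro z
    rw [← h, hQ, hQe]; simp
  obtain ⟨h0, h1, h2, h3, h4⟩ := poly4_zero (a := A0 + t^3*r) (b := A1 - 3*t^2*r + t^3*s)
    (c := A2 + 3*t*r - 3*t^2*s) (d := A3 - r + 3*t*s) (e := A4 - s) (fun z => by linear_combination hv z)
  have e0 : A0 = -(t^3*r) := by linear_combination h0
  have e1 : A1 = 3*t^2*r - t^3*s := by linear_combination h1
  have e2 : A2 = -3*t*r + 3*t^2*s := by linear_combination h2
  have e3 : A3 = r - 3*t*s := by linear_combination h3
  have e4 : A4 = s := by linear_combination h4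
  subst e0 e1 e2 e3 e4
  constructor
  · simp only [bI]; ring
  · simp only [bJ]; ring

lemma tri_of_mult {F : MvPolynomial (Fin 3) ℂ} (hF : F.IsHomogeneous 4) {A B : Fin 3 → ℂ}
    (h : inflMultLine F A B ≠ 0) : Tri (rsF F A B) := by
  obtain ⟨a, b, c, d, e, hq⟩ := rsF_bq hF A B
  have hv := lr_vals hq
  have hv' := lr_vals' hq
  rw [Tri_iff hq]
  by_cases hc : padm (contactAt F B A) = 0
  · have hs : ((lineRestrict F A B).roots.toFinset.sum fun t =>
      padm ((lineRestrict F A B).rootMultiplicity t)) ≠ 0 := by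
      intro h0; apply h; rw [inflMultLine, h0, hc]
    obtain ⟨t, -, ht⟩ := Finset.exists_ne_zero_of_sum_ne_zero hs
    refine triple_coeffs hv (t := t) ?_
    refine dvd_trans (pow_dvd_pow _ ?_) (Polynomial.pow_rootMultiplicity_dvd _ t)
    simp only [padm] at ht
    omega
  · have : (Polynomial.X - Polynomial.C 0)^3 ∣ lineRestrict F B A := by
      refine dvd_trans (pow_dvd_pow _ ?_) (Polynomial.pow_rootMultiplicity_dvd _ 0)
      simp only [padm, contactAt] at hc
      omega
    obtain ⟨h1, h2⟩ := triple_coeffs hv' this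
    simp only [bI, bJ] at h1 h2 ⊢
    exact ⟨by linear_combination h1, by linear_combination h2⟩

lemma mult_of_tri {F : MvPolynomial (Fin 3) ℂ} (hF : Sm F) {A B : Fin 3 → ℂ} (hAB : Ind A B)
    (h : Tri (rsF F A B)) : 0 < inflMultLine F A B := by
  have hno := hF.no_line hAB
  obtain ⟨a, b, c, d, e, hq, hI, hJ⟩ := h
  obtain ⟨u, v, r, s, huv, hh⟩ := exists_triple hI hJ
  by_cases hu : u = 0
  · have hv : v ≠ 0 := by tauto
    have hP : lineRestrict F B A = (Polynomial.X - Polynomial.C 0)^3 *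
        (Polynomial.C (v^3) * (Polynomial.C r * Polynomial.X + Polynomial.C s)) := by
      apply Polynomial.funext
      intro t
      rw [lr_eval]
      have := hq t 1
      rw [hh, hu, rsF, one_smul, add_comm] at this
      rw [this]; simp; ring
    have hne : lineRestrict F B A ≠ 0 := by
      intro h0
      apply hno
      intro x y
      rw [hq, hh, hu]
      have e1 := congrArg (Polynomial.eval 1) h0
      have e2 := congrArg (Polynomial.eval (-1)) h0
      rw [hP] at e1 e2
      simp [hv] at e1 e2
      have hr : r = 0 := by linear_combination (e1 - e2)/2
      have hs : s = 0 := by linear_combination (e1 + e2)/2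
      rw [hr, hs]; ring
    have : 3 ≤ contactAt F B A :=
      (Polynomial.le_rootMultiplicity_iff hne).2 ⟨_, hP⟩
    simp only [inflMultLine, padm]
    omega
  · have hP : lineRestrict F A B = (Polynomial.X - Polynomial.C (v/u))^3 *
        (Polynomial.C (-u^3) * (Polynomial.C r + Polynomial.C s * Polynomial.X)) := by
      apply Polynomial.funext
      intro t
      rw [lr_eval]
      have := hq 1 t
      rw [hh, rsF, one_smul] at this
      rw [this]; simp; field_simp; ring
    have hne : lineRestrict F A B ≠ 0 := by
      intro h0
      apply hno
      intro x y
      rw [hq, hh]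
      have h1 : Polynomial.C r + Polynomial.C s * Polynomial.X = 0 := by
        rw [hP] at h0
        rcases mul_eq_zero.1 h0 with h | h
        · exact absurd h (pow_ne_zero _ (Polynomial.X_sub_C_ne_zero _))
        · rcases mul_eq_zero.1 h with h | h
          · exact absurd (Polynomial.C_eq_zero.1 h) (neg_ne_zero.2 (pow_ne_zero _ hu))
          · exact h
      have e1 := congrArg (Polynomial.eval 0) h1
      have e2 := congrArg (Polynomial.eval 1) h1
      simp at e1 e2
      rw [e1] at e2
      rw [e1]
      simp at e2
      rw [e2]; ring
    have h3 : 3 ≤ (lineRestrict F A B).rootMultiplicity (v/u) :=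
      (Polynomial.le_rootMultiplicity_iff hne).2 ⟨_, hP⟩
    have hmem : v/u ∈ (lineRestrict F A B).roots.toFinset := by
      rw [Multiset.mem_toFinset, Polynomial.mem_roots hne, ← Polynomial.rootMultiplicity_pos hne]
      omega
    have := Finset.single_le_sum (f := fun t => padm ((lineRestrict F A B).rootMultiplicity t))
      (fun _ _ => Nat.zero_le _) hmem
    simp only [padm] at this
    simp only [inflMultLine, padm]
    omega

lemma mult_le {F : MvPolynomial (Fin 3) ℂ} (hF : F.IsHomogeneous 4) (A B : Fin 3 → ℂ) :
    inflMultLine F A B ≤ 8 := by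
  have hd : ∀ A B, (lineRestrict F A B).natDegree ≤ 4 := by
    intro A B
    obtain ⟨a, b, c, d, e, hq⟩ := rsF_bq hF A B
    exact (poly_coeffs (lr_vals hq)).2.2.2
  have h1 : ((lineRestrict F A B).roots.toFinset.sum fun t =>
    padm ((lineRestrict F A B).rootMultiplicity t)) ≤ 4 := by
    refine le_trans (Finset.sum_le_sum (g := fun t => (lineRestrict F A B).roots.count t) fun t _ => ?_) ?_
    · rw [Polynomial.count_roots]; exact Nat.sub_le _ _
    · rw [Multiset.toFinset_sum_count_eq]
      exact (Polynomial.card_roots' _).trans (hd A B)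
  have h2 : padm (contactAt F B A) ≤ 4 := by
    refine le_trans (Nat.sub_le _ _) ?_
    rw [contactAt, ← Polynomial.count_roots]
    exact (Multiset.count_le_card _ _).trans ((Polynomial.card_roots' _).trans (hd B A))
  rw [inflMultLine]; omega

lemma dual_pos {F : MvPolynomial (Fin 3) ℂ} (hF : Sm F) {w A B : Fin 3 → ℂ} (hAB : Ind A B)
    (hA : dotv w A = 0) (hB : dotv w B = 0) (h : Tri (rsF F A B)) : inflMultDual F w ≠ 0 := by
  have hpos := mult_of_tri hF hAB h
  have hb := mult_le hF.1
  have h3 : ∀ a b, (⨆ _ : dotv w a = 0 ∧ dotv w b = 0 ∧ LinearIndependent ℂ ![a, b],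
    inflMultLine F a b) ≤ 8 := fun a b => ciSup_le' fun _ => hb a b
  have h2 : ∀ a, (⨆ b, ⨆ _ : dotv w a = 0 ∧ dotv w b = 0 ∧ LinearIndependent ℂ ![a, b],
    inflMultLine F a b) ≤ 8 := fun a => ciSup_le' fun b => h3 a b
  have : inflMultLine F A B ≤ inflMultDual F w := by
    unfold inflMultDual
    refine le_trans ?_ (le_ciSup (f := fun a => ⨆ b, ⨆ _ : dotv w a = 0 ∧ dotv w b = 0 ∧
      LinearIndependent ℂ ![a, b], inflMultLine F a b) ⟨8, by rintro _ ⟨a, rfl⟩; exact h2 a⟩ A)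
    refine le_trans ?_ (le_ciSup (f := fun b => ⨆ _ : dotv w A = 0 ∧ dotv w b = 0 ∧
      LinearIndependent ℂ ![A, b], inflMultLine F A b) ⟨8, by rintro _ ⟨a, rfl⟩; exact h3 A a⟩ B)
    exact le_ciSup (f := fun _ : dotv w A = 0 ∧ dotv w B = 0 ∧
      LinearIndependent ℂ ![A, B] => inflMultLine F A B) ⟨8, by rintro _ ⟨a, rfl⟩; exact hb A B⟩
      ⟨hA, hB, Ind_iff.1 hAB⟩
  omega

lemma dual_tri {F : MvPolynomial (Fin 3) ℂ} (hF : F.IsHomogeneous 4) {w : Fin 3 → ℂ}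
    (h : inflMultDual F w ≠ 0) : ∃ A B, Ind A B ∧ dotv w A = 0 ∧ dotv w B = 0 ∧ Tri (rsF F A B) := by
  by_contra hcon
  push Not at hcon
  apply h
  unfold inflMultDual
  rw [← Nat.le_zero]
  refine ciSup_le' fun A => ciSup_le' fun B => ciSup_le' fun hh => ?_
  rw [Nat.le_zero]
  by_contra hne
  exact hcon A B (Ind_iff.2 hh.2.2) hh.1 hh.2.1 (tri_of_mult hF hne)

def Fits (N : Matrix (Fin 3) (Fin 3) ℂ) (F : MvPolynomial (Fin 3) ℂ) (k : Fin 15 → ℂ) : Prop :=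
  F.IsHomogeneous 4 ∧ ∀ v : Fin 3 → ℂ, MvPolynomial.eval (N.mulVec v) F = QF k (v 0) (v 1) (v 2)

lemma Fits.rs {N : Matrix (Fin 3) (Fin 3) ℂ} {F : MvPolynomial (Fin 3) ℂ} {k : Fin 15 → ℂ}
    (h : Fits N F k) (A B : Fin 3 → ℂ) : rsF F (N.mulVec A) (N.mulVec B) = rs (QF k) A B := by
  funext x y
  rw [rsF, ← Matrix.mulVec_smul, ← Matrix.mulVec_smul, ← Matrix.mulVec_add, h.2]
  simp [Infl.rs]

lemma inv_cancel {N : Matrix (Fin 3) (Fin 3) ℂ} (hN : IsUnit N.det) (A : Fin 3 → ℂ) :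
    N.mulVec (N⁻¹.mulVec A) = A ∧ N⁻¹.mulVec (N.mulVec A) = A := by
  constructor
  · rw [Matrix.mulVec_mulVec, Matrix.mul_nonsing_inv _ hN, Matrix.one_mulVec]
  · rw [Matrix.mulVec_mulVec, Matrix.nonsing_inv_mul _ hN, Matrix.one_mulVec]

lemma inv_det {N : Matrix (Fin 3) (Fin 3) ℂ} (hN : IsUnit N.det) : IsUnit (N⁻¹).det :=
  (Matrix.isUnit_nonsing_inv_det_iff).2 hN

lemma Ind.mulVec {N : Matrix (Fin 3) (Fin 3) ℂ} (hN : IsUnit N.det) {A B : Fin 3 → ℂ} (h : Ind A B) :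
    Ind (N.mulVec A) (N.mulVec B) := by
  intro x y hxy
  rw [← Matrix.mulVec_smul, ← Matrix.mulVec_smul, ← Matrix.mulVec_add] at hxy
  apply h
  by_contra hne
  exact mulVec_ne hN hne hxy

lemma Fits.sm {N : Matrix (Fin 3) (Fin 3) ℂ} (hN : IsUnit N.det) {F : MvPolynomial (Fin 3) ℂ}
    {k : Fin 15 → ℂ} (h : Fits N F k) (hs : ∀ q : Fin 3 → ℂ, q ≠ 0 → ¬ Sg (QF k) q) : Sm F := by
  refine ⟨h.1, fun q hq hsing => hs _ (mulVec_ne (inv_det hN) hq) fun v => ?_⟩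
  obtain ⟨α, β, γ, hh⟩ := hsing (N.mulVec v)
  refine ⟨α, β, γ, fun t => ?_⟩
  rw [← hh t]
  have := h.2 (N⁻¹.mulVec q + t • v)
  rw [Matrix.mulVec_add, Matrix.mulVec_smul, (inv_cancel hN q).1] at this
  rw [this]
  simp

lemma dotv_vecMul (w : Fin 3 → ℂ) (N : Matrix (Fin 3) (Fin 3) ℂ) (A : Fin 3 → ℂ) :
    dotv w (N.mulVec A) = dotv (Matrix.vecMul w N) A :=
  Matrix.dotProduct_mulVec w N A

lemma lv_dotv (u A : Fin 3 → ℂ) : lv u A = dotv u A := by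
  simp [lv, lf, dotv, Fin.sum_univ_three]

lemma vecMul_ne {N : Matrix (Fin 3) (Fin 3) ℂ} (hN : IsUnit N.det) {w : Fin 3 → ℂ} (hw : w ≠ 0) :
    Matrix.vecMul w N ≠ 0 := by
  intro h
  apply hw
  have := congrArg (fun v => Matrix.vecMul v N⁻¹) h
  simpa [Matrix.vecMul_vecMul, Matrix.mul_nonsing_inv _ hN] using this

/-- The finite set of flex lines, in the given frame -/
def FinT (k : Fin 15 → ℂ) (T : Finset (Fin 3 → ℂ)) : Prop :=
  (∀ u ∈ T, u ≠ 0) ∧ ∀ A B : Fin 3 → ℂ, Ind A B → Tri (rs (QF k) A B) → ∃ u ∈ T, lv u A = 0 ∧ lv u B = 0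

lemma finite_support {N : Matrix (Fin 3) (Fin 3) ℂ} (hN : IsUnit N.det) {F : MvPolynomial (Fin 3) ℂ}
    {k : Fin 15 → ℂ} (h : Fits N F k) {T : Finset (Fin 3 → ℂ)} (hT : FinT k T) :
    {l : DualPlane | inflMultDual F l.rep ≠ 0}.Finite := by
  classical
  refine Set.Finite.subset (Set.Finite.image (fun u : Fin 3 → ℂ => if hu : u ≠ 0 then
    Projectivization.mk ℂ (Matrix.vecMul u N⁻¹) (vecMul_ne (inv_det hN) hu) else
    Projectivization.mk ℂ ![1, 0, 0] (fun h => by simpa using congrFun h 0)) T.finite_toSet) ?_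
  intro l hl
  obtain ⟨A, B, hAB, hA, hB, htri⟩ := dual_tri h.1 hl
  have hr := h.rs (N⁻¹.mulVec A) (N⁻¹.mulVec B)
  rw [(inv_cancel hN A).1, (inv_cancel hN B).1] at hr
  rw [hr] at htri
  obtain ⟨u, hu, hA', hB'⟩ := hT.2 _ _ (Ind.mulVec (inv_det hN) hAB) htri
  refine ⟨u, hu, ?_⟩
  have hu0 := hT.1 u hu
  simp only [dif_pos hu0]
  rw [lv_dotv, dotv_vecMul] at hA' hB'
  obtain ⟨c, hc⟩ := perp_unique hAB hA hB hA' hB' l.rep_nonzero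
  have hc0 : c ≠ 0 := by
    rintro rfl
    exact vecMul_ne (inv_det hN) hu0 (by simpa using hc)
  rw [← l.mk_rep, Projectivization.mk_eq_mk_iff']
  exact ⟨c, hc.symm⟩

lemma fiber_const (F : MvPolynomial (Fin 3) ℂ) (t : ℂ) : fiberAt (rename Fin.castSucc F) t = F := by
  rw [fiberAt, MvPolynomial.aeval_rename]
  have : ((fun i : Fin 4 => if h : (i : ℕ) < 3 then X ⟨i, h⟩ else MvPolynomial.C t) ∘ Fin.castSucc :
      Fin 3 → MvPolynomial (Fin 3) ℂ) = MvPolynomial.X := by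
    funext i
    have := i.2
    simp
  rw [this, MvPolynomial.aeval_X_left_apply]

lemma const_limit {F : MvPolynomial (Fin 3) ℂ} (hF : Sm F) {μ : (Fin 3 → ℂ) → ℕ}
    (h : IsLimitConfig F μ) {w₀ : Fin 3 → ℂ} (hw : w₀ ≠ 0) :
    ∀ᶠ ε in nhdsWithin (0 : ℝ) (Set.Ioi 0), inflNear F w₀ ε = μ w₀ := by
  have hs : IsQuarticSmoothing (rename Fin.castSucc F) F := by
    refine ⟨fiber_const F 0, fun t => ?_, Eventually.of_forall fun t => ?_⟩
    · rw [fiber_const]; exact hF.1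
    · rw [fiber_const]; exact hF.smooth
  have := h.2 _ hs w₀ hw
  simp only [fiber_const] at this
  filter_upwards [this] with ε hε
  exact (eventually_const.1 hε)

lemma near_pos {F : MvPolynomial (Fin 3) ℂ} (hfin : {l : DualPlane | inflMultDual F l.rep ≠ 0}.Finite)
    (hF : Sm F) {w A B : Fin 3 → ℂ} (hw : w ≠ 0) (hAB : Ind A B)
    (hA : dotv w A = 0) (hB : dotv w B = 0) (h : Tri (rsF F A B)) {ε : ℝ} (hε : 0 < ε) :
    inflNear F w ε ≠ 0 := by
  classical
  set l : DualPlane := Projectivization.mk ℂ w hw with hl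
  obtain ⟨a, ha⟩ := Projectivization.exists_smul_eq_mk_rep ℂ w hw
  have hd : inflMultDual F l.rep ≠ 0 := by
    refine dual_pos hF hAB ?_ ?_ h
    · rw [hl, ← ha]
      simp only [dotv, Units.smul_def, Pi.smul_apply, smul_eq_mul, mul_assoc, ← Finset.mul_sum] at hA ⊢
      rw [hA, mul_zero]
    · rw [hl, ← ha]
      simp only [dotv, Units.smul_def, Pi.smul_apply, smul_eq_mul, mul_assoc, ← Finset.mul_sum] at hB ⊢
      rw [hB, mul_zero]
  have hn : projNear ε l.rep w := by
    refine ⟨(a : ℂ)⁻¹, ?_⟩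
    rw [hl, ← ha, Units.smul_def, smul_smul, inv_mul_cancel₀ a.ne_zero, one_smul]
    simpa using hε
  unfold inflNear
  intro h0
  have hf : (Function.support fun l : DualPlane =>
      if projNear ε l.rep w then inflMultDual F l.rep else 0).Finite := by
    refine hfin.subset fun l hl => ?_
    simp only [Function.mem_support, ne_eq, ite_eq_right_iff, Classical.not_imp] at hl
    exact hl.2
  have hle := single_le_finsum l hf (fun _ => Nat.zero_le _)
  simp only [if_pos hn] at hle
  have h0' : (∑ᶠ l : DualPlane, if projNear ε l.rep w then inflMultDual F l.rep else 0) = 0 := by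
    convert h0
  omega

lemma near_exists {F : MvPolynomial (Fin 3) ℂ} (hF : F.IsHomogeneous 4) {w : Fin 3 → ℂ} {ε : ℝ}
    (h : inflNear F w ε ≠ 0) : ∃ w' A B, ‖w' - w‖ < ε ∧ Ind A B ∧ dotv w' A = 0 ∧ dotv w' B = 0 ∧
      Tri (rsF F A B) := by
  unfold inflNear at h
  obtain ⟨l, hl⟩ : ∃ l : DualPlane, ¬ ((open Classical in if projNear ε l.rep w then inflMultDual F l.rep else 0) = 0) := by
    by_contra hcon
    push Not at hcon
    apply h
    rw [finsum_congr hcon, finsum_zero]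
  simp only [ne_eq, ite_eq_right_iff, Classical.not_imp] at hl
  obtain ⟨⟨c, hc⟩, hm⟩ := hl
  obtain ⟨A, B, hAB, hA, hB, ht⟩ := dual_tri hF hm
  refine ⟨c • l.rep, A, B, hc, hAB, ?_, ?_, ht⟩
  · simp only [dotv, Pi.smul_apply, smul_eq_mul, mul_assoc, ← Finset.mul_sum] at hA ⊢
    rw [hA, mul_zero]
  · simp only [dotv, Pi.smul_apply, smul_eq_mul, mul_assoc, ← Finset.mul_sum] at hB ⊢
    rw [hB, mul_zero]

lemma LI_cont (k : Fin 15 → ℂ) : Continuous (fun p : ℂ × ℂ => (LI k p.1 p.2, LJ k p.1 p.2)) := by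
  unfold LI LJ bI bJ lA lB lC lD lE
  fun_prop

lemma LI_contAt (k : Fin 15 → ℂ) {s r : (Fin 3 → ℂ) → ℂ} {w : Fin 3 → ℂ} (hs : ContinuousAt s w)
    (hr : ContinuousAt r w) : ContinuousAt (fun w => (LI k (s w) (r w), LJ k (s w) (r w))) w := by
  have h := ((LI_cont k).tendsto (s w, r w)).comp (hs.prodMk_nhds hr)
  exact h

lemma Flx_iff (c : Fin 12 → ℂ) (a b : ℂ) : Flx c a b ↔ (LI (e12 c) a b, LJ (e12 c) a b) = (0, 0) := by
  rw [Flx, tri_iff_LIJ, Prod.mk.injEq]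

lemma chart_Ind (a b : ℂ) : Ind ![1, 0, a] ![0, 1, b] := by
  intro x y hxy
  have h0 := congrFun hxy 0
  have h1 := congrFun hxy 1
  simp at h0 h1
  exact ⟨h0, h1⟩

lemma chart_rs (k : Fin 15 → ℂ) (a b : ℂ) : rs (QF k) ![1, 0, a] ![0, 1, b] = onLine' k a b := by
  funext x y
  rw [rs_chart]; rfl

/-- a plane vector in the kernel of the dual vector is a combination of `A`, `B` -/
lemma in_span {w A B v : Fin 3 → ℂ} (h : Ind A B) (hw : w ≠ 0) (hA : dotv w A = 0) (hB : dotv w B = 0)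
    (hv : dotv w v = 0) : ∃ p q : ℂ, v = p • A + q • B := by
  obtain ⟨c, hc⟩ := eq_smul_cr h hA hB
  have hc0 : c ≠ 0 := by rintro rfl; exact hw (by simpa using hc)
  have hn : dotv (cr A B) v = 0 := by
    rw [hc] at hv
    simp only [dotv, Pi.smul_apply, smul_eq_mul, mul_assoc, ← Finset.mul_sum] at hv
    exact (mul_eq_zero.1 hv).resolve_left hc0
  have hcr := cr_ne h
  simp only [dotv, Fin.sum_univ_three, cr] at hn
  simp at hn
  by_cases h2 : A 0 * B 1 - A 1 * B 0 = 0
  · by_cases h1 : A 2 * B 0 - A 0 * B 2 = 0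
    · have h0 : A 1 * B 2 - A 2 * B 1 ≠ 0 := by
        intro h0; apply hcr; simp [cr, h0, h1, h2]
      refine ⟨(v 1 * B 2 - v 2 * B 1)/(A 1 * B 2 - A 2 * B 1), (A 1 * v 2 - A 2 * v 1)/(A 1 * B 2 - A 2 * B 1), ?_⟩
      funext j
      fin_cases j <;> simp <;> field_simp <;> grind
    · refine ⟨(v 2 * B 0 - v 0 * B 2)/(A 2 * B 0 - A 0 * B 2), (A 2 * v 0 - A 0 * v 2)/(A 2 * B 0 - A 0 * B 2), ?_⟩
      funext j
      fin_cases j <;> simp <;> field_simp <;> grind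
  · refine ⟨(v 0 * B 1 - v 1 * B 0)/(A 0 * B 1 - A 1 * B 0), (A 0 * v 1 - A 1 * v 0)/(A 0 * B 1 - A 1 * B 0), ?_⟩
    funext j
    fin_cases j <;> simp <;> field_simp <;> grind

lemma tri_chart {f : ℂ → ℂ → ℂ → ℂ} {w A B v u : Fin 3 → ℂ} (h : Ind A B) (hw : w ≠ 0)
    (hA : dotv w A = 0) (hB : dotv w B = 0) (hv : dotv w v = 0) (hu : dotv w u = 0)
    (ht : Tri (rs f A B)) : Tri (rs f v u) := by
  obtain ⟨p, q, rfl⟩ := in_span h hw hA hB hv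
  obtain ⟨r, s, rfl⟩ := in_span h hw hA hB hu
  have := ht.comp p r q s
  convert this using 2
  funext y
  simp only [rs, Pi.add_apply, Pi.smul_apply, smul_eq_mul]
  congr 1 <;> ring

lemma shared {N : Matrix (Fin 3) (Fin 3) ℂ} (hN : IsUnit N.det) {F₁ F₂ : MvPolynomial (Fin 3) ℂ}
    {c₁ c₂ : Fin 12 → ℂ} (h₁ : Fits N F₁ (e12 c₁)) (h₂ : Fits N F₂ (e12 c₂)) (s₁ : Sm F₁) (s₂ : Sm F₂)
    {T : Finset (Fin 3 → ℂ)} (hT : FinT (e12 c₁) T) {μ : (Fin 3 → ℂ) → ℕ}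
    (l₁ : IsLimitConfig F₁ μ) (l₂ : IsLimitConfig F₂ μ) {a b : ℂ} (hfl : Flx c₁ a b) : Flx c₂ a b := by
  have hAB := Ind.mulVec hN (chart_Ind a b)
  set A := N.mulVec ![1, 0, a] with hA
  set B := N.mulVec ![0, 1, b] with hB
  set w₀ := cr A B with hw₀
  have hw0 : w₀ ≠ 0 := cr_ne hAB
  obtain ⟨dA, dB⟩ := cr_dot A B
  have ht : Tri (rsF F₁ A B) := by
    rw [hA, hB, h₁.rs, chart_rs]; exact hfl
  have hpos : ∀ ε : ℝ, 0 < ε → inflNear F₁ w₀ ε ≠ 0 := fun ε hε =>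
    near_pos (finite_support hN h₁ hT) s₁ hw0 hAB dA dB ht hε
  have hμ : μ w₀ ≠ 0 := by
    obtain ⟨ε, hε, hε0⟩ := ((const_limit s₁ l₁ hw0).and self_mem_nhdsWithin).exists
    rw [← hε]
    exact hpos ε hε0
  set v₀ := Matrix.vecMul w₀ N with hv₀
  have hv0 : v₀ ≠ 0 := vecMul_ne hN hw0
  rw [← hw₀, hA, dotv_vecMul, ← hv₀] at dA
  rw [← hw₀, hB, dotv_vecMul, ← hv₀] at dB
  simp [dotv, Fin.sum_univ_three] at dA dB
  have hv2 : v₀ 2 ≠ 0 := by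
    intro h2
    apply hv0
    funext i
    rw [h2] at dA dB
    fin_cases i <;> simp at dA dB ⊢ <;> assumption
  have ea : a = - v₀ 0 / v₀ 2 := by field_simp; linear_combination dA
  have eb : b = - v₀ 1 / v₀ 2 := by field_simp; linear_combination dB
  by_contra hno
  have hcont : ContinuousAt (fun w : Fin 3 → ℂ => (LI (e12 c₂) (- (Matrix.vecMul w N) 0 / (Matrix.vecMul w N) 2)
      (- (Matrix.vecMul w N) 1 / (Matrix.vecMul w N) 2), LJ (e12 c₂) (- (Matrix.vecMul w N) 0 / (Matrix.vecMul w N) 2)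
      (- (Matrix.vecMul w N) 1 / (Matrix.vecMul w N) 2))) w₀ := by
    have hc : ∀ i, Continuous (fun w : Fin 3 → ℂ => (Matrix.vecMul w N) i) := by
      intro i
      simp only [Matrix.vecMul, dotProduct]
      fun_prop
    exact LI_contAt (e12 c₂) ((hc 0).neg.continuousAt.div (hc 2).continuousAt hv2)
      ((hc 1).neg.continuousAt.div (hc 2).continuousAt hv2)
  have hc2 : Continuous (fun w : Fin 3 → ℂ => (Matrix.vecMul w N) 2) := by
    simp only [Matrix.vecMul, dotProduct]
    fun_prop
  rw [Flx_iff, ea, eb] at hno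
  have hev := (hcont.eventually_ne hno).and (hc2.continuousAt.eventually_ne hv2)
  obtain ⟨δ, hδ, hball⟩ := Metric.eventually_nhds_iff.1 hev
  obtain ⟨ε, hε, hεδ⟩ := ((const_limit s₂ l₂ hw0).and
    (Ioo_mem_nhdsGT hδ)).exists
  rw [← hε] at hμ
  obtain ⟨w', A', B', hn, hAB', hA', hB', ht'⟩ := near_exists s₂.1 hμ
  obtain ⟨hne, h2⟩ := hball (y := w') (by rw [dist_eq_norm]; exact hn.trans hεδ.2)
  apply hne
  rw [← Flx_iff]
  set v := Matrix.vecMul w' N with hv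
  have hr := h₂.rs (N⁻¹.mulVec A') (N⁻¹.mulVec B')
  rw [(inv_cancel hN A').1, (inv_cancel hN B').1] at hr
  rw [hr] at ht'
  rw [← (inv_cancel hN A').1, dotv_vecMul, ← hv] at hA'
  rw [← (inv_cancel hN B').1, dotv_vecMul, ← hv] at hB'
  rw [Flx, ← chart_rs]
  refine tri_chart (Ind.mulVec (inv_det hN) hAB') (w := v) ?_ hA' hB' ?_ ?_ ht'
  · intro h0; apply h2; rw [h0]; rfl
  · simp [dotv, Fin.sum_univ_three]; field_simp; ring
  · simp [dotv, Fin.sum_univ_three]; field_simp; ring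

def kk (N : Matrix (Fin 3) (Fin 3) ℂ) (F : MvPolynomial (Fin 3) ℂ) : Fin 15 → ℂ :=
  fun i => (transformPoly N F).coeff (mk i)

lemma kk_fits (N : Matrix (Fin 3) (Fin 3) ℂ) {F : MvPolynomial (Fin 3) ℂ} (hF : F.IsHomogeneous 4) :
    Fits N F (kk N F) := by
  refine ⟨hF, fun v => ?_⟩
  rw [← tp_eval, hom_eval (tp_hom hF N)]; rfl

lemma Fits.unique {N : Matrix (Fin 3) (Fin 3) ℂ} {F : MvPolynomial (Fin 3) ℂ} {k : Fin 15 → ℂ}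
    (h : Fits N F k) : kk N F = k := by
  have h1 := kk_fits N h.1
  have : transformPoly N F = PK k := by
    apply MvPolynomial.funext
    intro v
    rw [tp_eval, h.2, PK_eval]
  funext i
  rw [kk, this, PK_coeff]

def Lam (N : Matrix (Fin 3) (Fin 3) ℂ) (i : Fin 15) : MvPolynomial (Fin 3 →₀ ℕ) ℂ :=
  ∑ j, MvPolynomial.C ((transformPoly N (MvPolynomial.monomial (mk j) 1)).coeff (mk i)) *
    MvPolynomial.X (mk j)

lemma Lam_eval (N : Matrix (Fin 3) (Fin 3) ℂ) (i : Fin 15) {F : MvPolynomial (Fin 3) ℂ}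
    (hF : F.IsHomogeneous 4) : coeffEval (Lam N i) F = kk N F i := by
  have h : transformPoly N F = ∑ j, F.coeff (mk j) • transformPoly N (MvPolynomial.monomial (mk j) 1) := by
    conv_lhs => rw [eq_PK hF]
    simp only [PK, transformPoly, map_sum]
    refine Finset.sum_congr rfl fun j _ => ?_
    rw [← map_smul, MvPolynomial.smul_monomial, smul_eq_mul, mul_one]
  rw [kk, h]
  simp only [coeffEval, Lam, map_sum, map_mul, MvPolynomial.eval_C, MvPolynomial.eval_X,
    MvPolynomial.coeff_sum, MvPolynomial.coeff_smul, smul_eq_mul]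
  exact Finset.sum_congr rfl fun j _ => mul_comm _ _

def PhiOf (N : Matrix (Fin 3) (Fin 3) ℂ) (Ψ : MvPolynomial (Fin 12) ℂ) : MvPolynomial (Fin 3 →₀ ℕ) ℂ :=
  MvPolynomial.bind₁ (fun j : Fin 12 => Lam N (j.castLE (by norm_num))) Ψ

lemma PhiOf_eval (N : Matrix (Fin 3) (Fin 3) ℂ) (Ψ : MvPolynomial (Fin 12) ℂ) {F : MvPolynomial (Fin 3) ℂ}
    (hF : F.IsHomogeneous 4) : coeffEval (PhiOf N Ψ) F = MvPolynomial.eval (r12 (kk N F)) Ψ := by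
  rw [coeffEval, PhiOf, ← MvPolynomial.aeval_eq_eval, MvPolynomial.aeval_bind₁, ← MvPolynomial.aeval_eq_eval]
  congr 2
  funext j
  have := Lam_eval N (j.castLE (by norm_num)) hF
  rw [coeffEval, ← MvPolynomial.aeval_eq_eval] at this
  exact this

lemma cr_smul_of {p u : Fin 3 → ℂ} (h : cr p u ≠ 0) : Ind p u := by
  intro x y hxy
  have h0 := congrFun hxy 0
  have h1 := congrFun hxy 1
  have h2 := congrFun hxy 2
  simp at h0 h1 h2
  obtain ⟨i, hi⟩ := Function.ne_iff.1 h
  simp only [Pi.zero_apply] at hi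
  constructor
  · apply (mul_eq_zero.1 (_ : x * cr p u i = 0)).resolve_right hi
    fin_cases i <;> simp [cr] <;> grind
  · apply (mul_eq_zero.1 (_ : y * cr p u i = 0)).resolve_right hi
    fin_cases i <;> simp [cr] <;> grind

lemma exists_b {w p : Fin 3 → ℂ} (hw : w ≠ 0) (hp : p ≠ 0) (hpL : dotv w p = 0) :
    ∃ b, dotv w b = 0 ∧ Ind p b := by
  obtain ⟨i, hi⟩ := Function.ne_iff.1 hp
  simp only [Pi.zero_apply] at hi
  refine ⟨cr w (Pi.single i 1), ?_, cr_smul_of ?_⟩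
  · simp [dotv, Fin.sum_univ_three, cr]; ring
  · have : cr p (cr w (Pi.single i 1)) = p i • w := by
      simp only [dotv, Fin.sum_univ_three] at hpL
      funext j
      fin_cases i <;> fin_cases j <;> simp [cr] <;> grind
    rw [this]
    exact smul_ne_zero hi hw

lemma V0_kk {w p b : Fin 3 → ℂ} (hw : w ≠ 0) (hpL : dotv w p = 0) (hb : dotv w b = 0) (hpb : Ind p b)
    {N : Matrix (Fin 3) (Fin 3) ℂ} (hv : ∀ v : Fin 3 → ℂ, ∃ D : Fin 3 → ℂ,
      N.mulVec v = v 0 • p + v 1 • b + v 2 • D) {G : MvPolynomial (Fin 3) ℂ} (h : memV0Lp w p G) :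
    kk N G 12 = 0 ∧ kk N G 13 = 0 ∧ kk N G 14 = 0 := by
  obtain ⟨hV, b', hb', hli, hne, hc⟩ := h
  have hfit := kk_fits N hV.1
  obtain ⟨α, β, rfl⟩ := in_span hpb hw hpL hb hb'
  have hβ : β ≠ 0 := by
    rintro rfl
    have := (Ind_iff.2 hli) α (-1) (by simp)
    simp at this
  generalize kk N G = k at hfit
  have hval : ∀ t, (lineRestrict G p (α • p + β • b)).eval t = k 12 + (4*α*k 12 + β*k 13)*t +
      (6*α^2*k 12 + 3*α*β*k 13 + β^2*k 14)*t^2 +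
      (4*α^3*k 12 + 3*α^2*β*k 13 + 2*α*β^2*k 14 + β^3*k 0)*t^3 +
      (α^4*k 12 + α^3*β*k 13 + α^2*β^2*k 14 + α*β^3*k 0 + β^4*k 1)*t^4 := by
    intro t
    rw [lr_eval]
    obtain ⟨D, hD⟩ := hv ![1 + α*t, β*t, 0]
    have h1 := hfit.2 ![1 + α*t, β*t, 0]
    have e : p + t • (α • p + β • b) = N.mulVec ![1 + α*t, β*t, 0] := by
      rw [hD]
      funext i
      simp; ring
    rw [e, h1]
    simp [QF]; ring
  obtain ⟨c0, c1, c2, -⟩ := poly_coeffs hval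
  have hd : Polynomial.X^3 ∣ lineRestrict G p (α • p + β • b) := by
    have := dvd_trans (pow_dvd_pow _ hc) (Polynomial.pow_rootMultiplicity_dvd _ 0)
    simpa using this
  rw [Polynomial.X_pow_dvd_iff] at hd
  rw [hd 0 (by norm_num)] at c0
  rw [hd 1 (by norm_num), ← c0] at c1
  rw [hd 2 (by norm_num), ← c0] at c2
  have k13 : k 13 = 0 := by
    have : β * k 13 = 0 := by linear_combination -c1
    exact (mul_eq_zero.1 this).resolve_left hβ
  rw [k13] at c2
  have k14 : k 14 = 0 := by
    have : β^2 * k 14 = 0 := by linear_combination -c2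
    exact (mul_eq_zero.1 this).resolve_left (pow_ne_zero _ hβ)
  exact ⟨c0.symm, k13, k14⟩

lemma V_kk {w p b : Fin 3 → ℂ} (hw : w ≠ 0) (hpL : dotv w p = 0) (hb : dotv w b = 0) (hpb : Ind p b)
    {N : Matrix (Fin 3) (Fin 3) ℂ} (hv : ∀ v : Fin 3 → ℂ, ∃ D : Fin 3 → ℂ,
      N.mulVec v = v 0 • p + v 1 • b + v 2 • D) {F : MvPolynomial (Fin 3) ℂ} (h : memVLp w p F) :
    e12 (r12 (kk N F)) = kk N F := by
  obtain ⟨hV, hcl⟩ := h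
  have key : ∀ i, (∀ G, memV0Lp w p G → kk N G i = 0) → kk N F i = 0 := by
    intro i hi
    rw [← Lam_eval N i hV.1]
    apply hcl
    intro G hG
    rw [Lam_eval N i hG.1.1]
    exact hi G hG
  exact e12_r12 (key 12 fun G hG => (V0_kk hw hpL hb hpb hv hG).1)
    (key 13 fun G hG => (V0_kk hw hpL hb hpb hv hG).2.1)
    (key 14 fun G hG => (V0_kk hw hpL hb hpb hv hG).2.2)

def wv (a b : ℂ) : Fin 3 → ℂ := ![a, b, -1]

lemma wv_ne (a b : ℂ) : wv a b ≠ 0 := by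
  intro h
  have := congrFun h 2
  simp [wv] at this

lemma wv_perp (a b : ℂ) : dotv (wv a b) ![1, 0, a] = 0 ∧ dotv (wv a b) ![0, 1, b] = 0 := by
  simp [dotv, wv, Fin.sum_univ_three]

lemma scalar_of_eig {W M : Matrix (Fin 3) (Fin 3) ℂ} (hW : IsUnit W.det) {x : Fin 3 → ℂ}
    (hx : ∀ i, x i ≠ 0) {l : Fin 3 → ℂ} {m : ℂ} (hl : ∀ i, Matrix.vecMul (W i) M = l i • W i)
    (hm : Matrix.vecMul (Matrix.vecMul x W) M = m • Matrix.vecMul x W) : M = m • 1 := by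
  have h1 : W * M = Matrix.diagonal l * W := by
    ext i j
    have := congrFun (hl i) j
    rw [Matrix.diagonal_mul]
    simpa [Matrix.vecMul, Matrix.mul_apply, dotProduct] using this
  have h2 : Matrix.vecMul (Matrix.vecMul x (Matrix.diagonal l)) W = Matrix.vecMul (m • x) W := by
    rw [Matrix.vecMul_vecMul, ← h1, ← Matrix.vecMul_vecMul, hm, Matrix.smul_vecMul]
  have h3 := congrArg (fun v => Matrix.vecMul v W⁻¹) h2
  simp only [Matrix.vecMul_vecMul, Matrix.mul_nonsing_inv_cancel_right _ _ hW,
    Matrix.mul_nonsing_inv _ hW, Matrix.vecMul_one] at h3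
  have h4 : l = fun _ => m := by
    funext i
    have := congrFun h3 i
    rw [Matrix.vecMul_diagonal] at this
    simp only [Pi.smul_apply, smul_eq_mul] at this
    exact mul_left_cancel₀ (hx i) (by linear_combination this)
  have h5 : W * M = W * (m • 1) := by
    rw [h1, h4]
    ext i j
    simp [Matrix.diagonal_mul]
  have h6 := congrArg (fun v => W⁻¹ * v) h5
  simpa only [Matrix.nonsing_inv_mul_cancel_left _ _ hW] using h6

lemma stab_line {N : Matrix (Fin 3) (Fin 3) ℂ} (hN : IsUnit N.det) {F : MvPolynomial (Fin 3) ℂ}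
    {k : Fin 15 → ℂ} (h : Fits N F k) {T : Finset (Fin 3 → ℂ)} (hT : FinT k T) {a b : ℂ}
    (hfl : Tri (onLine' k a b)) {g : Matrix (Fin 3) (Fin 3) ℂ} (hg : IsUnit g.det) {c : ℂ}
    (hc : transformPoly g F = c • F) :
    ∃ u ∈ T, ∃ l : ℂ, l ≠ 0 ∧ Matrix.vecMul u (N⁻¹ * g * N) = l • wv a b := by
  have hdet : IsUnit (N⁻¹ * g * N).det := by
    rw [Matrix.det_mul, Matrix.det_mul]
    exact ((inv_det hN).mul hg).mul hN
  have hval : ∀ v : Fin 3 → ℂ, QF k ((N⁻¹ * g * N).mulVec v 0) ((N⁻¹ * g * N).mulVec v 1)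
      ((N⁻¹ * g * N).mulVec v 2) = c * QF k (v 0) (v 1) (v 2) := by
    intro v
    rw [← h.2, ← h.2, ← Matrix.mulVec_mulVec, ← Matrix.mulVec_mulVec, (inv_cancel hN _).1,
      ← tp_eval, hc, MvPolynomial.smul_eval]
  set H := N⁻¹ * g * N with hH
  have htri : Tri (rs (QF k) (H.mulVec ![1, 0, a]) (H.mulVec ![0, 1, b])) := by
    have h1 := hfl.smul c
    rw [← chart_rs] at h1
    convert h1 using 1
    funext x y
    have := hval (x • ![1, 0, a] + y • ![0, 1, b])
    rw [Matrix.mulVec_add, Matrix.mulVec_smul, Matrix.mulVec_smul] at this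
    simpa [rs] using this
  obtain ⟨u, hu, hA, hB⟩ := hT.2 _ _ ((chart_Ind a b).mulVec hdet) htri
  rw [lv_dotv, dotv_vecMul] at hA hB
  obtain ⟨l, hl⟩ := perp_unique (chart_Ind a b) (wv_perp a b).1 (wv_perp a b).2 hA hB (wv_ne a b)
  refine ⟨u, hu, l, ?_, hl⟩
  rintro rfl
  rw [zero_smul] at hl
  exact vecMul_ne hdet (hT.1 u hu) hl

lemma stab_finite {N : Matrix (Fin 3) (Fin 3) ℂ} (hN : IsUnit N.det) {F : MvPolynomial (Fin 3) ℂ}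
    {k : Fin 15 → ℂ} (h : Fits N F k) {T : Finset (Fin 3 → ℂ)} (hT : FinT k T) {a b : Fin 3 → ℂ}
    {a' b' : ℂ} (hfl : ∀ i, Tri (onLine' k (a i) (b i))) (hfl' : Tri (onLine' k a' b'))
    {x : Fin 3 → ℂ} (hx : ∀ i, x i ≠ 0)
    (hW : IsUnit (Matrix.of fun i => wv (a i) (b i)).det)
    (hw' : wv a' b' = Matrix.vecMul x (Matrix.of fun i => wv (a i) (b i))) : ProjStabFinite F := by
  classical
  set W : Matrix (Fin 3) (Fin 3) ℂ := Matrix.of fun i => wv (a i) (b i) with hWd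
  let R : (Fin 3 → T) × T → Matrix (Fin 3) (Fin 3) ℂ → Prop := fun q g => IsUnit g.det ∧
    (∀ i, ∃ l : ℂ, l ≠ 0 ∧ Matrix.vecMul (q.1 i : Fin 3 → ℂ) (N⁻¹ * g * N) = l • wv (a i) (b i)) ∧
    ∃ l : ℂ, l ≠ 0 ∧ Matrix.vecMul (q.2 : Fin 3 → ℂ) (N⁻¹ * g * N) = l • wv a' b'
  let f : (Fin 3 → T) × T → Matrix (Fin 3) (Fin 3) ℂ := fun q =>
    if hq : ∃ g, R q g then hq.choose else 0
  refine ⟨Set.range f, Set.finite_range f, ?_⟩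
  rintro g ⟨c, -, hc⟩
  have hg := GL_det g
  choose u hu l hl hul using fun i => stab_line hN h hT (hfl i) hg hc
  obtain ⟨u', hu', l', hl', hul'⟩ := stab_line hN h hT hfl' hg hc
  set G : Matrix (Fin 3) (Fin 3) ℂ := (g : Matrix (Fin 3) (Fin 3) ℂ)
  let q : (Fin 3 → T) × T := (fun i => ⟨u i, hu i⟩, ⟨u', hu'⟩)
  have hq : ∃ g, R q g := ⟨G, hg, fun i => ⟨l i, hl i, hul i⟩, l', hl', hul'⟩
  have hf : R q (f q) := by
    simp only [f, dif_pos hq]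
    exact hq.choose_spec
  refine ⟨f q, ⟨q, rfl⟩, ?_⟩
  generalize f q = g₀ at hf
  obtain ⟨hg₀, h1, h2⟩ := hf
  have step : ∀ (u w : Fin 3 → ℂ) (l : ℂ), Matrix.vecMul u (N⁻¹ * G * N) = l • w →
      (∃ l₀ : ℂ, l₀ ≠ 0 ∧ Matrix.vecMul u (N⁻¹ * g₀ * N) = l₀ • w) →
      ∃ s : ℂ, Matrix.vecMul w (N⁻¹ * (g₀⁻¹ * G) * N) = s • w := by
    rintro u w l hu ⟨l₀, hl₀, hu₀⟩
    refine ⟨l₀⁻¹ * l, ?_⟩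
    have : w = l₀⁻¹ • Matrix.vecMul u (N⁻¹ * g₀ * N) := by
      rw [hu₀, smul_smul, inv_mul_cancel₀ hl₀, one_smul]
    conv_lhs => rw [this]
    rw [Matrix.smul_vecMul, Matrix.vecMul_vecMul]
    have e : N⁻¹ * g₀ * N * (N⁻¹ * (g₀⁻¹ * G) * N) = N⁻¹ * G * N := by
      simp only [Matrix.mul_assoc]
      rw [Matrix.mul_nonsing_inv_cancel_left _ _ hN, Matrix.mul_nonsing_inv_cancel_left _ _ hg₀]
    rw [e, hu, smul_smul]
  choose s hs using fun i => step (u i) _ _ (hul i) (h1 i)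
  obtain ⟨m, hm⟩ := step u' _ _ hul' h2
  rw [hw'] at hm
  have key := scalar_of_eig hW hx (l := s) (m := m) hs hm
  have e1 : g₀⁻¹ * G = m • 1 := by
    have : N * (N⁻¹ * (g₀⁻¹ * G) * N) * N⁻¹ = g₀⁻¹ * G := by
      rw [Matrix.mul_assoc, Matrix.mul_nonsing_inv_cancel_right _ _ hN,
        Matrix.mul_nonsing_inv_cancel_left _ _ hN]
    rw [← this, key]
    simp [Matrix.mul_nonsing_inv _ hN]
  have e2 : G = m • g₀ := by
    rw [← Matrix.mul_nonsing_inv_cancel_left g₀ G hg₀, e1]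
    simp
  refine ⟨m, ?_, e2⟩
  rintro rfl
  rw [e2] at hg
  simp at hg

def dd (a b c d e f : ℂ) : ℂ := a*d - c*b + c*f - e*d + e*b - a*f

lemma dd_lim {a b c d e f : ℕ → ℂ} {a' b' c' d' e' f' : ℂ} (h1 : Tendsto a atTop (nhds a'))
    (h2 : Tendsto b atTop (nhds b')) (h3 : Tendsto c atTop (nhds c')) (h4 : Tendsto d atTop (nhds d'))
    (h5 : Tendsto e atTop (nhds e')) (h6 : Tendsto f atTop (nhds f')) (hne : dd a' b' c' d' e' f' ≠ 0) :
    ∀ᶠ n in atTop, dd (a n) (b n) (c n) (d n) (e n) (f n) ≠ 0 := by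
  have : Tendsto (fun n => dd (a n) (b n) (c n) (d n) (e n) (f n)) atTop (nhds (dd a' b' c' d' e' f')) :=
    (((((h1.mul h4).sub (h3.mul h2)).add (h3.mul h6)).sub (h5.mul h4)).add (h5.mul h2)).sub (h1.mul h6)
  exact this.eventually_ne hne

lemma stab_finite' {N : Matrix (Fin 3) (Fin 3) ℂ} (hN : IsUnit N.det) {F : MvPolynomial (Fin 3) ℂ}
    {k : Fin 15 → ℂ} (h : Fits N F k) {T : Finset (Fin 3 → ℂ)} (hT : FinT k T)
    {a1 b1 a2 b2 a3 b3 a4 b4 : ℂ}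
    (f1 : Tri (onLine' k a1 b1)) (f2 : Tri (onLine' k a2 b2)) (f3 : Tri (onLine' k a3 b3))
    (f4 : Tri (onLine' k a4 b4)) (d0 : dd a1 b1 a2 b2 a3 b3 ≠ 0) (d1 : dd a4 b4 a2 b2 a3 b3 ≠ 0)
    (d2 : dd a1 b1 a4 b4 a3 b3 ≠ 0) (d3 : dd a1 b1 a2 b2 a4 b4 ≠ 0) : ProjStabFinite F := by
  refine stab_finite hN h hT (a := ![a1, a2, a3]) (b := ![b1, b2, b3]) (a' := a4) (b' := b4)
    (x := ![dd a4 b4 a2 b2 a3 b3 / dd a1 b1 a2 b2 a3 b3, dd a1 b1 a4 b4 a3 b3 / dd a1 b1 a2 b2 a3 b3,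
      dd a1 b1 a2 b2 a4 b4 / dd a1 b1 a2 b2 a3 b3]) ?_ f4 ?_ ?_ ?_
  · intro i
    fin_cases i
    exacts [f1, f2, f3]
  · intro i
    fin_cases i
    exacts [div_ne_zero d1 d0, div_ne_zero d2 d0, div_ne_zero d3 d0]
  · rw [isUnit_iff_ne_zero, Matrix.det_fin_three]
    intro h0
    apply d0
    simp [wv] at h0
    unfold dd
    linear_combination -h0
  · funext j
    fin_cases j <;> simp [Matrix.vecMul, dotProduct, Fin.sum_univ_three, wv] <;>
      field_simp <;> simp only [dd] <;> ring

lemma fits_PK {N : Matrix (Fin 3) (Fin 3) ℂ} (hN : IsUnit N.det) (k : Fin 15 → ℂ) :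
    Fits N (transformPoly N⁻¹ (PK k)) k := by
  refine ⟨tp_hom (PK_hom k) _, fun v => ?_⟩
  rw [tp_eval, (inv_cancel hN v).2, PK_eval]

lemma good_param {Ψ : MvPolynomial (Fin 12) ℂ} (hΨ : Ψ ≠ 0) : ∃ c : Fin 12 → ℂ, MvPolynomial.eval c Ψ ≠ 0 ∧
    ∃ a1 b1 a2 b2 a3 b3 a4 b4 : ℂ, Tri (onLine' (e12 c) a1 b1) ∧ Tri (onLine' (e12 c) a2 b2) ∧
      Tri (onLine' (e12 c) a3 b3) ∧ Tri (onLine' (e12 c) a4 b4) ∧ dd a1 b1 a2 b2 a3 b3 ≠ 0 ∧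
      dd a4 b4 a2 b2 a3 b3 ≠ 0 ∧ dd a1 b1 a4 b4 a3 b3 ≠ 0 ∧ dd a1 b1 a2 b2 a4 b4 ≠ 0 := by
  obtain ⟨ω, hω⟩ := exists_omega
  obtain ⟨C, G, t, Gn, hC, hG, ht, ht0, hGn, he, hev⟩ := exists_seq hω hΨ
  obtain ⟨a1, b1, ha1, hb1, h1⟩ := Fr.cluster fr1 (fr1_OK hω hC hG) hω hC ht ht0 hGn
  obtain ⟨a2, b2, ha2, hb2, h2⟩ := Fr.cluster (fr2 ω hω) (fr2_OK hω hC hG) hω hC ht ht0 hGn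
  obtain ⟨a3, b3, ha3, hb3, h3⟩ := Fr.cluster (fr3 ω hω) (fr3_OK hω hC hG) hω hC ht ht0 hGn
  obtain ⟨a4, b4, ha4, hb4, h4⟩ := Fr.cluster (fr4 ω) (fr4_OK hω hC hG) hω hC ht ht0 hGn
  have hs : 2*ω+1 ≠ 0 := by
    intro h
    have h3 : (3:ℂ) = 0 := by linear_combination 4*hω - (2*ω+1)*h
    norm_num at h3
  have E1 : fr1.α * fr1.m0 + fr1.β * fr1.m2 = 0 := by simp [fr1]
  have E1' : fr1.α * fr1.m1 + fr1.β * fr1.m3 = 0 := by simp [fr1]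
  have E2 : (fr2 ω hω).α * (fr2 ω hω).m0 + (fr2 ω hω).β * (fr2 ω hω).m2 = 1 := by
    simp only [fr2]; ring
  have E2' : (fr2 ω hω).α * (fr2 ω hω).m1 + (fr2 ω hω).β * (fr2 ω hω).m3 = 1 := by
    simp only [fr2]; ring
  have E3 : (fr3 ω hω).α * (fr3 ω hω).m0 + (fr3 ω hω).β * (fr3 ω hω).m2 = ω := by
    simp only [fr3]; linear_combination (4/3)*hω
  have E3' : (fr3 ω hω).α * (fr3 ω hω).m1 + (fr3 ω hω).β * (fr3 ω hω).m3 = -1-ω := by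
    simp only [fr3]; linear_combination (4/3)*hω
  have E4 : (fr4 ω).α * (fr4 ω).m0 + (fr4 ω).β * (fr4 ω).m2 = 1+ω := by
    simp only [fr4]; ring
  have E4' : (fr4 ω).α * (fr4 ω).m1 + (fr4 ω).β * (fr4 ω).m3 = -ω := by
    simp only [fr4]; ring
  rw [E1] at ha1
  rw [E1'] at hb1
  rw [E2] at ha2
  rw [E2'] at hb2
  rw [E3] at ha3
  rw [E3'] at hb3
  rw [E4] at ha4
  rw [E4'] at hb4
  have hn : ∀ x : ℂ, x = 2*ω+1 ∨ x = -(2*ω+1) → x ≠ 0 := by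
    rintro x (rfl | rfl)
    exacts [hs, neg_ne_zero.2 hs]
  have D0 := dd_lim ha1 hb1 ha2 hb2 ha3 hb3 (by apply hn; unfold dd; right; ring)
  have D1 := dd_lim ha4 hb4 ha2 hb2 ha3 hb3 (by apply hn; unfold dd; left; ring)
  have D2 := dd_lim ha1 hb1 ha4 hb4 ha3 hb3 (by
    apply hn; unfold dd; right; linear_combination 0*hω)
  have D3 := dd_lim ha1 hb1 ha2 hb2 ha4 hb4 (by apply hn; unfold dd; right; ring)
  obtain ⟨n, h1, h2, h3, h4, D0, D1, D2, D3⟩ :=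
    (h1.and (h2.and (h3.and (h4.and (D0.and (D1.and (D2.and D3))))))).exists
  refine ⟨r12 (C + t n • Gn n), hev n, a1 n, b1 n, a2 n, b2 n, a3 n, b3 n, a4 n, b4 n, ?_⟩
  rw [he n]
  exact ⟨h1, h2, h3, h4, D0, D1, D2, D3⟩

lemma witness {w p b : Fin 3 → ℂ} (hb : dotv w b = 0) (hpb : Ind p b)
    {N : Matrix (Fin 3) (Fin 3) ℂ} (hN : IsUnit N.det) (hv : ∀ v : Fin 3 → ℂ, ∃ D : Fin 3 → ℂ,
      N.mulVec v = v 0 • p + v 1 • b + v 2 • D) {F : MvPolynomial (Fin 3) ℂ} {c : Fin 12 → ℂ}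
    (h : Fits N F (e12 c)) (hc : c 0 ≠ 0) (hs : Sm F) (hst : ProjStabFinite F) : memVLp w p F := by
  have hV : memV F := ⟨h.1, hs.squarefree, hs.git, hst⟩
  refine ⟨hV, fun Φ hΦ => hΦ F ⟨hV, b, hb, Ind_iff.1 hpb, ?_⟩⟩
  have hL : lineRestrict F p b = Polynomial.X^3 * (Polynomial.C (c 0) + Polynomial.C (c 1) * Polynomial.X) := by
    apply Polynomial.funext
    intro t
    rw [lr_eval]
    obtain ⟨D, hD⟩ := hv ![1, t, 0]
    have h1 := h.2 ![1, t, 0]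
    have e : p + t • b = N.mulVec ![1, t, 0] := by
      rw [hD]
      funext i
      simp
    rw [e, h1]
    simp [QF, e12]
    ring
  have hne : lineRestrict F p b ≠ 0 := by
    rw [hL]
    refine mul_ne_zero (pow_ne_zero _ Polynomial.X_ne_zero) fun h0 => hc ?_
    have := congrArg (Polynomial.eval 0) h0
    simpa using this
  refine ⟨hne, ?_⟩
  rw [contactAt, Polynomial.le_rootMultiplicity_iff hne, hL]
  simp

lemma main_thm (w p : Fin 3 → ℂ) (hw : w ≠ 0) (hp : p ≠ 0) (hpL : dotv w p = 0) :
    ∃ Φ : MvPolynomial (Fin 3 →₀ ℕ) ℂ,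
      (∃ F : MvPolynomial (Fin 3) ℂ, memVLp w p F ∧ coeffEval Φ F ≠ 0) ∧
      ∀ F₁ F₂ : MvPolynomial (Fin 3) ℂ, memVLp w p F₁ → memVLp w p F₂ →
        coeffEval Φ F₁ ≠ 0 → coeffEval Φ F₂ ≠ 0 →
        (∃ μ : (Fin 3 → ℂ) → ℕ, IsLimitConfig F₁ μ ∧ IsLimitConfig F₂ μ) →
        ∃ c : ℂ, c ≠ 0 ∧ F₂ = c • F₁ := by
  obtain ⟨Ψ, hΨ, hgood, hinj⟩ := thmB
  obtain ⟨b, hb, hpb⟩ := exists_b hw hp hpL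
  obtain ⟨N, hN, hv⟩ := exists_frame hpb
  refine ⟨PhiOf N Ψ, ?_, ?_⟩
  · obtain ⟨c, hc, a1, b1, a2, b2, a3, b3, a4, b4, f1, f2, f3, f4, d0, d1, d2, d3⟩ := good_param hΨ
    obtain ⟨hc0, hsm, T, hT⟩ := hgood c hc
    have hfit := fits_PK hN (e12 c)
    refine ⟨_, witness hb hpb hN hv hfit hc0 (hfit.sm hN hsm)
      (stab_finite' hN hfit hT f1 f2 f3 f4 d0 d1 d2 d3), ?_⟩
    rw [PhiOf_eval N Ψ hfit.1, hfit.unique, r12_e12]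
    exact hc
  · rintro F₁ F₂ m₁ m₂ n₁ n₂ ⟨μ, l₁, l₂⟩
    have fit₁ := kk_fits N m₁.1.1
    have fit₂ := kk_fits N m₂.1.1
    rw [PhiOf_eval N Ψ fit₁.1] at n₁
    rw [PhiOf_eval N Ψ fit₂.1] at n₂
    rw [← V_kk hw hpL hb hpb hv m₁] at fit₁
    rw [← V_kk hw hpL hb hpb hv m₂] at fit₂
    generalize r12 (kk N F₁) = c₁ at *
    generalize r12 (kk N F₂) = c₂ at *
    obtain ⟨-, s₁, T, hT⟩ := hgood c₁ n₁
    obtain ⟨z₂, s₂, -⟩ := hgood c₂ n₂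
    obtain ⟨m, hm⟩ := hinj c₁ c₂ n₁ n₂ fun a b hfl =>
      shared hN fit₁ fit₂ (fit₁.sm hN s₁) (fit₂.sm hN s₂) hT l₁ l₂ hfl
    refine ⟨m, ?_, ?_⟩
    · rintro rfl
      rw [zero_smul] at hm
      exact z₂ (by rw [hm]; rfl)
    · apply MvPolynomial.funext
      intro v
      rw [MvPolynomial.smul_eval, ← (inv_cancel hN v).1, fit₁.2, fit₂.2, hm, e12_smul, QF_smul]

theorem generic_injectivity_on_VLp
    (w p : Fin 3 → ℂ) (hw : w ≠ 0) (hp : p ≠ 0) (hpL : dotv w p = 0) :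
    ∃ Φ : MvPolynomial (Fin 3 →₀ ℕ) ℂ,
      -- `{Φ ≠ 0}` cuts out a nonempty open subset of `𝒱_{L,p}`:
      (∃ F : MvPolynomial (Fin 3) ℂ, memVLp w p F ∧ coeffEval Φ F ≠ 0) ∧
      -- `ℱ` is injective on this open subset:
      ∀ F₁ F₂ : MvPolynomial (Fin 3) ℂ, memVLp w p F₁ → memVLp w p F₂ →
        coeffEval Φ F₁ ≠ 0 → coeffEval Φ F₂ ≠ 0 →
        (∃ μ : (Fin 3 → ℂ) → ℕ, IsLimitConfig F₁ μ ∧ IsLimitConfig F₂ μ) →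
        ∃ c : ℂ, c ≠ 0 ∧ F₂ = c • F₁ := by
  exact main_thm w p hw hp hpL

end Infl
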